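/- Suppose MN > 0 and M ≠ N. Every finite-dimensional simple U_q(Lsl(M,N))-module is isomorphic to π*(S'(P̲, f, c)|_U) for some (P̲, f, c) ∈ R_{M,N} and some π ∈ D, where S'(P̲, f, c)|_U denotes restriction of the U'-module S'(P̲, f, c) along the inclusion U ↪ U' and π* denotes twisting the action by the automorphism π. -/

import Mathlib

noncomputable section

namespace QAS

open Polynomial
open scoped TensorProduct

/-! ### Basic combinatorial data -/

/-- `l_i = 1` for `i ≤ M`, `-1` otherwise. -/
def lof (M : ℕ) (i : ℕ) : ℤ := if i ≤ M then 1 else -1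

/-- the bilinear form `(ε_i, ε_j) = l_i δ_{ij}`. -/
def innerE (M : ℕ) (i j : ℕ) : ℤ := if i = j then lof M i else 0

/-- `(ε_a − ε_b, ε_c − ε_d)`. -/
def form4 (M : ℕ) (a b c d : ℕ) : ℤ :=
  innerE M a c - innerE M a d - innerE M b c + innerE M b d

/-- the Cartan pairing `c_{ij} = (ε_i − ε_{i+1}, ε_j − ε_{j+1})`. -/
def cc (M : ℕ) (i j : ℕ) : ℤ := form4 M i (i + 1) j (j + 1)

/-- `q_i = q^{l_i}`. -/
def qpar (q : ℂ) (M : ℕ) (i : ℕ) : ℂ := q ^ lof M i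

/-- the quantum integer `[m]_v`. -/
def qint (v : ℂ) (m : ℤ) : ℂ := (v ^ m - v ^ (-m)) / (v - v⁻¹)

/-- the sign `(−1)^{|X_i||X_j|}` for the generators `X_i`, `X_j`. -/
def sgn (M : ℕ) (i j : ℕ) : ℂ := if i = M ∧ j = M then -1 else 1

/-- index set `1 ≤ i ≤ M+N−1`. -/
abbrev Idx (M N : ℕ) := {i : ℕ // 1 ≤ i ∧ i ≤ M + N - 1}

/-! ### Generators and the free superalgebra -/

/-- Drinfel'd generators; when `ext = true` we also have `K₀^{±1}`. -/
inductive Gen (M N : ℕ) (ext : Bool) : Type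
  | Xp : Idx M N → ℤ → Gen M N ext
  | Xm : Idx M N → ℤ → Gen M N ext
  | K : Idx M N → Gen M N ext
  | Ki : Idx M N → Gen M N ext
  | H : Idx M N → {s : ℤ // s ≠ 0} → Gen M N ext
  | K0 : ext = true → Gen M N ext
  | K0i : ext = true → Gen M N ext

abbrev FA (M N : ℕ) (ext : Bool) := FreeAlgebra ℂ (Gen M N ext)

def gi {M N : ℕ} {ext : Bool} (g : Gen M N ext) : FA M N ext := FreeAlgebra.ι ℂ g

def XpF (M N : ℕ) (ext : Bool) (i : ℕ) (n : ℤ) : FA M N ext :=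
  if h : 1 ≤ i ∧ i ≤ M + N - 1 then gi (Gen.Xp ⟨i, h⟩ n) else 0

def XmF (M N : ℕ) (ext : Bool) (i : ℕ) (n : ℤ) : FA M N ext :=
  if h : 1 ≤ i ∧ i ≤ M + N - 1 then gi (Gen.Xm ⟨i, h⟩ n) else 0

def KF (M N : ℕ) (ext : Bool) (i : ℕ) : FA M N ext :=
  if h : 1 ≤ i ∧ i ≤ M + N - 1 then gi (Gen.K ⟨i, h⟩) else 0

def KiF (M N : ℕ) (ext : Bool) (i : ℕ) : FA M N ext :=
  if h : 1 ≤ i ∧ i ≤ M + N - 1 then gi (Gen.Ki ⟨i, h⟩) else 0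

def HF (M N : ℕ) (ext : Bool) (i : ℕ) (s : ℤ) : FA M N ext :=
  if h : (1 ≤ i ∧ i ≤ M + N - 1) ∧ s ≠ 0 then gi (Gen.H ⟨i, h.1⟩ ⟨s, h.2⟩) else 0

def K0F (M N : ℕ) (ext : Bool) : FA M N ext :=
  if h : ext = true then gi (Gen.K0 h) else 0

def K0iF (M N : ℕ) (ext : Bool) : FA M N ext :=
  if h : ext = true then gi (Gen.K0i h) else 0

/-- coefficients of `exp (t · Σ_{s ≥ 1} a_s z^s)`. -/
def expC {A : Type} [Ring A] [Algebra ℂ A] (t : ℂ) (a : ℕ → A) : ℕ → A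
  | 0 => 1
  | n + 1 =>
      ((n : ℂ) + 1)⁻¹ •
        (t • ∑ s ∈ Finset.range (n + 1), ((s : ℂ) + 1) • (a (s + 1) * expC t a (n - s)))
termination_by n => n
decreasing_by omega

/-- `φ⁺_{i,n}`, the coefficient of `z^n` in
`K_i exp((q_i − q_i⁻¹) Σ_{s>0} h_{i,s} z^s)`. -/
def phiPF (q : ℂ) (M N : ℕ) (ext : Bool) (i : ℕ) (n : ℤ) : FA M N ext :=
  if 0 ≤ n then
    KF M N ext i *
      expC (qpar q M i - (qpar q M i)⁻¹) (fun s => HF M N ext i (s : ℤ)) n.toNat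
  else 0

/-- `φ⁻_{i,n}`, the coefficient of `z^n` (`n ≤ 0`) in
`K_i⁻¹ exp(−(q_i − q_i⁻¹) Σ_{s>0} h_{i,−s} z^{−s})`. -/
def phiMF (q : ℂ) (M N : ℕ) (ext : Bool) (i : ℕ) (n : ℤ) : FA M N ext :=
  if n ≤ 0 then
    KiF M N ext i *
      expC (-(qpar q M i - (qpar q M i)⁻¹)) (fun s => HF M N ext i (-(s : ℤ))) (-n).toNat
  else 0

/-- the `u`-bracket `[x,y]_u = xy − u·yx` (for `x` or `y` of even parity). -/
def brF {A : Type} [Ring A] [Module ℂ A] (u : ℂ) (x y : A) : A := x * y - u • (y * x)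

/-- the quartic oscillation expression
`[[[X_{M−1,m}, X_{M,n}]_{q⁻¹}, X_{M+1,k}]_q, X_{M,u}]` (a graded anticommutator in the
outermost bracket, both entries being odd). -/
def oscOf {A : Type} [Ring A] [Module ℂ A] (q : ℂ) (M : ℕ) (X : ℕ → ℤ → A) (m n k u : ℤ) : A :=
  brF q (brF q⁻¹ (X (M - 1) m) (X M n)) (X (M + 1) k) * X M u +
    X M u * brF q (brF q⁻¹ (X (M - 1) m) (X M n)) (X (M + 1) k)

/-! ### The defining relations.
`lvl = 1`: only (R1)–(R3);  `lvl = 2`: (R1)–(R5);  `lvl = 3`: all of (R1)–(R7).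
`ext = true` adds `K₀^{±1}` together with its relations. -/

inductive rel (q : ℂ) (M N : ℕ) (ext : Bool) (lvl : ℕ) : FA M N ext → FA M N ext → Prop
  | KKi (i : Idx M N) : rel q M N ext lvl (gi (Gen.K i) * gi (Gen.Ki i)) 1
  | KiK (i : Idx M N) : rel q M N ext lvl (gi (Gen.Ki i) * gi (Gen.K i)) 1
  | KK (i j : Idx M N) :
      rel q M N ext lvl (gi (Gen.K i) * gi (Gen.K j)) (gi (Gen.K j) * gi (Gen.K i))
  | KKi2 (i j : Idx M N) :
      rel q M N ext lvl (gi (Gen.K i) * gi (Gen.Ki j)) (gi (Gen.Ki j) * gi (Gen.K i))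
  | KiKi (i j : Idx M N) :
      rel q M N ext lvl (gi (Gen.Ki i) * gi (Gen.Ki j)) (gi (Gen.Ki j) * gi (Gen.Ki i))
  | KH (i j : Idx M N) (s : {s : ℤ // s ≠ 0}) :
      rel q M N ext lvl (gi (Gen.K i) * gi (Gen.H j s)) (gi (Gen.H j s) * gi (Gen.K i))
  | KiH (i j : Idx M N) (s : {s : ℤ // s ≠ 0}) :
      rel q M N ext lvl (gi (Gen.Ki i) * gi (Gen.H j s)) (gi (Gen.H j s) * gi (Gen.Ki i))
  | HH (i j : Idx M N) (s t : {s : ℤ // s ≠ 0}) :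
      rel q M N ext lvl (gi (Gen.H i s) * gi (Gen.H j t)) (gi (Gen.H j t) * gi (Gen.H i s))
  | KXp (i j : Idx M N) (n : ℤ) :
      rel q M N ext lvl (gi (Gen.K i) * gi (Gen.Xp j n))
        ((q ^ cc M i.1 j.1) • (gi (Gen.Xp j n) * gi (Gen.K i)))
  | KXm (i j : Idx M N) (n : ℤ) :
      rel q M N ext lvl (gi (Gen.K i) * gi (Gen.Xm j n))
        ((q ^ (-cc M i.1 j.1)) • (gi (Gen.Xm j n) * gi (Gen.K i)))
  | HXp (i j : Idx M N) (s : {s : ℤ // s ≠ 0}) (n : ℤ) :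
      rel q M N ext lvl
        (gi (Gen.H i s) * gi (Gen.Xp j n) - gi (Gen.Xp j n) * gi (Gen.H i s))
        ((qint (qpar q M i.1) (s.1 * lof M i.1 * cc M i.1 j.1) / (s.1 : ℂ)) •
          gi (Gen.Xp j (n + s.1)))
  | HXm (i j : Idx M N) (s : {s : ℤ // s ≠ 0}) (n : ℤ) :
      rel q M N ext lvl
        (gi (Gen.H i s) * gi (Gen.Xm j n) - gi (Gen.Xm j n) * gi (Gen.H i s))
        (-((qint (qpar q M i.1) (s.1 * lof M i.1 * cc M i.1 j.1) / (s.1 : ℂ)) •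
          gi (Gen.Xm j (n + s.1))))
  | XpXm (i j : Idx M N) (m n : ℤ) :
      rel q M N ext lvl
        (gi (Gen.Xp i m) * gi (Gen.Xm j n) -
          sgn M i.1 j.1 • (gi (Gen.Xm j n) * gi (Gen.Xp i m)))
        (if i = j then
            (qpar q M i.1 - (qpar q M i.1)⁻¹)⁻¹ •
              (phiPF q M N ext i.1 (m + n) - phiMF q M N ext i.1 (m + n))
          else 0)
  | XX0p (i j : Idx M N) (m n : ℤ) (h2 : 2 ≤ lvl) (h : cc M i.1 j.1 = 0) :
      rel q M N ext lvl
        (gi (Gen.Xp i m) * gi (Gen.Xp j n) -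
          sgn M i.1 j.1 • (gi (Gen.Xp j n) * gi (Gen.Xp i m))) 0
  | XX0m (i j : Idx M N) (m n : ℤ) (h2 : 2 ≤ lvl) (h : cc M i.1 j.1 = 0) :
      rel q M N ext lvl
        (gi (Gen.Xm i m) * gi (Gen.Xm j n) -
          sgn M i.1 j.1 • (gi (Gen.Xm j n) * gi (Gen.Xm i m))) 0
  | XXp (i j : Idx M N) (m n : ℤ) (h2 : 2 ≤ lvl) (h : cc M i.1 j.1 ≠ 0) :
      rel q M N ext lvl
        (gi (Gen.Xp i (m + 1)) * gi (Gen.Xp j n) -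
          (q ^ cc M i.1 j.1) • (gi (Gen.Xp j n) * gi (Gen.Xp i (m + 1))))
        ((q ^ cc M i.1 j.1) • (gi (Gen.Xp i m) * gi (Gen.Xp j (n + 1))) -
          gi (Gen.Xp j (n + 1)) * gi (Gen.Xp i m))
  | XXm (i j : Idx M N) (m n : ℤ) (h2 : 2 ≤ lvl) (h : cc M i.1 j.1 ≠ 0) :
      rel q M N ext lvl
        (gi (Gen.Xm i (m + 1)) * gi (Gen.Xm j n) -
          (q ^ (-cc M i.1 j.1)) • (gi (Gen.Xm j n) * gi (Gen.Xm i (m + 1))))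
        ((q ^ (-cc M i.1 j.1)) • (gi (Gen.Xm i m) * gi (Gen.Xm j (n + 1))) -
          gi (Gen.Xm j (n + 1)) * gi (Gen.Xm i m))
  | serreP (i j : Idx M N) (m n k : ℤ) (h3 : 3 ≤ lvl)
      (h : cc M i.1 j.1 = 1 ∨ cc M i.1 j.1 = -1) (hi : i.1 ≠ M) :
      rel q M N ext lvl
        (brF q (gi (Gen.Xp i m)) (brF q⁻¹ (gi (Gen.Xp i n)) (gi (Gen.Xp j k))) +
          brF q (gi (Gen.Xp i n)) (brF q⁻¹ (gi (Gen.Xp i m)) (gi (Gen.Xp j k)))) 0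
  | serreM (i j : Idx M N) (m n k : ℤ) (h3 : 3 ≤ lvl)
      (h : cc M i.1 j.1 = 1 ∨ cc M i.1 j.1 = -1) (hi : i.1 ≠ M) :
      rel q M N ext lvl
        (brF q (gi (Gen.Xm i m)) (brF q⁻¹ (gi (Gen.Xm i n)) (gi (Gen.Xm j k))) +
          brF q (gi (Gen.Xm i n)) (brF q⁻¹ (gi (Gen.Xm i m)) (gi (Gen.Xm j k)))) 0
  | oscP (m n k u : ℤ) (h3 : 3 ≤ lvl) (hM : 1 < M) (hN : 1 < N) :
      rel q M N ext lvl
        (oscOf q M (XpF M N ext) m n k u + oscOf q M (XpF M N ext) m u k n) 0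
  | oscM (m n k u : ℤ) (h3 : 3 ≤ lvl) (hM : 1 < M) (hN : 1 < N) :
      rel q M N ext lvl
        (oscOf q M (XmF M N ext) m n k u + oscOf q M (XmF M N ext) m u k n) 0
  | K0K0i (he : ext = true) : rel q M N ext lvl (gi (Gen.K0 he) * gi (Gen.K0i he)) 1
  | K0iK0 (he : ext = true) : rel q M N ext lvl (gi (Gen.K0i he) * gi (Gen.K0 he)) 1
  | K0K (he : ext = true) (i : Idx M N) :
      rel q M N ext lvl (gi (Gen.K0 he) * gi (Gen.K i)) (gi (Gen.K i) * gi (Gen.K0 he))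
  | K0Ki (he : ext = true) (i : Idx M N) :
      rel q M N ext lvl (gi (Gen.K0 he) * gi (Gen.Ki i)) (gi (Gen.Ki i) * gi (Gen.K0 he))
  | K0H (he : ext = true) (i : Idx M N) (s : {s : ℤ // s ≠ 0}) :
      rel q M N ext lvl (gi (Gen.K0 he) * gi (Gen.H i s)) (gi (Gen.H i s) * gi (Gen.K0 he))
  | K0Xp (he : ext = true) (i : Idx M N) (n : ℤ) :
      rel q M N ext lvl (gi (Gen.K0 he) * gi (Gen.Xp i n))
        ((q ^ (if i.1 = 1 then (1 : ℤ) else 0)) • (gi (Gen.Xp i n) * gi (Gen.K0 he)))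
  | K0Xm (he : ext = true) (i : Idx M N) (n : ℤ) :
      rel q M N ext lvl (gi (Gen.K0 he) * gi (Gen.Xm i n))
        ((q ^ (if i.1 = 1 then (-1 : ℤ) else 0)) • (gi (Gen.Xm i n) * gi (Gen.K0 he)))

/-! ### The quantum affine superalgebras -/

abbrev ALG (q : ℂ) (M N : ℕ) (ext : Bool) (lvl : ℕ) := RingQuot (rel q M N ext lvl)

def mkA (q : ℂ) (M N : ℕ) (ext : Bool) (lvl : ℕ) : FA M N ext →ₐ[ℂ] ALG q M N ext lvl :=
  RingQuot.mkAlgHom ℂ (rel q M N ext lvl)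

def XpA (q : ℂ) (M N : ℕ) (ext : Bool) (lvl : ℕ) (i : ℕ) (n : ℤ) : ALG q M N ext lvl :=
  mkA q M N ext lvl (XpF M N ext i n)

def XmA (q : ℂ) (M N : ℕ) (ext : Bool) (lvl : ℕ) (i : ℕ) (n : ℤ) : ALG q M N ext lvl :=
  mkA q M N ext lvl (XmF M N ext i n)

def KA (q : ℂ) (M N : ℕ) (ext : Bool) (lvl : ℕ) (i : ℕ) : ALG q M N ext lvl :=
  mkA q M N ext lvl (KF M N ext i)

def KiA (q : ℂ) (M N : ℕ) (ext : Bool) (lvl : ℕ) (i : ℕ) : ALG q M N ext lvl :=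
  mkA q M N ext lvl (KiF M N ext i)

def HA (q : ℂ) (M N : ℕ) (ext : Bool) (lvl : ℕ) (i : ℕ) (s : ℤ) : ALG q M N ext lvl :=
  mkA q M N ext lvl (HF M N ext i s)

def K0A (q : ℂ) (M N : ℕ) (ext : Bool) (lvl : ℕ) : ALG q M N ext lvl :=
  mkA q M N ext lvl (K0F M N ext)

def K0iA (q : ℂ) (M N : ℕ) (ext : Bool) (lvl : ℕ) : ALG q M N ext lvl :=
  mkA q M N ext lvl (K0iF M N ext)

def phiPA (q : ℂ) (M N : ℕ) (ext : Bool) (lvl : ℕ) (i : ℕ) (n : ℤ) : ALG q M N ext lvl :=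
  mkA q M N ext lvl (phiPF q M N ext i n)

def phiMA (q : ℂ) (M N : ℕ) (ext : Bool) (lvl : ℕ) (i : ℕ) (n : ℤ) : ALG q M N ext lvl :=
  mkA q M N ext lvl (phiMF q M N ext i n)

/-- `U⁺`: the subalgebra generated by the `X⁺_{i,n}`. -/
def Aplus (q : ℂ) (M N : ℕ) (ext : Bool) (lvl : ℕ) : Subalgebra ℂ (ALG q M N ext lvl) :=
  Algebra.adjoin ℂ {x | ∃ i : ℕ, ∃ n : ℤ, x = XpA q M N ext lvl i n}

/-- `U⁻`: the subalgebra generated by the `X⁻_{i,n}`. -/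
def Aminus (q : ℂ) (M N : ℕ) (ext : Bool) (lvl : ℕ) : Subalgebra ℂ (ALG q M N ext lvl) :=
  Algebra.adjoin ℂ {x | ∃ i : ℕ, ∃ n : ℤ, x = XmA q M N ext lvl i n}

/-- `U⁰`: the subalgebra generated by the `K_i^{±1}` and `h_{i,s}`. -/
def Azero (q : ℂ) (M N : ℕ) (ext : Bool) (lvl : ℕ) : Subalgebra ℂ (ALG q M N ext lvl) :=
  Algebra.adjoin ℂ {x | (∃ i : ℕ, x = KA q M N ext lvl i) ∨ (∃ i : ℕ, x = KiA q M N ext lvl i) ∨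
    ∃ i : ℕ, ∃ s : ℤ, x = HA q M N ext lvl i s}

/-- `U'⁰`: the subalgebra generated by `U⁰` and `K₀^{±1}`. -/
def AzeroE (q : ℂ) (M N : ℕ) (ext : Bool) (lvl : ℕ) : Subalgebra ℂ (ALG q M N ext lvl) :=
  Algebra.adjoin ℂ {x | (∃ i : ℕ, x = KA q M N ext lvl i) ∨ (∃ i : ℕ, x = KiA q M N ext lvl i) ∨
    (∃ i : ℕ, ∃ s : ℤ, x = HA q M N ext lvl i s) ∨ x = K0A q M N ext lvl ∨
      x = K0iA q M N ext lvl}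

/-! ### The multiplication map on the triple tensor product -/

def triMul (q : ℂ) (M N : ℕ) (ext : Bool) (lvl : ℕ)
    (S T R : Subalgebra ℂ (ALG q M N ext lvl)) :
    (↥S ⊗[ℂ] (↥T ⊗[ℂ] ↥R)) →ₗ[ℂ] ALG q M N ext lvl :=
  TensorProduct.lift
    (((LinearMap.mul ℂ (ALG q M N ext lvl)).comp S.val.toLinearMap).compl₂
      (TensorProduct.lift
        (((LinearMap.mul ℂ (ALG q M N ext lvl)).comp T.val.toLinearMap).compl₂
          R.val.toLinearMap)))

/-! ### Root vectors and PBW monomials -/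

def Xroot (q : ℂ) (M N : ℕ) (ext : Bool) (lvl : ℕ) (i : ℕ) : ℕ → ℤ → ALG q M N ext lvl
  | 0, n => XpA q M N ext lvl i n
  | k + 1, n =>
      brF (qpar q M (i + k + 1)) (Xroot q M N ext lvl i k n) (XpA q M N ext lvl (i + k + 1) 0)

/-- the root vector `X_{α_i + ⋯ + α_j}(n)`. -/
def XrootIJ (q : ℂ) (M N : ℕ) (ext : Bool) (lvl : ℕ) (i j : ℕ) (n : ℤ) : ALG q M N ext lvl :=
  Xroot q M N ext lvl i (j - i) n

def rootLE (a b : ℕ × ℕ) : Prop := a.1 < b.1 ∨ (a.1 = b.1 ∧ a.2 ≤ b.2)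

/-- the set of PBW ordered monomials in the root vectors. -/
def pbwSet (q : ℂ) (M N : ℕ) (ext : Bool) (lvl : ℕ) : Set (ALG q M N ext lvl) :=
  {x | ∃ L : List ((ℕ × ℕ) × ℤ),
      (∀ p ∈ L, 1 ≤ p.1.1 ∧ p.1.1 ≤ p.1.2 ∧ p.1.2 ≤ M + N - 1) ∧
      L.Chain' (fun a b => rootLE a.1 b.1) ∧
      x = (L.map fun p => XrootIJ q M N ext lvl p.1.1 p.1.2 p.2).prod}

/-- PBW ordered monomials of total degree `d` (`d i` counts the multiplicity of `α_i`). -/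
def pbwDegSet (q : ℂ) (M N : ℕ) (ext : Bool) (lvl : ℕ) (d : ℕ → ℕ) : Set (ALG q M N ext lvl) :=
  {x | ∃ L : List ((ℕ × ℕ) × ℤ),
      (∀ p ∈ L, 1 ≤ p.1.1 ∧ p.1.1 ≤ p.1.2 ∧ p.1.2 ≤ M + N - 1) ∧
      L.Chain' (fun a b => rootLE a.1 b.1) ∧
      (∀ i : ℕ, ((L.map fun p => if p.1.1 ≤ i ∧ i ≤ p.1.2 then 1 else 0).sum) = d i) ∧
      x = (L.map fun p => XrootIJ q M N ext lvl p.1.1 p.1.2 p.2).prod}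

/-- words in the generators `X⁺_{i,n}` of degree `d`. -/
def wordDegSet (q : ℂ) (M N : ℕ) (ext : Bool) (lvl : ℕ) (d : ℕ → ℕ) :
    Set (ALG q M N ext lvl) :=
  {x | ∃ w : List (ℕ × ℤ), (∀ p ∈ w, 1 ≤ p.1 ∧ p.1 ≤ M + N - 1) ∧
      (∀ i : ℕ, (w.map Prod.fst).count i = d i) ∧
      x = (w.map fun p => XpA q M N ext lvl p.1 p.2).prod}

/-! ### The subspaces `I^±_{i,j}` and `O^±` -/

def IElt (q : ℂ) (M N : ℕ) (ext : Bool) (lvl : ℕ) (pl : Bool) (i j : ℕ) (m n : ℤ) :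
    ALG q M N ext lvl :=
  let X : ℕ → ℤ → ALG q M N ext lvl := if pl then XpA q M N ext lvl else XmA q M N ext lvl
  let e : ℤ := if pl then cc M i j else -cc M i j
  if cc M i j = 0 then X i m * X j n - sgn M i j • (X j n * X i m)
  else
    X i (m + 1) * X j n - (q ^ e) • (X j n * X i (m + 1)) -
      (q ^ e) • (X i m * X j (n + 1)) + X j (n + 1) * X i m

def Isub (q : ℂ) (M N : ℕ) (ext : Bool) (lvl : ℕ) (pl : Bool) (i j : ℕ) :
    Submodule ℂ (ALG q M N ext lvl) :=
  Submodule.span ℂ (Set.range fun p : ℤ × ℤ => IElt q M N ext lvl pl i j p.1 p.2)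

def IsubAll (q : ℂ) (M N : ℕ) (ext : Bool) (lvl : ℕ) (pl : Bool) :
    Submodule ℂ (ALG q M N ext lvl) :=
  ⨆ p : ℕ × ℕ, ⨆ _ : 1 ≤ p.1 ∧ p.1 ≤ p.2 ∧ p.2 ≤ M + N - 1,
    Isub q M N ext lvl pl p.1 p.2

def OscElt (q : ℂ) (M N : ℕ) (ext : Bool) (lvl : ℕ) (pl : Bool) (m n k u : ℤ) :
    ALG q M N ext lvl :=
  let X : ℕ → ℤ → ALG q M N ext lvl := if pl then XpA q M N ext lvl else XmA q M N ext lvl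
  oscOf q M X m n k u + oscOf q M X m u k n

def Osub (q : ℂ) (M N : ℕ) (ext : Bool) (lvl : ℕ) (pl : Bool) :
    Submodule ℂ (ALG q M N ext lvl) :=
  Submodule.span ℂ
    (Set.range fun p : ℤ × ℤ × ℤ × ℤ => OscElt q M N ext lvl pl p.1 p.2.1 p.2.2.1 p.2.2.2)

/-- the sign `(−1)^{(p(α_k)+p(α_u))·p(α_i)}`. -/
def gsgn (M : ℕ) (k u i : ℕ) : ℂ :=
  if ((k = M ∧ ¬u = M) ∨ (¬k = M ∧ u = M)) ∧ i = M then -1 else 1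

/-! ### Highest weights and the associated eigenvalue sequences -/

/-- `Q·f = 0` for a bilateral formal series `f`. -/
def annih (Q : Polynomial ℂ) (f : ℤ → ℂ) : Prop :=
  ∀ n : ℤ, ∑ s ∈ Finset.range (Q.natDegree + 1), Q.coeff s * f (n - s) = 0

/-- an element of `R_{M,N}`: a highest weight `(P̲, f, c)`. -/
structure HW (q : ℂ) (M N : ℕ) : Type where
  P : ℕ → Polynomial ℂ
  f : ℤ → ℂ
  c : ℂ
  P_const : ∀ i, (P i).coeff 0 = 1
  c_ne : c ≠ 0
  torsion : ∃ Q : Polynomial ℂ, Q ≠ 0 ∧ annih Q f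
  f_zero : f 0 = (c - c⁻¹) / (q - q⁻¹)

def toPS (p : Polynomial ℂ) : PowerSeries ℂ := PowerSeries.mk fun n => p.coeff n

/-- `P(z·u)`. -/
def pscale (u : ℂ) (P : Polynomial ℂ) : Polynomial ℂ := P.comp (Polynomial.C u * Polynomial.X)

/-- the coefficient of `z^n` (`n ≥ 0`) in `q_i^{deg P} P(z q_i⁻¹)/P(z q_i)`,
expanded at `z = 0`. -/
def gammaP (q : ℂ) (M : ℕ) (i : ℕ) (P : Polynomial ℂ) (n : ℤ) : ℂ :=
  if 0 ≤ n then
    qpar q M i ^ P.natDegree *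
      PowerSeries.coeff n.toNat
        (toPS (pscale (qpar q M i)⁻¹ P) * (toPS (pscale (qpar q M i) P))⁻¹)
  else 0

/-- the coefficient of `z^n` (`n ≤ 0`) in `q_i^{deg P} P(z q_i⁻¹)/P(z q_i)`,
expanded at `z = ∞`. -/
def gammaM (q : ℂ) (M : ℕ) (i : ℕ) (P : Polynomial ℂ) (n : ℤ) : ℂ :=
  if n ≤ 0 then
    qpar q M i ^ P.natDegree *
      PowerSeries.coeff (-n).toNat
        (toPS ((pscale (qpar q M i)⁻¹ P).reflect P.natDegree) *
          (toPS ((pscale (qpar q M i) P).reflect P.natDegree))⁻¹)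
  else 0

/-! ### Verma, Weyl and simple modules -/

def vermaRels (q : ℂ) (M N : ℕ) (ext : Bool) (Λ : HW q M N) : Set (ALG q M N ext 3) :=
  {x | ∃ i : ℕ, ∃ n : ℤ, x = XpA q M N ext 3 i n} ∪
  {x | ∃ i : ℕ, ∃ n : ℤ, 1 ≤ i ∧ i ≤ M + N - 1 ∧ i ≠ M ∧
      (x = phiPA q M N ext 3 i n - algebraMap ℂ _ (gammaP q M i (Λ.P i) n) ∨
       x = phiMA q M N ext 3 i n - algebraMap ℂ _ (gammaM q M i (Λ.P i) n))} ∪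
  {x | x = KA q M N ext 3 M - algebraMap ℂ _ Λ.c} ∪
  {x | ∃ n : ℤ, x = phiPA q M N ext 3 M n - phiMA q M N ext 3 M n -
      algebraMap ℂ _ ((q - q⁻¹) * Λ.f n)} ∪
  {x | ext = true ∧ x = K0A q M N ext 3 - 1}

def evenRels (q : ℂ) (M N : ℕ) (ext : Bool) (Λ : HW q M N) : Set (ALG q M N ext 3) :=
  {x | ∃ i : ℕ, 1 ≤ i ∧ i ≤ M + N - 1 ∧ i ≠ M ∧
      x = XmA q M N ext 3 i 0 ^ (1 + (Λ.P i).natDegree)}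

def oddElt (q : ℂ) (M N : ℕ) (ext : Bool) (Q : Polynomial ℂ) (n : ℤ) : ALG q M N ext 3 :=
  ∑ s ∈ Finset.range (Q.natDegree + 1),
    Q.coeff (Q.natDegree - s) • XmA q M N ext 3 M ((s : ℤ) + n)

def oddRels (q : ℂ) (M N : ℕ) (ext : Bool) (Q : Polynomial ℂ) : Set (ALG q M N ext 3) :=
  if M = 1 ∧ N = 1 then {x | ∃ n : ℤ, x = oddElt q M N ext Q n}
  else {oddElt q M N ext Q 0}

def vermaIdeal (q : ℂ) (M N : ℕ) (ext : Bool) (Λ : HW q M N) : Ideal (ALG q M N ext 3) :=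
  Ideal.span (vermaRels q M N ext Λ)

def weylIdeal (q : ℂ) (M N : ℕ) (ext : Bool) (Λ : HW q M N) (Q : Polynomial ℂ) :
    Ideal (ALG q M N ext 3) :=
  Ideal.span (vermaRels q M N ext Λ ∪ evenRels q M N ext Λ ∪ oddRels q M N ext Q)

def uweylIdeal (q : ℂ) (M N : ℕ) (ext : Bool) (Λ : HW q M N) : Ideal (ALG q M N ext 3) :=
  Ideal.span (vermaRels q M N ext Λ ∪ evenRels q M N ext Λ)

/-- the Verma module `M(Λ)`. -/
def VermaMod (q : ℂ) (M N : ℕ) (ext : Bool) (Λ : HW q M N) : Type :=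
  ALG q M N ext 3 ⧸ vermaIdeal q M N ext Λ

/-- the Weyl module `W(Λ; Q)`. -/
def WeylMod (q : ℂ) (M N : ℕ) (ext : Bool) (Λ : HW q M N) (Q : Polynomial ℂ) : Type :=
  ALG q M N ext 3 ⧸ weylIdeal q M N ext Λ Q

/-- the universal Weyl module `W(Λ)`. -/
def UWeylMod (q : ℂ) (M N : ℕ) (ext : Bool) (Λ : HW q M N) : Type :=
  ALG q M N ext 3 ⧸ uweylIdeal q M N ext Λ

instance (q : ℂ) (M N : ℕ) (ext : Bool) (Λ : HW q M N) : AddCommGroup (VermaMod q M N ext Λ) :=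
  inferInstanceAs (AddCommGroup (ALG q M N ext 3 ⧸ vermaIdeal q M N ext Λ))
instance (q : ℂ) (M N : ℕ) (ext : Bool) (Λ : HW q M N) :
    Module (ALG q M N ext 3) (VermaMod q M N ext Λ) :=
  inferInstanceAs (Module (ALG q M N ext 3) (ALG q M N ext 3 ⧸ vermaIdeal q M N ext Λ))
instance (q : ℂ) (M N : ℕ) (ext : Bool) (Λ : HW q M N) : Module ℂ (VermaMod q M N ext Λ) :=
  inferInstanceAs (Module ℂ (ALG q M N ext 3 ⧸ vermaIdeal q M N ext Λ))
instance (q : ℂ) (M N : ℕ) (ext : Bool) (Λ : HW q M N) :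
    IsScalarTower ℂ (ALG q M N ext 3) (VermaMod q M N ext Λ) :=
  inferInstanceAs (IsScalarTower ℂ (ALG q M N ext 3) (ALG q M N ext 3 ⧸ vermaIdeal q M N ext Λ))

instance (q : ℂ) (M N : ℕ) (ext : Bool) (Λ : HW q M N) (Q : Polynomial ℂ) :
    AddCommGroup (WeylMod q M N ext Λ Q) :=
  inferInstanceAs (AddCommGroup (ALG q M N ext 3 ⧸ weylIdeal q M N ext Λ Q))
instance (q : ℂ) (M N : ℕ) (ext : Bool) (Λ : HW q M N) (Q : Polynomial ℂ) :
    Module (ALG q M N ext 3) (WeylMod q M N ext Λ Q) :=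
  inferInstanceAs (Module (ALG q M N ext 3) (ALG q M N ext 3 ⧸ weylIdeal q M N ext Λ Q))
instance (q : ℂ) (M N : ℕ) (ext : Bool) (Λ : HW q M N) (Q : Polynomial ℂ) :
    Module ℂ (WeylMod q M N ext Λ Q) :=
  inferInstanceAs (Module ℂ (ALG q M N ext 3 ⧸ weylIdeal q M N ext Λ Q))
instance (q : ℂ) (M N : ℕ) (ext : Bool) (Λ : HW q M N) (Q : Polynomial ℂ) :
    IsScalarTower ℂ (ALG q M N ext 3) (WeylMod q M N ext Λ Q) :=
  inferInstanceAs
    (IsScalarTower ℂ (ALG q M N ext 3) (ALG q M N ext 3 ⧸ weylIdeal q M N ext Λ Q))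

instance (q : ℂ) (M N : ℕ) (ext : Bool) (Λ : HW q M N) : AddCommGroup (UWeylMod q M N ext Λ) :=
  inferInstanceAs (AddCommGroup (ALG q M N ext 3 ⧸ uweylIdeal q M N ext Λ))
instance (q : ℂ) (M N : ℕ) (ext : Bool) (Λ : HW q M N) :
    Module (ALG q M N ext 3) (UWeylMod q M N ext Λ) :=
  inferInstanceAs (Module (ALG q M N ext 3) (ALG q M N ext 3 ⧸ uweylIdeal q M N ext Λ))
instance (q : ℂ) (M N : ℕ) (ext : Bool) (Λ : HW q M N) : Module ℂ (UWeylMod q M N ext Λ) :=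
  inferInstanceAs (Module ℂ (ALG q M N ext 3 ⧸ uweylIdeal q M N ext Λ))
instance (q : ℂ) (M N : ℕ) (ext : Bool) (Λ : HW q M N) :
    IsScalarTower ℂ (ALG q M N ext 3) (UWeylMod q M N ext Λ) :=
  inferInstanceAs (IsScalarTower ℂ (ALG q M N ext 3) (ALG q M N ext 3 ⧸ uweylIdeal q M N ext Λ))

/-- the highest weight vector (image of `1`). -/
def vgen (q : ℂ) (M N : ℕ) (Λ : HW q M N) : VermaMod q M N true Λ :=
  Submodule.Quotient.mk 1

/-- the sum of all submodules not containing the highest weight vector (the unique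
maximal submodule of the Verma module). -/
def radV (q : ℂ) (M N : ℕ) (Λ : HW q M N) :
    Submodule (ALG q M N true 3) (VermaMod q M N true Λ) :=
  sSup {p | vgen q M N Λ ∉ p}

/-- the simple quotient `S'(Λ)`. -/
def SimpMod (q : ℂ) (M N : ℕ) (Λ : HW q M N) : Type :=
  VermaMod q M N true Λ ⧸ radV q M N Λ

instance (q : ℂ) (M N : ℕ) (Λ : HW q M N) : AddCommGroup (SimpMod q M N Λ) :=
  inferInstanceAs (AddCommGroup (VermaMod q M N true Λ ⧸ radV q M N Λ))
instance (q : ℂ) (M N : ℕ) (Λ : HW q M N) :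
    Module (ALG q M N true 3) (SimpMod q M N Λ) :=
  inferInstanceAs (Module (ALG q M N true 3) (VermaMod q M N true Λ ⧸ radV q M N Λ))
instance (q : ℂ) (M N : ℕ) (Λ : HW q M N) : Module ℂ (SimpMod q M N Λ) :=
  inferInstanceAs (Module ℂ (VermaMod q M N true Λ ⧸ radV q M N Λ))
instance (q : ℂ) (M N : ℕ) (Λ : HW q M N) :
    IsScalarTower ℂ (ALG q M N true 3) (SimpMod q M N Λ) :=
  inferInstanceAs (IsScalarTower ℂ (ALG q M N true 3) (VermaMod q M N true Λ ⧸ radV q M N Λ))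

/-! ### Weight spaces -/

/-- `K_i` for `0 ≤ i`, with `K₀` at `i = 0`. -/
def Kgen (q : ℂ) (M N : ℕ) (ext : Bool) (lvl : ℕ) (i : ℕ) : ALG q M N ext lvl :=
  if i = 0 then K0A q M N ext lvl else KA q M N ext lvl i

/-- the `μ`-weight space of a module. -/
def wtSp (q : ℂ) (M N : ℕ) (ext : Bool) {W : Type} [AddCommGroup W] [Module ℂ W]
    [Module (ALG q M N ext 3) W] [IsScalarTower ℂ (ALG q M N ext 3) W] (μ : ℕ → ℂ) :
    Submodule ℂ W where
  carrier := {w | ∀ i < M + N, Kgen q M N ext 3 i • w = μ i • w}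
  add_mem' := by
    intro a b ha hb i hi
    rw [smul_add, ha i hi, hb i hi, smul_add]
  zero_mem' := by
    intro i hi
    rw [smul_zero, smul_zero]
  smul_mem' := by
    intro c w hw i hi
    have h1 : Kgen q M N ext 3 i • (c • w) = c • (Kgen q M N ext 3 i • w) := by
      rw [← algebraMap_smul (ALG q M N ext 3) c w, ← mul_smul, ← Algebra.commutes, mul_smul,
        algebraMap_smul]
    rw [h1, hw i hi, smul_comm]

/-- the character `λ_Λ`. -/
def lamF (q : ℂ) (M N : ℕ) (Λ : HW q M N) : ℕ → ℂ :=
  fun i => if i = 0 then 1 else if i = M then Λ.c else qpar q M i ^ (Λ.P i).natDegree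

/-- the character `α_j`. -/
def alF (q : ℂ) (M : ℕ) (j : ℕ) : ℕ → ℂ :=
  fun i => if i = 0 then (if j = 1 then q else 1) else q ^ cc M j i

/-! ### The generators of `U` inside `U'` -/

def UGenSet (q : ℂ) (M N : ℕ) : Set (ALG q M N true 3) :=
  {x | (∃ i : ℕ, ∃ n : ℤ, x = XpA q M N true 3 i n) ∨
    (∃ i : ℕ, ∃ n : ℤ, x = XmA q M N true 3 i n) ∨
    (∃ i : ℕ, x = KA q M N true 3 i) ∨ (∃ i : ℕ, x = KiA q M N true 3 i) ∨
    ∃ i : ℕ, ∃ s : ℤ, x = HA q M N true 3 i s}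

/-! ### One-sided presentations (for `U^±`) -/

def XgF (M N : ℕ) (i : ℕ) (n : ℤ) : FreeAlgebra ℂ (Idx M N × ℤ) :=
  if h : 1 ≤ i ∧ i ≤ M + N - 1 then FreeAlgebra.ι ℂ ((⟨i, h⟩, n) : Idx M N × ℤ) else 0

inductive rel1 (q : ℂ) (M N : ℕ) (pl : Bool) :
    FreeAlgebra ℂ (Idx M N × ℤ) → FreeAlgebra ℂ (Idx M N × ℤ) → Prop
  | comm0 (i j : Idx M N) (m n : ℤ) (h : cc M i.1 j.1 = 0) :
      rel1 q M N pl
        (FreeAlgebra.ι ℂ ((i, m) : Idx M N × ℤ) * FreeAlgebra.ι ℂ ((j, n) : Idx M N × ℤ) -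
          sgn M i.1 j.1 •
            (FreeAlgebra.ι ℂ ((j, n) : Idx M N × ℤ) * FreeAlgebra.ι ℂ ((i, m) : Idx M N × ℤ))) 0
  | deg2 (i j : Idx M N) (m n : ℤ) (h : cc M i.1 j.1 ≠ 0) :
      rel1 q M N pl
        (FreeAlgebra.ι ℂ ((i, m + 1) : Idx M N × ℤ) * FreeAlgebra.ι ℂ ((j, n) : Idx M N × ℤ) -
          (q ^ (if pl then cc M i.1 j.1 else -cc M i.1 j.1)) •
            (FreeAlgebra.ι ℂ ((j, n) : Idx M N × ℤ) *
              FreeAlgebra.ι ℂ ((i, m + 1) : Idx M N × ℤ)))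
        ((q ^ (if pl then cc M i.1 j.1 else -cc M i.1 j.1)) •
            (FreeAlgebra.ι ℂ ((i, m) : Idx M N × ℤ) *
              FreeAlgebra.ι ℂ ((j, n + 1) : Idx M N × ℤ)) -
          FreeAlgebra.ι ℂ ((j, n + 1) : Idx M N × ℤ) * FreeAlgebra.ι ℂ ((i, m) : Idx M N × ℤ))
  | serre (i j : Idx M N) (m n k : ℤ) (h : cc M i.1 j.1 = 1 ∨ cc M i.1 j.1 = -1)
      (hi : i.1 ≠ M) :
      rel1 q M N pl
        (brF q (FreeAlgebra.ι ℂ ((i, m) : Idx M N × ℤ))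
            (brF q⁻¹ (FreeAlgebra.ι ℂ ((i, n) : Idx M N × ℤ))
              (FreeAlgebra.ι ℂ ((j, k) : Idx M N × ℤ))) +
          brF q (FreeAlgebra.ι ℂ ((i, n) : Idx M N × ℤ))
            (brF q⁻¹ (FreeAlgebra.ι ℂ ((i, m) : Idx M N × ℤ))
              (FreeAlgebra.ι ℂ ((j, k) : Idx M N × ℤ)))) 0
  | osc (m n k u : ℤ) (hM : 1 < M) (hN : 1 < N) :
      rel1 q M N pl (oscOf q M (XgF M N) m n k u + oscOf q M (XgF M N) m u k n) 0

end QAS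

section
namespace QAS
open PowerSeries

section sl2
variable {A : Type} [Ring A] [Algebra ℂ A]

/-- formal derivative of a power series with noncommutative coefficients. -/
def psD (F : PowerSeries A) : PowerSeries A :=
  PowerSeries.mk fun m => ((m : ℂ) + 1) • PowerSeries.coeff (m + 1) F

lemma psD_mul (F G : PowerSeries A) : psD (F * G) = psD F * G + F * psD G := by
  ext m
  simp only [psD, coeff_mk, map_add, coeff_mul]
  have h1 : ((m : ℂ) + 1) • ∑ p ∈ Finset.HasAntidiagonal.antidiagonal (m + 1), coeff p.1 F * coeff p.2 G
      = ∑ p ∈ Finset.HasAntidiagonal.antidiagonal (m + 1), ((p.1 : ℂ) • coeff p.1 F) * coeff p.2 G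
        + ∑ p ∈ Finset.HasAntidiagonal.antidiagonal (m + 1), coeff p.1 F * ((p.2 : ℂ) • coeff p.2 G) := by
    rw [Finset.smul_sum, ← Finset.sum_add_distrib]
    refine Finset.sum_congr rfl fun p hp => ?_
    rw [Finset.HasAntidiagonal.mem_antidiagonal] at hp
    rw [smul_mul_assoc, mul_smul_comm, ← add_smul]
    congr 1
    exact_mod_cast hp.symm
  rw [h1, Finset.Nat.sum_antidiagonal_succ, Finset.Nat.sum_antidiagonal_succ']
  simp

lemma psD_unique (H F G : PowerSeries A) (hF : psD F = H * F) (hG : psD G = H * G)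
    (h0 : coeff 0 F = coeff 0 G) : F = G := by
  ext m
  induction m using Nat.strong_induction_on with
  | _ m ih =>
    rcases m with _ | m
    · exact h0
    · have e1 := congrArg (coeff m) hF
      have e2 := congrArg (coeff m) hG
      simp only [psD, coeff_mk, coeff_mul] at e1 e2
      have hne : ((m : ℂ) + 1) ≠ 0 := by exact_mod_cast Nat.succ_ne_zero m
      have : ((m : ℂ) + 1) • coeff (m + 1) F = ((m : ℂ) + 1) • coeff (m + 1) G := by
        rw [e1, e2]
        refine Finset.sum_congr rfl fun p hp => ?_
        rw [Finset.HasAntidiagonal.mem_antidiagonal] at hp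
        rw [ih p.2 (by omega)]
      have := congrArg (fun x => ((m : ℂ) + 1)⁻¹ • x) this
      simpa [smul_smul, inv_mul_cancel₀ hne] using this

/-- `g(w) = (1 - θ w)/(1 - θ⁻¹ w)`. -/
def gco (θ : ℂ) (m : ℕ) : ℂ := if m = 0 then 1 else (θ⁻¹) ^ m * (1 - θ ^ 2)

lemma gco_zero (θ : ℂ) : gco θ 0 = 1 := by simp [gco]
lemma gco_succ (θ : ℂ) (m : ℕ) : gco θ (m + 1) = (θ⁻¹) ^ (m + 1) * (1 - θ ^ 2) := by simp [gco]

lemma gco_U (θ : ℂ) (hθ : θ ≠ 0) (m : ℕ) :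
    ∑ p ∈ Finset.HasAntidiagonal.antidiagonal m, θ ^ (p.1 + 1) * gco θ p.2 = θ * (θ⁻¹) ^ m := by
  induction m with
  | zero => simp [gco_zero]
  | succ m ih =>
    rw [Finset.Nat.sum_antidiagonal_succ]
    have : ∑ p ∈ Finset.HasAntidiagonal.antidiagonal m, θ ^ (p.1 + 1 + 1) * gco θ p.2 =
        θ * ∑ p ∈ Finset.HasAntidiagonal.antidiagonal m, θ ^ (p.1 + 1) * gco θ p.2 := by
      rw [Finset.mul_sum]; refine Finset.sum_congr rfl fun p _ => by ring
    have e : θ * θ⁻¹ = 1 := mul_inv_cancel₀ hθ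
    simp only [this, ih, gco_succ]
    generalize θ⁻¹ = u at *
    linear_combination (-θ ^ 2 * u ^ m) * e

lemma gco_V (θ : ℂ) (hθ : θ ≠ 0) (m : ℕ) :
    ∑ p ∈ Finset.HasAntidiagonal.antidiagonal m, (θ⁻¹) ^ (p.1 + 1) * gco θ p.2 =
      ((m : ℂ) + 1) * (θ⁻¹) ^ (m + 1) - m * θ * (θ⁻¹) ^ m := by
  induction m with
  | zero => simp [gco_zero]
  | succ m ih =>
    rw [Finset.Nat.sum_antidiagonal_succ]
    have : ∑ p ∈ Finset.HasAntidiagonal.antidiagonal m, (θ⁻¹) ^ (p.1 + 1 + 1) * gco θ p.2 =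
        θ⁻¹ * ∑ p ∈ Finset.HasAntidiagonal.antidiagonal m, (θ⁻¹) ^ (p.1 + 1) * gco θ p.2 := by
      rw [Finset.mul_sum]; refine Finset.sum_congr rfl fun p _ => by ring
    simp only [this, ih, gco_succ]
    have e : θ * θ⁻¹ = 1 := mul_inv_cancel₀ hθ
    push_cast
    generalize θ⁻¹ = u at *
    linear_combination (-θ * u * u ^ m) * e

lemma gco_rec (θ : ℂ) (hθ : θ ≠ 0) (m : ℕ) :
    ∑ p ∈ Finset.HasAntidiagonal.antidiagonal m, (θ ^ (p.1 + 1) - (θ⁻¹) ^ (p.1 + 1)) * gco θ p.2 =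
      -(((m : ℂ) + 1) * gco θ (m + 1)) := by
  simp only [sub_mul, Finset.sum_sub_distrib, gco_U θ hθ, gco_V θ hθ, gco_succ]
  have e : θ * θ⁻¹ = 1 := mul_inv_cancel₀ hθ
  generalize θ⁻¹ = u at *
  linear_combination (-((m : ℂ) + 1) * θ * u ^ m) * e

/-- the exponential as a power series. -/
def expS (t : ℂ) (h : ℕ → A) : PowerSeries A := PowerSeries.mk fun n => expC t h n

lemma psD_expS (t : ℂ) (h : ℕ → A) :
    psD (expS t h) = (PowerSeries.mk fun s => (t * ((s : ℂ) + 1)) • h (s + 1)) * expS t h := by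
  ext m
  have hne : ((m : ℂ) + 1) ≠ 0 := by exact_mod_cast Nat.succ_ne_zero m
  simp only [psD, coeff_mk, expS, coeff_mul]
  rw [expC, smul_smul, mul_inv_cancel₀ hne, one_smul, Finset.smul_sum,
    Finset.Nat.sum_antidiagonal_eq_sum_range_succ_mk]
  refine Finset.sum_congr rfl fun s _ => ?_
  simp only [smul_smul, smul_mul_assoc]

/-- commutation of the exponential with `y`. -/
lemma expS_mul_y (t θ : ℂ) (hθ : θ ≠ 0) (h : ℕ → A) (y : ℤ → A)
    (hy : ∀ (s : ℕ) (n : ℤ), (t * ((s : ℂ) + 1)) • (h (s + 1) * y n - y n * h (s + 1)) =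
      -((θ ^ (s + 1) - (θ⁻¹) ^ (s + 1)) • y (n + (s + 1)))) (n : ℤ) :
    expS t h * C (y n) = (PowerSeries.mk fun i : ℕ => gco θ i • y (n + i)) * expS t h := by
  set H : PowerSeries A := PowerSeries.mk fun s => (t * ((s : ℂ) + 1)) • h (s + 1) with hH
  have hE := psD_expS t h
  rw [← hH] at hE
  have hC : psD (C (y n)) = 0 := by
    ext m; simp [psD, coeff_C]
  apply psD_unique H
  · rw [psD_mul, hE, hC, mul_zero, add_zero, mul_assoc]
  · rw [psD_mul, hE, ← mul_assoc, ← mul_assoc, ← add_mul]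
    congr 1
    ext m
    simp only [map_add, psD, coeff_mk, coeff_mul, hH]
    rw [← Finset.Nat.sum_antidiagonal_swap]
    simp only [Prod.fst_swap, Prod.snd_swap]
    have key : ∑ p ∈ Finset.HasAntidiagonal.antidiagonal m,
        (((t * ((p.1 : ℂ) + 1)) • h (p.1 + 1)) * (gco θ p.2 • y (n + p.2)) -
         (gco θ p.2 • y (n + p.2)) * ((t * ((p.1 : ℂ) + 1)) • h (p.1 + 1))) =
        (((m : ℂ) + 1) * gco θ (m + 1)) • y (n + (m + 1)) := by
      have : ∀ p ∈ Finset.HasAntidiagonal.antidiagonal m,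
        (((t * ((p.1 : ℂ) + 1)) • h (p.1 + 1)) * (gco θ p.2 • y (n + p.2)) -
         (gco θ p.2 • y (n + p.2)) * ((t * ((p.1 : ℂ) + 1)) • h (p.1 + 1))) =
        (-((θ ^ (p.1 + 1) - (θ⁻¹) ^ (p.1 + 1)) * gco θ p.2)) • y (n + (m + 1)) := by
        intro p hp
        rw [Finset.HasAntidiagonal.mem_antidiagonal] at hp
        have h1 := hy p.1 (n + p.2)
        have h2 : n + (p.2 : ℤ) + ((p.1 : ℤ) + 1) = n + (m + 1) := by
          rw [← hp]; push_cast; ring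
        rw [h2] at h1
        have h3 : (((t * ((p.1 : ℂ) + 1)) • h (p.1 + 1)) * (gco θ p.2 • y (n + p.2)) -
          (gco θ p.2 • y (n + p.2)) * ((t * ((p.1 : ℂ) + 1)) • h (p.1 + 1))) =
          gco θ p.2 • ((t * ((p.1 : ℂ) + 1)) •
            (h (p.1 + 1) * y (n + p.2) - y (n + p.2) * h (p.1 + 1))) := by
          simp only [smul_mul_assoc, mul_smul_comm, smul_sub, smul_smul]
          rw [mul_comm (gco θ p.2)]
        rw [h3, h1, smul_neg, smul_smul, neg_smul, mul_comm]
      rw [Finset.sum_congr rfl this, ← Finset.sum_smul, Finset.sum_neg_distrib, gco_rec θ hθ,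
        neg_neg]
    rw [Finset.sum_sub_distrib] at key
    rw [smul_smul, Nat.cast_succ, ← key, sub_add_cancel]
  · simp [coeff_mul, expS, expC, gco_zero]

end sl2
end QAS
end

section
set_option linter.unusedSectionVars false
set_option linter.unusedSimpArgs false
namespace QAS
open PowerSeries

section sl2b
variable {A : Type} [Ring A] [Algebra ℂ A]

/-- the series `Σ_{n ≥ 1} u_n y_n X^n`. -/
def ySer (u : ℕ → ℂ) (y : ℤ → A) : PowerSeries A :=
  PowerSeries.mk fun n => if n = 0 then 0 else u n • y n

lemma gco_sum (θ : ℂ) (hθ : θ ≠ 0) (m : ℕ) :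
    θ⁻¹ * ∑ n ∈ Finset.range (m + 1), (if n = 0 then 0 else gco θ (m - n)) =
      if m = 0 then 0 else (1 + θ) * (θ⁻¹) ^ m - 1 := by
  have h1 : ∑ n ∈ Finset.range (m + 1), (if n = 0 then 0 else gco θ (m - n)) =
      ∑ j ∈ Finset.range m, gco θ j := by
    rw [Finset.sum_range_succ']
    simp only [Nat.add_eq_zero_iff, one_ne_zero, and_false, if_false, if_true, add_zero]
    rw [← Finset.sum_range_reflect]
    refine Finset.sum_congr rfl fun j hj => ?_
    congr 1
    have := Finset.mem_range.1 hj
    omega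
  have e : θ * θ⁻¹ = 1 := mul_inv_cancel₀ hθ
  have h2 : ∀ m : ℕ, θ⁻¹ * ∑ j ∈ Finset.range (m + 1), gco θ j = (1 + θ) * (θ⁻¹) ^ (m + 1) - 1 := by
    intro m
    induction m with
    | zero =>
      simp only [zero_add, Finset.sum_range_one, gco_zero]
      generalize θ⁻¹ = u at *
      linear_combination -e
    | succ m ih =>
      rw [Finset.sum_range_succ, mul_add, ih, gco_succ]
      generalize θ⁻¹ = u at *
      linear_combination (-u * u ^ m - u * u ^ m * θ) * e
  rw [h1]
  rcases m with _ | m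
  · simp
  · simp only [h2]; simp

lemma coeff_mul_congr (F G H : PowerSeries A) (N : ℕ) (h : ∀ m ≤ N, coeff m G = coeff m H) :
    coeff N (F * G) = coeff N (F * H) := by
  simp only [coeff_mul]
  refine Finset.sum_congr rfl fun p hp => ?_
  rw [Finset.HasAntidiagonal.mem_antidiagonal] at hp
  rw [h p.2 (by omega)]

lemma coeff_mul_congr_left (F G H : PowerSeries A) (N : ℕ) (h : ∀ m ≤ N, coeff m G = coeff m H) :
    coeff N (G * F) = coeff N (H * F) := by
  simp only [coeff_mul]
  refine Finset.sum_congr rfl fun p hp => ?_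
  rw [Finset.HasAntidiagonal.mem_antidiagonal] at hp
  rw [h p.1 (by omega)]

lemma phi_a (t θ : ℂ) (hθ : θ ≠ 0) (h : ℕ → A) (y : ℤ → A) (K : A)
    (hK : ∀ n, K * y n = θ⁻¹ • (y n * K))
    (hy : ∀ (s : ℕ) (n : ℤ), (t * ((s : ℂ) + 1)) • (h (s + 1) * y n - y n * h (s + 1)) =
      -((θ ^ (s + 1) - (θ⁻¹) ^ (s + 1)) • y (n + (s + 1)))) :
    (C K * expS t h) * ySer (fun _ => 1) y =
      ySer (fun m => (1 + θ) * (θ⁻¹) ^ m - 1) y * (C K * expS t h) := by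
  have hE : expS t h * ySer (fun _ => 1) y =
      (PowerSeries.mk fun m : ℕ => (∑ n ∈ Finset.range (m + 1), (if n = 0 then 0 else gco θ (m - n))) •
        y m) * expS t h := by
    ext N
    have e1 : ∀ m ≤ N, coeff m (ySer (fun _ => 1) y) =
        coeff m (∑ n ∈ Finset.range (N + 1), (if n = 0 then (0 : ℂ) else 1) • (C (y n) * X ^ n)) := by
      intro m hm
      simp only [map_sum, coeff_smul, coeff_C_mul, coeff_X_pow, ySer, coeff_mk]
      rw [Finset.sum_eq_single m]
      · simp
      · intro b _ hb; simp [hb.symm]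
      · intro hb; exact absurd (Finset.mem_range.2 (by omega)) hb
    rw [coeff_mul_congr _ _ _ _ e1, Finset.mul_sum]
    have e2 : ∀ n ∈ Finset.range (N + 1),
        expS t h * ((if n = 0 then (0 : ℂ) else 1) • (C (y n) * X ^ n)) =
        ((if n = 0 then (0 : ℂ) else 1) • ((PowerSeries.mk fun i : ℕ => gco θ i • y (n + i)) * X ^ n)) *
          expS t h := by
      intro n _
      rw [mul_smul_comm, smul_mul_assoc, ← mul_assoc, expS_mul_y t θ hθ h y hy, mul_assoc, mul_assoc]
      congr 2
      exact (PowerSeries.commute_X_pow _ n)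
    rw [Finset.sum_congr rfl e2, ← Finset.sum_mul]
    apply coeff_mul_congr_left
    intro m hm
    simp only [map_sum, coeff_smul, coeff_mk, coeff_mul_X_pow']
    rw [Finset.sum_smul]
    symm
    apply Finset.sum_subset_zero_on_sdiff (Finset.range_mono (by omega))
    · intro x hx
      have : ¬ x ≤ m := by
        simp at hx; omega
      simp [this]
    · intro x hx
      have hx : x ≤ m := by simp at hx; omega
      have : (x : ℤ) + ((m - x : ℕ) : ℤ) = m := by omega
      rw [if_pos hx, this]
      split_ifs <;> simp
  rw [mul_assoc, hE, ← mul_assoc, ← mul_assoc]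
  congr 1
  ext m
  simp only [coeff_C_mul, coeff_mul_C, coeff_mk, ySer]
  rw [mul_smul_comm, hK, smul_smul, mul_comm, gco_sum θ hθ]
  split_ifs <;> simp

lemma ca_eq (θ : ℂ) (hθ : θ ≠ 0) (hθ1 : θ ≠ 1) (y : ℤ → A)
    (hq : ∀ m n : ℤ, y (m + 1) * y n - θ⁻¹ • (y n * y (m + 1)) =
      θ⁻¹ • (y m * y (n + 1)) - y (n + 1) * y m) :
    ySer (fun m => (1 + θ) * (θ⁻¹) ^ m - 1) y * ySer (fun _ => 1) y =
      θ • (ySer (fun m => (θ⁻¹) ^ m) y * ySer (fun m => (θ⁻¹) ^ m) y) := by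
  have e : θ * θ⁻¹ = 1 := mul_inv_cancel₀ hθ
  have hp1 : 1 - θ⁻¹ ≠ 0 := by
    intro h; apply hθ1; rw [sub_eq_zero] at h; rw [← e, ← h, mul_one]
  ext N
  rcases N with _ | K
  · simp [ySer, coeff_mul]
  set p := θ⁻¹ with hp
  let β : ℕ → ℕ → ℂ := fun m n => (1 - p ^ m) * (1 - p ^ n)
  have S0 : ∑ x ∈ Finset.HasAntidiagonal.antidiagonal K, β x.1 x.2 •
      (y (x.1 + 1) * y x.2 - p • (y x.1 * y (x.2 + 1))) = 0 := by
    have h1 : ∑ x ∈ Finset.HasAntidiagonal.antidiagonal K, β x.1 x.2 •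
      (y (x.1 + 1) * y x.2 - p • (y x.1 * y (x.2 + 1))) =
      - ∑ x ∈ Finset.HasAntidiagonal.antidiagonal K, β x.1 x.2 •
      (y (x.1 + 1) * y x.2 - p • (y x.1 * y (x.2 + 1))) := by
      conv_rhs => rw [← Finset.Nat.sum_antidiagonal_swap]
      rw [← Finset.sum_neg_distrib]
      refine Finset.sum_congr rfl fun x _ => ?_
      simp only [Prod.fst_swap, Prod.snd_swap]
      have hb : β x.2 x.1 = β x.1 x.2 := mul_comm _ _
      rw [hb, ← smul_neg]
      congr 1
      have := hq x.1 x.2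
      rw [sub_eq_sub_iff_add_eq_add] at this
      rw [neg_sub, sub_eq_sub_iff_add_eq_add, this, add_comm]
    have h2 := add_eq_zero_iff_eq_neg.2 h1
    rw [← two_smul ℂ] at h2
    exact (smul_eq_zero.1 h2).resolve_left two_ne_zero
  have S1 : ∑ x ∈ Finset.HasAntidiagonal.antidiagonal K, β x.1 x.2 • (y (x.1 + 1) * y x.2) =
      ∑ x ∈ Finset.HasAntidiagonal.antidiagonal (K + 1),
        (if x.1 = 0 then 0 else if x.2 = 0 then (0 : ℂ) else (1 - θ * p ^ x.1) * (1 - p ^ x.2)) •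
          (y x.1 * y x.2) := by
    rw [Finset.Nat.sum_antidiagonal_succ]
    simp only [if_true, zero_smul, zero_add]
    refine Finset.sum_congr rfl fun x _ => ?_
    simp only [Nat.add_eq_zero_iff, one_ne_zero, and_false, if_false]
    push_cast
    congr 1
    simp only [β]
    split_ifs with h
    · simp [h]
    · linear_combination (p ^ x.1 * (1 - p ^ x.2)) * e
  have S2 : ∑ x ∈ Finset.HasAntidiagonal.antidiagonal K, β x.1 x.2 • (p • (y x.1 * y (x.2 + 1))) =
      ∑ x ∈ Finset.HasAntidiagonal.antidiagonal (K + 1),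
        (if x.1 = 0 then 0 else if x.2 = 0 then (0 : ℂ) else p * (1 - p ^ x.1) * (1 - θ * p ^ x.2)) •
          (y x.1 * y x.2) := by
    rw [Finset.Nat.sum_antidiagonal_succ']
    simp only [if_true, ite_self, zero_smul, add_zero, zero_add]
    refine Finset.sum_congr rfl fun x _ => ?_
    simp only [Nat.add_eq_zero_iff, one_ne_zero, and_false, if_false]
    push_cast
    rw [smul_smul]
    congr 1
    simp only [β]
    split_ifs with h
    · simp [h]
    · linear_combination (p * p ^ x.2 * (1 - p ^ x.1)) * e
  simp only [smul_sub, Finset.sum_sub_distrib] at S0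
  rw [S1, S2, ← Finset.sum_sub_distrib] at S0
  have key : (1 - p) • (coeff (K + 1) (ySer (fun m => (1 + θ) * p ^ m - 1) y * ySer (fun _ => 1) y) -
      coeff (K + 1) (θ • (ySer (fun m => p ^ m) y * ySer (fun m => p ^ m) y))) = 0 := by
    rw [← neg_eq_zero, ← S0, coeff_smul, coeff_mul, coeff_mul, Finset.smul_sum, ← Finset.sum_sub_distrib,
      Finset.smul_sum, ← Finset.sum_neg_distrib]
    refine Finset.sum_congr rfl fun x _ => ?_
    simp only [ySer, coeff_mk]
    split_ifs with h1 h2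
    · simp
    · simp
    · simp
    · simp only [smul_mul_smul_comm, smul_smul, ← sub_smul, ← neg_smul]
      congr 1
      linear_combination (p ^ x.1 - p ^ x.2) * e
  have := (smul_eq_zero.1 key).resolve_left hp1
  exact sub_eq_zero.1 this

end sl2b

section ringid
variable {R : Type} [Ring R] [Algebra ℂ R]

def TT (a c : R) : ℕ → R
  | 0 => 1
  | n + 1 => a * TT a c n + c ^ (n + 1)

def brk (θ : ℂ) (n : ℕ) : ℂ := ∑ i ∈ Finset.range n, θ ^ i

lemma TT_eq (θ : ℂ) (a b c : R) (h1 : c * a = θ • (b * b)) (h2 : a + c = (1 + θ) • b) (n : ℕ) :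
    TT a c n = brk θ (n + 1) • b ^ n := by
  induction n using Nat.strong_induction_on with
  | _ n ih =>
    rcases n with _ | n
    · simp [TT, brk]
    rcases n with _ | n
    · simp [TT, brk, Finset.sum_range_succ, h2]
    · have i1 := ih (n + 1) (by omega)
      have i2 := ih n (by omega)
      have hc : c * TT a c (n + 1) = θ • (b * b * TT a c n) + c ^ (n + 2) := by
        rw [TT, mul_add, ← mul_assoc, h1, smul_mul_assoc, ← pow_succ']
      have : TT a c (n + 2) = (a + c) * TT a c (n + 1) - θ • (b * b * TT a c n) := by
        rw [add_mul, hc, TT]; abel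
      rw [this, h2, i1, i2]
      simp only [mul_smul_comm, smul_mul_assoc, smul_smul]
      rw [← pow_succ', mul_assoc, ← pow_succ', ← pow_succ', ← sub_smul]
      congr 1
      simp only [brk, Finset.sum_range_succ]
      ring

lemma brk_inv (θ : ℂ) (hθ : θ ≠ 0) (k : ℕ) : brk θ⁻¹ (k + 1) = (θ⁻¹) ^ k * brk θ (k + 1) := by
  rw [brk, brk, ← Finset.sum_range_reflect, Finset.mul_sum]
  refine Finset.sum_congr rfl fun j hj => ?_
  have : j ≤ k := by simp at hj; omega
  have h2 : k + 1 - 1 - j = k - j := by omega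
  rw [h2, inv_pow, inv_pow, eq_inv_mul_iff_mul_eq₀ (pow_ne_zero _ hθ), ← div_eq_mul_inv,
    div_eq_iff (pow_ne_zero _ hθ), ← pow_add]
  congr 1; omega

lemma brk_ne (θ : ℂ) (hθ : ∀ k : ℕ, k ≠ 0 → θ ^ k ≠ 1) (k : ℕ) : brk θ (k + 1) ≠ 0 := by
  intro h
  have := geom_sum_mul θ (k + 1)
  rw [brk] at h
  rw [h, zero_mul] at this
  exact hθ (k + 1) (by omega) (sub_eq_zero.1 this.symm)

lemma x_pow (t : ℂ) (p : ℂ) (x a c φ K : R) (h1 : x * a = a * x + t • (φ - K))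
    (h2 : φ * a = c * φ) (h3 : K * a = p • (a * K)) (k : ℕ) :
    x * a ^ (k + 1) = a ^ (k + 1) * x + t • (TT a c k * φ - brk p (k + 1) • (a ^ k * K)) := by
  have hφ : ∀ k : ℕ, φ * a ^ k = c ^ k * φ := by
    intro k
    induction k with
    | zero => simp
    | succ k ih => rw [pow_succ, ← mul_assoc, ih, mul_assoc, h2, ← mul_assoc, ← pow_succ]
  have hK : ∀ k : ℕ, K * a ^ k = p ^ k • (a ^ k * K) := by
    intro k
    induction k with
    | zero => simp
    | succ k ih =>
      rw [pow_succ, ← mul_assoc, ih, smul_mul_assoc, mul_assoc, h3, mul_smul_comm, smul_smul,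
        ← mul_assoc, ← pow_succ]
  induction k with
  | zero => simp [TT, brk, h1]
  | succ k ih =>
    have hb : brk p (k + 1 + 1) = brk p (k + 1) + p ^ (k + 1) := by
      rw [brk, Finset.sum_range_succ, ← brk]
    rw [pow_succ' a (k + 1), ← mul_assoc, h1, add_mul, mul_assoc, ih, smul_mul_assoc, sub_mul, hφ, hK,
      TT, hb, add_smul, add_mul, mul_add, mul_smul_comm, mul_sub, mul_smul_comm]
    have e1 : a * (a ^ k * K) = a ^ (k + 1) * K := by rw [← mul_assoc, ← pow_succ']
    rw [e1]
    simp only [mul_assoc, smul_sub, smul_add]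
    abel
end ringid
end QAS
end

section
set_option linter.unusedSectionVars false
set_option linter.unusedSimpArgs false
namespace QAS
open PowerSeries

/-- coefficients of the Drinfeld polynomial, defined recursively. -/
def Pco (q k : ℂ) (γ : ℕ → ℂ) : ℕ → ℂ
  | 0 => 1
  | n + 1 => (k * ((q⁻¹) ^ (n + 1) - q ^ (n + 1)))⁻¹ *
      ∑ s ∈ Finset.range (n + 1), γ (s + 1) * (q ^ (n - s) * Pco q k γ (n - s))
termination_by n => n
decreasing_by omega

lemma qinv_sub_ne (q : ℂ) (hq0 : q ≠ 0) (hq1 : ∀ k : ℕ, k ≠ 0 → q ^ k ≠ 1) (n : ℕ) :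
    (q⁻¹) ^ (n + 1) - q ^ (n + 1) ≠ 0 := by
  intro h
  rw [sub_eq_zero, inv_pow] at h
  apply hq1 ((n + 1) + (n + 1)) (by omega)
  rw [pow_add]
  nth_rw 1 [← h]
  exact inv_mul_cancel₀ (pow_ne_zero _ hq0)

lemma Pco_rec (q k : ℂ) (hq0 : q ≠ 0) (hq1 : ∀ k : ℕ, k ≠ 0 → q ^ k ≠ 1) (hk : k ≠ 0)
    (γ : ℕ → ℂ) (h0 : γ 0 = k) (n : ℕ) :
    ∑ p ∈ Finset.HasAntidiagonal.antidiagonal n, γ p.1 * (q ^ p.2 * Pco q k γ p.2) =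
      k * ((q⁻¹) ^ n * Pco q k γ n) := by
  rcases n with _ | n
  · simp [Pco, h0]
  · rw [Finset.Nat.sum_antidiagonal_succ, Finset.Nat.sum_antidiagonal_eq_sum_range_succ_mk]
    simp only [h0]
    have hne := mul_ne_zero hk (qinv_sub_ne q hq0 hq1 n)
    have : ∑ s ∈ Finset.range (n + 1), γ (s + 1) * (q ^ (n - s) * Pco q k γ (n - s)) =
        (k * ((q⁻¹) ^ (n + 1) - q ^ (n + 1))) * Pco q k γ (n + 1) := by
      rw [Pco, mul_inv_cancel_left₀ hne]
    rw [this]; ring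

section
variable {V : Type} [AddCommGroup V] [Module ℂ V]

/-- the vectors `w_{k,r}`. -/
def wkr (q : ℂ) (Pc : ℕ → ℂ) (y : ℤ → Module.End ℂ V) (v : V) (k r : ℕ) : V :=
  ∑ p ∈ Finset.HasAntidiagonal.antidiagonal r,
    (q ^ p.2 * Pc p.2) • (coeff p.1 ((ySer (fun _ => 1) y) ^ k) v)

lemma coeff_pow_b (p : ℂ) (y : ℤ → Module.End ℂ V) (k i : ℕ) :
    coeff i ((ySer (fun m => p ^ m) y) ^ k) = p ^ i • coeff i ((ySer (fun _ => 1) y) ^ k) := by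
  induction k generalizing i with
  | zero =>
    simp only [pow_zero, coeff_one]
    split_ifs with h <;> simp [h]
  | succ k ih =>
    rw [pow_succ, pow_succ, coeff_mul, coeff_mul, Finset.smul_sum]
    refine Finset.sum_congr rfl fun x hx => ?_
    rw [Finset.HasAntidiagonal.mem_antidiagonal] at hx
    rw [ih, ← hx, pow_add]
    simp only [ySer, coeff_mk]
    split_ifs with h
    · simp
    · rw [smul_mul_smul_comm, one_smul]

lemma sl2_x_w (q k : ℂ) (hq0 : q ≠ 0) (hq1 : ∀ k : ℕ, k ≠ 0 → q ^ k ≠ 1) (hk : k ≠ 0)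
    (y : ℤ → Module.End ℂ V) (x : Module.End ℂ V) (K : Module.End ℂ V) (h : ℕ → Module.End ℂ V)
    (hK : ∀ n, K * y n = (q ^ 2)⁻¹ • (y n * K))
    (hy : ∀ (s : ℕ) (n : ℤ), ((q - q⁻¹) * ((s : ℂ) + 1)) • (h (s + 1) * y n - y n * h (s + 1)) =
      -(((q ^ 2) ^ (s + 1) - ((q ^ 2)⁻¹) ^ (s + 1)) • y (n + (s + 1))))
    (hxy : ∀ n : ℕ, n ≠ 0 → x * y n - y n * x =
      (q - q⁻¹)⁻¹ • (K * expC (q - q⁻¹) h n))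
    (hyy : ∀ m n : ℤ, y (m + 1) * y n - (q ^ 2)⁻¹ • (y n * y (m + 1)) =
      (q ^ 2)⁻¹ • (y m * y (n + 1)) - y (n + 1) * y m)
    (v : V) (hxv : x v = 0) (hKv : K v = k • v) (γ : ℕ → ℂ) (h0 : γ 0 = k)
    (hγ : ∀ n, (K * expC (q - q⁻¹) h n) v = γ n • v) (j r : ℕ) :
    x (wkr q (Pco q k γ) y v (j + 1) r) =
      ((q - q⁻¹)⁻¹ * k * (brk (q ^ 2) (j + 1) * ((q ^ 2)⁻¹ ^ r - (q ^ 2)⁻¹ ^ j))) •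
        wkr q (Pco q k γ) y v j r := by
  have hθ : q ^ 2 ≠ 0 := pow_ne_zero _ hq0
  have hθ1 : q ^ 2 ≠ 1 := hq1 2 (by norm_num)
  set Pc := Pco q k γ with hPc
  set a := ySer (fun _ => 1) y with ha
  set b := ySer (fun m => ((q ^ 2)⁻¹) ^ m) y with hb
  set c := ySer (fun m => (1 + q ^ 2) * ((q ^ 2)⁻¹) ^ m - 1) y with hc
  set φ := C K * expS (q - q⁻¹) h with hφ
  have e1 : φ * a = c * φ := phi_a _ _ hθ h y K hK hy
  have e2 : c * a = (q ^ 2) • (b * b) := ca_eq _ hθ hθ1 y hyy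
  have e3 : a + c = (1 + q ^ 2) • b := by
    ext1 m
    simp only [ha, hb, hc, ySer, map_add, coeff_smul, coeff_mk]
    split_ifs
    · simp
    · rw [← add_smul, smul_smul]; congr 1; ring
  have e4 : C x * a = a * C x + (q - q⁻¹)⁻¹ • (φ - C K) := by
    ext1 m
    simp only [ha, hφ, ySer, map_add, map_sub, coeff_smul, coeff_mk, coeff_C_mul, coeff_mul_C, coeff_C,
      expS]
    split_ifs with hm
    · simp [hm, expC]
    · rw [sub_zero, ← hxy m hm]; simp
  have e5 : C K * a = (q ^ 2)⁻¹ • (a * C K) := by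
    ext1 m
    simp only [ha, ySer, coeff_smul, coeff_mk, coeff_C_mul, coeff_mul_C]
    split_ifs
    · simp
    · simp [hK]
  have main := x_pow _ _ _ _ _ _ _ e4 e1 e5 j
  rw [TT_eq _ _ _ _ e2 e3, brk_inv _ hθ] at main
  have cf : ∀ i, x (coeff i (a ^ (j + 1)) v) =
      (q - q⁻¹)⁻¹ • (brk (q ^ 2) (j + 1) • coeff i (b ^ j * φ) v -
        ((q ^ 2)⁻¹ ^ j * brk (q ^ 2) (j + 1)) • (k • coeff i (a ^ j) v)) := by
    intro i
    have := congrArg (fun F : PowerSeries (Module.End ℂ V) => (coeff i F) v) main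
    simp only [coeff_C_mul, map_add, coeff_mul_C, coeff_smul, map_sub, smul_mul_assoc,
      LinearMap.add_apply, LinearMap.smul_apply, LinearMap.sub_apply, Module.End.mul_apply, hxv, hKv,
      map_zero, zero_add, map_smul] at this
    exact this
  have cb : ∑ p ∈ Finset.HasAntidiagonal.antidiagonal r, (q ^ p.2 * Pc p.2) •
      (coeff p.1 (b ^ j * φ) v) = (k * (q ^ 2)⁻¹ ^ r) • wkr q Pc y v j r := by
    have hφc : ∀ n, coeff n φ v = γ n • v := by
      intro n; rw [← hγ]; simp [hφ, expS]
    have hQ : ∀ (F : PowerSeries (Module.End ℂ V)) (r : ℕ),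
        ∑ p ∈ Finset.HasAntidiagonal.antidiagonal r, (q ^ p.2 * Pc p.2) • (coeff p.1 F v) =
        coeff r (F * PowerSeries.mk fun n => algebraMap ℂ (Module.End ℂ V) (q ^ n * Pc n)) v := by
      intro F r
      simp only [coeff_mul, coeff_mk, LinearMap.sum_apply, Module.End.mul_apply,
        Module.algebraMap_end_apply, map_smul]
    rw [hQ, mul_assoc, coeff_mul, wkr, LinearMap.sum_apply, Finset.smul_sum]
    refine Finset.sum_congr rfl fun p hp => ?_
    rw [Finset.HasAntidiagonal.mem_antidiagonal] at hp
    rw [Module.End.mul_apply, ← hQ]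
    simp only [hφc, smul_smul]
    rw [← Finset.sum_smul]
    have hr := Pco_rec q k hq0 hq1 hk γ h0 p.2
    rw [← hPc] at hr
    simp only [mul_comm _ (γ _)]
    rw [hr, map_smul, hb, coeff_pow_b, LinearMap.smul_apply, smul_smul]
    congr 1
    rw [← hp, pow_add]
    have : (q⁻¹) ^ p.2 = ((q ^ 2)⁻¹) ^ p.2 * q ^ p.2 := by
      rw [← mul_pow]; congr 1; field_simp
    rw [this]; ring
  rw [wkr, map_sum, ← ha]
  simp only [map_smul, cf]
  have e6 : ∀ p : ℕ × ℕ, (q ^ p.2 * Pc p.2) • ((q - q⁻¹)⁻¹ • (brk (q ^ 2) (j + 1) • coeff p.1 (b ^ j * φ) v -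
        ((q ^ 2)⁻¹ ^ j * brk (q ^ 2) (j + 1)) • (k • coeff p.1 (a ^ j) v))) =
      ((q - q⁻¹)⁻¹ * brk (q ^ 2) (j + 1)) • ((q ^ p.2 * Pc p.2) • coeff p.1 (b ^ j * φ) v) -
      ((q - q⁻¹)⁻¹ * k * ((q ^ 2)⁻¹ ^ j * brk (q ^ 2) (j + 1))) •
        ((q ^ p.2 * Pc p.2) • coeff p.1 (a ^ j) v) := by
    intro p
    simp only [smul_sub, smul_smul]
    congr 2 <;> ring

  simp only [e6]
  rw [Finset.sum_sub_distrib, ← Finset.smul_sum, ← Finset.smul_sum, cb, ← wkr.eq_1, smul_smul, ← sub_smul]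
  congr 1
  ring
end
end QAS
end

section
set_option linter.unusedSectionVars false
set_option linter.unusedSimpArgs false
namespace QAS
open PowerSeries

section
variable {V : Type} [AddCommGroup V] [Module ℂ V]

lemma exists_rel [FiniteDimensional ℂ V] (u : ℕ → V) : ∃ Q : Polynomial ℂ, Q ≠ 0 ∧
    ∑ s ∈ Finset.range (Q.natDegree + 1), Q.coeff s • u s = 0 := by
  let f : Polynomial ℂ →ₗ[ℂ] V := Polynomial.lsum fun n => LinearMap.toSpanSingleton ℂ V (u n)
  have hf : ¬ Function.Injective f := by
    intro h
    have := Module.Finite.of_injective f h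
    exact Polynomial.not_finite this
  rw [← LinearMap.ker_eq_bot, Submodule.eq_bot_iff] at hf
  push Not at hf
  obtain ⟨Q, h1, h2⟩ := hf
  refine ⟨Q, h2, ?_⟩
  have h3 : Q.sum (fun n c => c • u n) = 0 := by
    have := LinearMap.mem_ker.1 h1
    simpa [f, Polynomial.lsum_apply] using this
  rwa [Polynomial.sum_over_range] at h3
  simp

lemma wkr_eig (q k p : ℂ) (Pc : ℕ → ℂ)
    (y : ℤ → Module.End ℂ V) (K : Module.End ℂ V)
    (hK : ∀ n, K * y n = p • (y n * K)) (v : V) (hKv : K v = k • v) (j r : ℕ) :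
    K (wkr q Pc y v j r) = (k * p ^ j) • wkr q Pc y v j r := by
  have h1 : ∀ j i, K * coeff i ((ySer (fun _ => 1) y) ^ j) =
      p ^ j • (coeff i ((ySer (fun _ => 1) y) ^ j) * K) := by
    intro j
    induction j with
    | zero => intro i; simp [coeff_one]
    | succ j ih =>
      intro i
      rw [pow_succ, coeff_mul, Finset.mul_sum, Finset.sum_mul, Finset.smul_sum]
      refine Finset.sum_congr rfl fun x _ => ?_
      rw [← mul_assoc, ih, smul_mul_assoc, mul_assoc, mul_assoc]
      simp only [ySer, coeff_mk]
      split_ifs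
      · simp
      · rw [one_smul, hK, mul_smul_comm, smul_smul, pow_succ]
  rw [wkr, map_sum, Finset.smul_sum]
  refine Finset.sum_congr rfl fun x _ => ?_
  rw [map_smul, ← Module.End.mul_apply, h1, LinearMap.smul_apply, Module.End.mul_apply, hKv, map_smul,
    smul_smul, smul_smul, smul_smul]
  congr 1; ring

lemma pow_inj_of (q : ℂ) (hq0 : q ≠ 0) (hq1 : ∀ k : ℕ, k ≠ 0 → q ^ k ≠ 1) :
    Function.Injective fun n : ℤ => q ^ n := by
  have key : ∀ m : ℤ, m ≠ 0 → q ^ m ≠ 1 := by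
    intro m hm h
    rcases Int.natAbs_eq m with h' | h'
    · rw [h', zpow_natCast] at h
      exact hq1 _ (by omega) h
    · rw [h', zpow_neg, zpow_natCast, inv_eq_one] at h
      exact hq1 _ (by omega) h
  intro a b h
  by_contra hab
  apply key (a - b) (by omega)
  simp only at h
  rw [zpow_sub₀ hq0, h, div_self (zpow_ne_zero _ hq0)]

lemma Pco_fin [FiniteDimensional ℂ V] (q k : ℂ) (hq0 : q ≠ 0)
    (hq1 : ∀ k : ℕ, k ≠ 0 → q ^ k ≠ 1) (hk : k ≠ 0)
    (y : ℤ → Module.End ℂ V) (x : Module.End ℂ V) (K : Module.End ℂ V) (h : ℕ → Module.End ℂ V)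
    (hK : ∀ n, K * y n = (q ^ 2)⁻¹ • (y n * K))
    (hy : ∀ (s : ℕ) (n : ℤ), ((q - q⁻¹) * ((s : ℂ) + 1)) • (h (s + 1) * y n - y n * h (s + 1)) =
      -(((q ^ 2) ^ (s + 1) - ((q ^ 2)⁻¹) ^ (s + 1)) • y (n + (s + 1))))
    (hxy : ∀ n : ℕ, n ≠ 0 → x * y n - y n * x =
      (q - q⁻¹)⁻¹ • (K * expC (q - q⁻¹) h n))
    (hyy : ∀ m n : ℤ, y (m + 1) * y n - (q ^ 2)⁻¹ • (y n * y (m + 1)) =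
      (q ^ 2)⁻¹ • (y m * y (n + 1)) - y (n + 1) * y m)
    (v : V) (hv : v ≠ 0) (hxv : x v = 0) (hKv : K v = k • v) (γ : ℕ → ℂ) (h0 : γ 0 = k)
    (hγ : ∀ n, (K * expC (q - q⁻¹) h n) v = γ n • v) :
    ∃ j0 : ℕ, ∀ r, j0 ≤ r → Pco q k γ r = 0 := by
  have hθ : q ^ 2 ≠ 0 := pow_ne_zero _ hq0
  have hinj := pow_inj_of q hq0 hq1
  have hpow : ∀ j : ℕ, ((q ^ 2)⁻¹) ^ j = q ^ (-2 * (j : ℤ)) := by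
    intro j
    rw [inv_pow, ← pow_mul, neg_mul, zpow_neg]
    congr 1
  have h1 : ∃ j0, ∀ r, wkr q (Pco q k γ) y v j0 r = 0 := by
    by_contra hcon
    push Not at hcon
    choose r hr using hcon
    have hfin : Set.Finite (Module.End.HasEigenvalue K) := Module.End.finite_hasEigenvalue K
    have : Set.range (fun j : ℕ => k * ((q ^ 2)⁻¹) ^ j) ⊆ {μ | Module.End.HasEigenvalue K μ} := by
      rintro _ ⟨j, rfl⟩
      exact Module.End.hasEigenvalue_of_hasEigenvector
        (Module.End.hasEigenvector_iff.2 ⟨Module.End.mem_eigenspace_iff.2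
          (wkr_eig q k _ (Pco q k γ) y K hK v hKv j (r j)), hr j⟩)
    refine Set.infinite_range_of_injective ?_ (hfin.subset this)
    intro a b hab
    simp only [hpow] at hab
    have := hinj (mul_left_cancel₀ hk hab)
    omega
  obtain ⟨j0, hj0⟩ := h1
  refine ⟨j0, fun r hr => ?_⟩
  have h2 : ∀ i ≤ j0, wkr q (Pco q k γ) y v (j0 - i) r = 0 := by
    intro i hi
    induction i with
    | zero => exact hj0 r
    | succ i ih =>
      have := sl2_x_w q k hq0 hq1 hk y x K h hK hy hxy hyy v hxv hKv γ h0 hγ (j0 - (i + 1)) r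
      have e : j0 - (i + 1) + 1 = j0 - i := by omega
      rw [e, ih (by omega), map_zero] at this
      refine (smul_eq_zero.1 this.symm).resolve_left ?_
      refine mul_ne_zero (mul_ne_zero (inv_ne_zero ?_) hk) (mul_ne_zero ?_ ?_)
      · have := qinv_sub_ne q hq0 hq1 0
        intro h; apply this; simp only [zero_add, pow_one]; linear_combination -h
      · rw [← e]; refine brk_ne _ ?_ _
        intro m hm; rw [← pow_mul]; exact hq1 _ (by omega)
      · rw [hpow, hpow]
        intro h
        have := hinj (sub_eq_zero.1 h)
        omega
  have h3 := h2 j0 le_rfl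
  rw [Nat.sub_self, wkr] at h3
  rw [Finset.sum_eq_single (0, r)] at h3
  · simp only [pow_zero, coeff_zero_one, Module.End.one_apply] at h3
    have := (smul_eq_zero.1 h3).resolve_right hv
    exact (mul_eq_zero.1 this).resolve_left (pow_ne_zero _ hq0)
  · intro b hb hne
    rw [Finset.HasAntidiagonal.mem_antidiagonal] at hb
    have : b.1 ≠ 0 := by
      intro h; apply hne; ext
      · exact h
      · simp; omega
    simp [coeff_one, this]
  · intro hb; exact absurd (by simp) hb
end
end QAS
end

section
set_option linter.unusedSectionVars false
set_option linter.unusedSimpArgs false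
namespace QAS
open PowerSeries

lemma ann_vanish (Q : Polynomial ℂ) (hQ : Q ≠ 0) (G : ℤ → ℂ) (hG : annih Q G) (d : ℤ)
    (hd : ∀ n, d < n → G n = 0) : ∀ n, G n = 0 := by
  have h1 : ∀ i : ℕ, ∀ n, d - i < n → G n = 0 := by
    intro i
    induction i with
    | zero => intro n hn; exact hd n (by simpa using hn)
    | succ i ih =>
      intro n hn
      rcases lt_or_ge (d - i) n with h | h
      · exact ih n h
      · have hn' : n = d - i := by push_cast at hn; omega
        have := hG (n + Q.natDegree)
        rw [Finset.sum_eq_single Q.natDegree] at this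
        · rw [add_sub_cancel_right] at this
          exact (mul_eq_zero.1 this).resolve_left (by simpa using hQ)
        · intro b hb hne
          have : b < Q.natDegree := by
            have := Finset.mem_range.1 hb; omega
          rw [ih _ (by omega), mul_zero]
        · intro hb; exact absurd (Finset.mem_range.2 (by omega)) hb
  intro n
  exact h1 (d - n + 1).toNat n (by omega)

lemma pscale_coeff (u : ℂ) (P : Polynomial ℂ) (n : ℕ) : (pscale u P).coeff n = u ^ n * P.coeff n := by
  rw [pscale, Polynomial.comp_C_mul_X_coeff, mul_comm]

lemma sq_one_cases (z : ℂ) (h : z ^ 2 = 1) : z = 1 ∨ z = -1 := by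
  rcases mul_eq_zero.1 (show (z - 1) * (z + 1) = 0 by linear_combination h) with h | h
  · left; exact sub_eq_zero.1 h
  · right; exact eq_neg_of_add_eq_zero_left h

lemma drin_numeric (q k : ℂ) (hq0 : q ≠ 0) (hk : k ≠ 0)
    (γp γm : ℤ → ℂ) (hp : ∀ n < 0, γp n = 0) (hm : ∀ n > 0, γm n = 0) (hp0 : γp 0 = k)
    (hm0 : γm 0 = k⁻¹) (Pc : ℕ → ℂ) (hP0 : Pc 0 = 1) (j0 : ℕ) (hPf : ∀ r, j0 ≤ r → Pc r = 0)
    (hrec : ∀ n : ℕ, ∑ p ∈ Finset.HasAntidiagonal.antidiagonal n, γp (p.1 : ℤ) * (q ^ p.2 * Pc p.2) =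
      k * ((q⁻¹) ^ n * Pc n))
    (Q : Polynomial ℂ) (hQ : Q ≠ 0) (hann : annih Q fun n => γp n - γm n) :
    ∃ (P : Polynomial ℂ) (ε : ℂ), P.coeff 0 = 1 ∧ (ε = 1 ∨ ε = -1) ∧
      (∀ n, γp n = ε * (if 0 ≤ n then q ^ P.natDegree * PowerSeries.coeff n.toNat
        (toPS (pscale q⁻¹ P) * (toPS (pscale q P))⁻¹) else 0)) ∧
      (∀ n, γm n = ε * (if n ≤ 0 then q ^ P.natDegree * PowerSeries.coeff (-n).toNat
        (toPS ((pscale q⁻¹ P).reflect P.natDegree) *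
          (toPS ((pscale q P).reflect P.natDegree))⁻¹) else 0)) := by
  let P : Polynomial ℂ := ∑ r ∈ Finset.range j0, Polynomial.monomial r (Pc r)
  have hPc : ∀ r, P.coeff r = Pc r := by
    intro r
    simp only [P, Polynomial.finsetSum_coeff, Polynomial.coeff_monomial, Finset.sum_ite_eq',
      Finset.mem_range]
    split_ifs with h
    · rfl
    · rw [hPf r (by omega)]
  have hPne : P ≠ 0 := by
    intro h; have := hPc 0; rw [h, hP0] at this; simp at this
  set d := P.natDegree with hd
  have hPd : ∀ r, d < r → Pc r = 0 := fun r hr => by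
    rw [← hPc]; exact Polynomial.coeff_eq_zero_of_natDegree_lt hr
  have hPdne : Pc d ≠ 0 := by
    rw [← hPc]; simpa [hd] using hPne
  -- convolution
  let cv : (ℤ → ℂ) → ℤ → ℂ := fun f n => ∑ j ∈ Finset.range (d + 1), (q ^ j * Pc j) * f (n - j)
  have cvp : ∀ n : ℕ, cv γp n = k * ((q⁻¹) ^ n * Pc n) := by
    intro n
    rw [← hrec, Finset.Nat.antidiagonal_eq_map', Finset.sum_map]
    simp only [cv, Function.Embedding.coeFn_mk]
    have e1 : ∀ D, n ≤ D → d ≤ D → ∑ j ∈ Finset.range (d + 1), (q ^ j * Pc j) * γp (n - j) =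
        ∑ j ∈ Finset.range (D + 1), (q ^ j * Pc j) * γp (n - j) := by
      intro D h1 h2
      apply Finset.sum_subset (Finset.range_mono (by omega))
      intro x _ hx
      rw [hPd x (by simp at hx; omega)]; simp
    have e2 : ∀ D, n ≤ D → d ≤ D → ∑ j ∈ Finset.range (n + 1), (q ^ j * Pc j) * γp (n - j) =
        ∑ j ∈ Finset.range (D + 1), (q ^ j * Pc j) * γp (n - j) := by
      intro D h1 h2
      apply Finset.sum_subset (Finset.range_mono (by omega))
      intro x _ hx
      rw [hp _ (by simp at hx; omega)]; simp
    rw [e1 (max n d) (le_max_left _ _) (le_max_right _ _), ← e2 (max n d) (le_max_left _ _) (le_max_right _ _)]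
    refine Finset.sum_congr rfl fun j hj => ?_
    have : j ≤ n := by simp at hj; omega
    rw [mul_comm]; congr 2
    show (n : ℤ) - j = ((n - j : ℕ) : ℤ)
    omega
  have cvpn : ∀ n : ℤ, n < 0 → cv γp n = 0 := by
    intro n hn
    apply Finset.sum_eq_zero
    intro j _
    rw [hp _ (by omega), mul_zero]
  have hG : ∀ n, cv (fun n => γp n - γm n) n = 0 := by
    apply ann_vanish Q hQ _ _ d
    · intro n hn
      have e1 : cv (fun n => γp n - γm n) n = cv γp n - cv γm n := by
        simp only [cv, mul_sub, Finset.sum_sub_distrib]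
      have e2 : cv γm n = 0 := by
        apply Finset.sum_eq_zero
        intro j hj
        rw [hm _ (by simp at hj; omega), mul_zero]
      obtain ⟨m, rfl⟩ := Int.eq_ofNat_of_zero_le (show 0 ≤ n by omega)
      rw [e1, e2, cvp, hPd m (by omega)]; simp
    · intro n
      simp only [cv, Finset.mul_sum]
      rw [Finset.sum_comm]
      apply Finset.sum_eq_zero
      intro j _
      have := hann (n - j)
      simp only at this
      calc _ = (q ^ j * Pc j) * ∑ s ∈ Finset.range (Q.natDegree + 1), Q.coeff s * (γp (n - j - s) - γm (n - j - s)) := by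
              rw [Finset.mul_sum]
              refine Finset.sum_congr rfl fun s _ => ?_
              rw [sub_right_comm]; ring
        _ = 0 := by rw [this, mul_zero]
  have hcv : ∀ n, cv γm n = cv γp n := by
    intro n
    have := hG n
    simp only [cv, mul_sub, Finset.sum_sub_distrib] at this
    exact (sub_eq_zero.1 this).symm
  have htop : (q ^ d * Pc d) * k⁻¹ = k * ((q⁻¹) ^ d * Pc d) := by
    rw [← cvp, ← hcv, ← hm0]
    symm
    simp only [cv]
    rw [Finset.sum_eq_single d]
    · simp
    · intro b hb hne
      rw [hm _ (by simp at hb; omega), mul_zero]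
    · intro hb; exact absurd (Finset.mem_range.2 (by omega)) hb
  have hqd : q ^ d ≠ 0 := pow_ne_zero _ hq0
  have hsq : (k / q ^ d) ^ 2 = 1 := by
    rw [inv_pow] at htop
    field_simp at htop ⊢
    first | exact htop.symm | (rw [← htop])
  have hkε : k / q ^ d * q ^ d = k := div_mul_cancel₀ _ hqd
  refine ⟨P, k / q ^ d, by rw [hPc, hP0], sq_one_cases _ hsq, ?_, ?_⟩
  · intro n
    split_ifs with hn
    · obtain ⟨m, rfl⟩ := Int.eq_ofNat_of_zero_le hn
      rw [← hd, ← mul_assoc, hkε]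
      have : (PowerSeries.mk fun n : ℕ => γp n) = (C k * toPS (pscale q⁻¹ P)) * (toPS (pscale q P))⁻¹ := by
        rw [PowerSeries.eq_mul_inv_iff_mul_eq]
        · ext n
          rw [coeff_C_mul]
          simp only [coeff_mul, coeff_mk, toPS, pscale_coeff, hPc]
          exact hrec n
        · simp [toPS, pscale_coeff, hPc, hP0, ← PowerSeries.coeff_zero_eq_constantCoeff_apply]
      have := congrArg (coeff m) this
      rw [mul_assoc, coeff_C_mul, coeff_mk] at this
      rw [this]; simp
    · rw [hp n (by omega), mul_zero]
  · intro n
    split_ifs with hn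
    · obtain ⟨m, hm'⟩ := Int.eq_ofNat_of_zero_le (show 0 ≤ -n by omega)
      have hnm : n = -(m : ℤ) := by omega
      subst hnm
      rw [← hd, ← mul_assoc, hkε]
      have hrefl : ∀ u i, ((pscale u P).reflect d).coeff i = if i ≤ d then u ^ (d - i) * Pc (d - i) else 0 := by
        intro u i
        rw [Polynomial.coeff_reflect, pscale_coeff, hPc]
        split_ifs with h
        · rw [Polynomial.revAt_le h]
        · rw [Polynomial.revAt_eq_self_of_lt (by omega), hPd _ (by omega), mul_zero]
      have : (PowerSeries.mk fun n : ℕ => γm (-(n : ℤ))) = (C k * toPS ((pscale q⁻¹ P).reflect d)) *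
          (toPS ((pscale q P).reflect d))⁻¹ := by
        rw [PowerSeries.eq_mul_inv_iff_mul_eq]
        · ext n
          rw [coeff_C_mul]
          simp only [coeff_mul, coeff_mk, toPS, hrefl]
          have e1 : k * (if n ≤ d then q⁻¹ ^ (d - n) * Pc (d - n) else 0) = cv γp ((d : ℤ) - n) := by
            split_ifs with h
            · rw [← cvp]; congr 1; omega
            · rw [cvpn _ (by omega), mul_zero]
          rw [e1, ← hcv]
          simp only [cv]
          rw [← Finset.sum_range_reflect, ← Finset.Nat.sum_antidiagonal_swap,
            Finset.Nat.sum_antidiagonal_eq_sum_range_succ_mk]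
          simp only [Prod.fst_swap, Prod.snd_swap, Prod.swap_prod_mk]
          have key : ∀ D, n ≤ D → d ≤ D →
            ∑ x ∈ Finset.range (n + 1), γm (-((n - x : ℕ) : ℤ)) * (if x ≤ d then q ^ (d - x) * Pc (d - x) else 0) =
            ∑ x ∈ Finset.range (D + 1), (if x ≤ d then q ^ (d - x) * Pc (d - x) else 0) * γm (x - n) := by
            intro D h1 h2
            rw [← Finset.sum_subset (Finset.range_mono (show n + 1 ≤ D + 1 by omega))]
            · refine Finset.sum_congr rfl fun x hx => ?_
              have : x ≤ n := by simp at hx; omega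
              rw [mul_comm]; congr 2; omega
            · intro x _ hx
              rw [hm _ (by simp at hx; omega), mul_zero]
          rw [key (max n d) (le_max_left _ _) (le_max_right _ _)]
          rw [← Finset.sum_subset (Finset.range_mono (show d + 1 ≤ max n d + 1 by omega))]
          · refine Finset.sum_congr rfl fun x hx => ?_
            have hx : x ≤ d := by simp at hx; omega
            rw [if_pos hx]
            have : d + 1 - 1 - x = d - x := by omega
            rw [this]; congr 2; omega
          · intro x _ hx
            rw [if_neg (by simp at hx; omega), zero_mul]
        · rw [← PowerSeries.coeff_zero_eq_constantCoeff_apply, toPS, coeff_mk, hrefl]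
          simp [hPdne, hq0]
      have := congrArg (coeff m) this
      rw [mul_assoc, coeff_C_mul, coeff_mk] at this
      rw [this]; simp
    · rw [hm n (by omega), mul_zero]

section
variable {V : Type} [AddCommGroup V] [Module ℂ V]

lemma sl2_main [FiniteDimensional ℂ V] (q : ℂ) (hq0 : q ≠ 0)
    (hq1 : ∀ k : ℕ, k ≠ 0 → q ^ k ≠ 1)
    (x y : ℤ → Module.End ℂ V) (K Ki : Module.End ℂ V) (h : ℕ → Module.End ℂ V)
    (φp φm : ℤ → Module.End ℂ V)
    (hφp : ∀ n : ℕ, φp n = K * expC (q - q⁻¹) h n) (hφpn : ∀ n < 0, φp n = 0)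
    (hφm0 : φm 0 = Ki) (hφm : ∀ n > 0, φm n = 0) (hKiK : Ki * K = 1)
    (hK : ∀ n, K * y n = (q ^ 2)⁻¹ • (y n * K))
    (hy : ∀ (s : ℕ) (n : ℤ), ((q - q⁻¹) * ((s : ℂ) + 1)) • (h (s + 1) * y n - y n * h (s + 1)) =
      -(((q ^ 2) ^ (s + 1) - ((q ^ 2)⁻¹) ^ (s + 1)) • y (n + (s + 1))))
    (hxy : ∀ m n, x m * y n - y n * x m = (q - q⁻¹)⁻¹ • (φp (m + n) - φm (m + n)))
    (hyy : ∀ m n : ℤ, y (m + 1) * y n - (q ^ 2)⁻¹ • (y n * y (m + 1)) =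
      (q ^ 2)⁻¹ • (y m * y (n + 1)) - y (n + 1) * y m)
    (v : V) (hv : v ≠ 0) (hxv : ∀ n, x n v = 0) (γp γm : ℤ → ℂ)
    (hγp : ∀ n, φp n v = γp n • v) (hγm : ∀ n, φm n v = γm n • v) :
    ∃ (P : Polynomial ℂ) (ε : ℂ), P.coeff 0 = 1 ∧ (ε = 1 ∨ ε = -1) ∧
      (∀ n, γp n = ε * (if 0 ≤ n then q ^ P.natDegree * PowerSeries.coeff n.toNat
        (toPS (pscale q⁻¹ P) * (toPS (pscale q P))⁻¹) else 0)) ∧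
      (∀ n, γm n = ε * (if n ≤ 0 then q ^ P.natDegree * PowerSeries.coeff (-n).toNat
        (toPS ((pscale q⁻¹ P).reflect P.natDegree) *
          (toPS ((pscale q P).reflect P.natDegree))⁻¹) else 0)) := by
  have hqq : q - q⁻¹ ≠ 0 := by
    have := qinv_sub_ne q hq0 hq1 0
    intro h; apply this; simp only [zero_add, pow_one]; linear_combination -h
  have inj : ∀ a b : ℂ, a • v = b • v → a = b := fun a b hab => by
    have := sub_smul a b v
    rw [hab, sub_self] at this
    exact sub_eq_zero.1 ((smul_eq_zero.1 this).resolve_right hv)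
  have hKv : K v = γp 0 • v := by rw [← hγp]; have := hφp 0; simp [expC] at this; rw [this]
  have hkk : γm 0 * γp 0 = 1 := by
    apply inj
    have : (Ki * K) v = v := by rw [hKiK]; rfl
    rw [Module.End.mul_apply, hKv, map_smul, ← hφm0, hγm, smul_smul, mul_comm] at this
    rw [this, one_smul]
  have hk : γp 0 ≠ 0 := right_ne_zero_of_mul_eq_one hkk
  have hp : ∀ n < 0, γp n = 0 := fun n hn => by
    apply inj; rw [← hγp, hφpn n hn]; simp
  have hm : ∀ n > 0, γm n = 0 := fun n hn => by
    apply inj; rw [← hγm, hφm n hn]; simp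
  obtain ⟨j0, hj0⟩ := Pco_fin q (γp 0) hq0 hq1 hk y (x 0) K h hK hy (by
      intro n hn
      rw [hxy, ← hφp, zero_add, hφm n (by omega), sub_zero]) hyy v hv (hxv 0) hKv (fun n => γp n) rfl
      (fun n => by rw [← hφp, hγp])
  obtain ⟨Q, hQ, hrel⟩ := exists_rel fun s : ℕ => y (-s) v
  refine drin_numeric q (γp 0) hq0 hk γp γm hp hm rfl (eq_inv_of_mul_eq_one_left hkk)
    (Pco q (γp 0) fun n => γp n) (by simp [Pco]) j0 hj0
    (Pco_rec q (γp 0) hq0 hq1 hk (fun n => γp n) rfl) Q hQ ?_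
  intro n
  have e : ∀ s : ℕ, x n (y (-s) v) = ((q - q⁻¹)⁻¹ * (γp (n - s) - γm (n - s))) • v := by
    intro s
    have := congrArg (fun F : Module.End ℂ V => F v) (hxy n (-s))
    simp only [LinearMap.sub_apply, Module.End.mul_apply, hxv, map_zero, sub_zero,
      LinearMap.smul_apply, hγp, hγm, ← sub_smul, smul_smul] at this
    exact this
  have := congrArg (x n) hrel
  simp only [map_sum, map_smul, e, map_zero, smul_smul, ← Finset.sum_smul] at this
  have := (smul_eq_zero.1 this).resolve_right hv
  apply mul_left_cancel₀ (inv_ne_zero hqq)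
  rw [mul_zero, ← this, Finset.mul_sum]
  refine Finset.sum_congr rfl fun s _ => by ring
end
end QAS
end

section
set_option linter.unusedSectionVars false
set_option linter.unusedSimpArgs false
namespace QAS

section gens
variable (q : ℂ) (M N : ℕ) (ext : Bool)

/-- image of a generator. -/
def gx (g : Gen M N ext) : ALG q M N ext 3 := mkA q M N ext 3 (gi g)

variable {q M N ext}

lemma mkA_rel {a b : FA M N ext} (h : rel q M N ext 3 a b) : mkA q M N ext 3 a = mkA q M N ext 3 b :=
  RingQuot.mkAlgHom_rel ℂ h

lemma gKKi (i : Idx M N) : gx q M N ext (Gen.K i) * gx q M N ext (Gen.Ki i) = 1 := by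
  simpa [gx] using mkA_rel (rel.KKi (q := q) (ext := ext) (lvl := 3) i)
lemma gKiK (i : Idx M N) : gx q M N ext (Gen.Ki i) * gx q M N ext (Gen.K i) = 1 := by
  simpa [gx] using mkA_rel (rel.KiK (q := q) (ext := ext) (lvl := 3) i)
lemma gKK (i j : Idx M N) : Commute (gx q M N ext (Gen.K i)) (gx q M N ext (Gen.K j)) := by
  simpa [gx, Commute, SemiconjBy] using mkA_rel (rel.KK (q := q) (ext := ext) (lvl := 3) i j)
lemma gKKi2 (i j : Idx M N) : Commute (gx q M N ext (Gen.K i)) (gx q M N ext (Gen.Ki j)) := by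
  simpa [gx, Commute, SemiconjBy] using mkA_rel (rel.KKi2 (q := q) (ext := ext) (lvl := 3) i j)
lemma gKiKi (i j : Idx M N) : Commute (gx q M N ext (Gen.Ki i)) (gx q M N ext (Gen.Ki j)) := by
  simpa [gx, Commute, SemiconjBy] using mkA_rel (rel.KiKi (q := q) (ext := ext) (lvl := 3) i j)
lemma gKH (i j : Idx M N) (s : {s : ℤ // s ≠ 0}) :
    Commute (gx q M N ext (Gen.K i)) (gx q M N ext (Gen.H j s)) := by
  simpa [gx, Commute, SemiconjBy] using mkA_rel (rel.KH (q := q) (ext := ext) (lvl := 3) i j s)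
lemma gKiH (i j : Idx M N) (s : {s : ℤ // s ≠ 0}) :
    Commute (gx q M N ext (Gen.Ki i)) (gx q M N ext (Gen.H j s)) := by
  simpa [gx, Commute, SemiconjBy] using mkA_rel (rel.KiH (q := q) (ext := ext) (lvl := 3) i j s)
lemma gHH (i j : Idx M N) (s t : {s : ℤ // s ≠ 0}) :
    Commute (gx q M N ext (Gen.H i s)) (gx q M N ext (Gen.H j t)) := by
  simpa [gx, Commute, SemiconjBy] using mkA_rel (rel.HH (q := q) (ext := ext) (lvl := 3) i j s t)
lemma gKXp (i j : Idx M N) (n : ℤ) : gx q M N ext (Gen.K i) * gx q M N ext (Gen.Xp j n) =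
    (q ^ cc M i.1 j.1) • (gx q M N ext (Gen.Xp j n) * gx q M N ext (Gen.K i)) := by
  simpa [gx] using mkA_rel (rel.KXp (q := q) (ext := ext) (lvl := 3) i j n)
lemma gKXm (i j : Idx M N) (n : ℤ) : gx q M N ext (Gen.K i) * gx q M N ext (Gen.Xm j n) =
    (q ^ (-cc M i.1 j.1)) • (gx q M N ext (Gen.Xm j n) * gx q M N ext (Gen.K i)) := by
  simpa [gx] using mkA_rel (rel.KXm (q := q) (ext := ext) (lvl := 3) i j n)

/-- subalgebra generated by the `K_i^{±1}`. -/
def CS (q : ℂ) (M N : ℕ) (ext : Bool) : Subalgebra ℂ (ALG q M N ext 3) :=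
  Algebra.adjoin ℂ {x | ∃ i, x = gx q M N ext (Gen.K i) ∨ x = gx q M N ext (Gen.Ki i)}

/-- `T` is invertible with inverse `Ti`, commutes with the Cartan generators and has
weights `w`. -/
structure HasWt (T Ti : ALG q M N ext 3) (w : ℕ → ℤ) : Prop where
  memT : T ∈ CS q M N ext
  memTi : Ti ∈ CS q M N ext
  inv1 : T * Ti = 1
  inv2 : Ti * T = 1
  cK : ∀ i, Commute T (gx q M N ext (Gen.K i))
  cKi : ∀ i, Commute T (gx q M N ext (Gen.Ki i))
  cH : ∀ i s, Commute T (gx q M N ext (Gen.H i s))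
  xp : ∀ j n, T * gx q M N ext (Gen.Xp j n) = (q ^ w j.1) • (gx q M N ext (Gen.Xp j n) * T)
  xm : ∀ j n, T * gx q M N ext (Gen.Xm j n) = (q ^ (-w j.1)) • (gx q M N ext (Gen.Xm j n) * T)

lemma HasWt.congr {T Ti : ALG q M N ext 3} {w w' : ℕ → ℤ} (h : HasWt T Ti w)
    (hw : ∀ j : Idx M N, w j.1 = w' j.1) : HasWt T Ti w' :=
  { h with
    xp := fun j n => by rw [← hw]; exact h.xp j n
    xm := fun j n => by rw [← hw]; exact h.xm j n }

lemma HasWt.one : HasWt (1 : ALG q M N ext 3) 1 (fun _ => 0) where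
  memT := one_mem _
  memTi := one_mem _
  inv1 := by simp
  inv2 := by simp
  cK := fun _ => Commute.one_left _
  cKi := fun _ => Commute.one_left _
  cH := fun _ _ => Commute.one_left _
  xp := by simp
  xm := by simp

lemma HasWt.K (i : Idx M N) : HasWt (gx q M N ext (Gen.K i)) (gx q M N ext (Gen.Ki i))
    (fun j => cc M i.1 j) where
  memT := Algebra.subset_adjoin ⟨i, Or.inl rfl⟩
  memTi := Algebra.subset_adjoin ⟨i, Or.inr rfl⟩
  inv1 := gKKi i
  inv2 := gKiK i
  cK := gKK i
  cKi := gKKi2 i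
  cH := gKH i
  xp := gKXp i
  xm := gKXm i

lemma swap_inv {A : Type} [Ring A] [Algebra ℂ A] {T Ti x : A} {u : ℂ} (hu : u ≠ 0) (h1 : T * Ti = 1) (h2 : Ti * T = 1)
    (h : T * x = u • (x * T)) : Ti * x = u⁻¹ • (x * Ti) := by
  calc Ti * x = u⁻¹ • (Ti * (u • (x * T)) * Ti) := by
        rw [mul_smul_comm, smul_mul_assoc, smul_smul, inv_mul_cancel₀ hu, one_smul, mul_assoc, mul_assoc,
          h1, mul_one]
    _ = u⁻¹ • (x * Ti) := by rw [← h, ← mul_assoc Ti T x, h2, one_mul]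

lemma comm_inv {A : Type} [Ring A] {T Ti x : A} (h1 : T * Ti = 1) (h2 : Ti * T = 1)
    (h : Commute T x) : Commute Ti x := by
  calc Ti * x = Ti * (x * T) * Ti := by rw [mul_assoc, mul_assoc, h1, mul_one]
    _ = x * Ti := by rw [← h.eq, ← mul_assoc Ti T x, h2, one_mul]

lemma HasWt.inv (hq0 : q ≠ 0) {T Ti : ALG q M N ext 3} {w : ℕ → ℤ} (h : HasWt T Ti w) :
    HasWt Ti T (fun j => -w j) where
  memT := h.memTi
  memTi := h.memT
  inv1 := h.inv2
  inv2 := h.inv1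
  cK := fun i => comm_inv h.inv1 h.inv2 (h.cK i)
  cKi := fun i => comm_inv h.inv1 h.inv2 (h.cKi i)
  cH := fun i s => comm_inv h.inv1 h.inv2 (h.cH i s)
  xp := fun j n => by
    rw [zpow_neg]; exact swap_inv (zpow_ne_zero _ hq0) h.inv1 h.inv2 (h.xp j n)
  xm := fun j n => by
    rw [zpow_neg]; exact swap_inv (zpow_ne_zero _ hq0) h.inv1 h.inv2 (h.xm j n)

lemma HasWt.mul (hq0 : q ≠ 0) {T Ti S Si : ALG q M N ext 3} {w w' : ℕ → ℤ} (h : HasWt T Ti w)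
    (h' : HasWt S Si w') : HasWt (T * S) (Si * Ti) (fun j => w j + w' j) where
  memT := mul_mem h.memT h'.memT
  memTi := mul_mem h'.memTi h.memTi
  inv1 := by rw [mul_assoc, ← mul_assoc S, h'.inv1, one_mul, h.inv1]
  inv2 := by rw [mul_assoc, ← mul_assoc Ti, h.inv2, one_mul, h'.inv2]
  cK := fun i => (h.cK i).mul_left (h'.cK i)
  cKi := fun i => (h.cKi i).mul_left (h'.cKi i)
  cH := fun i s => (h.cH i s).mul_left (h'.cH i s)
  xp := fun j n => by
    rw [mul_assoc, h'.xp, mul_smul_comm, ← mul_assoc, h.xp, smul_mul_assoc, smul_smul, mul_assoc,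
      zpow_add₀ hq0, mul_comm]
  xm := fun j n => by
    rw [mul_assoc, h'.xm, mul_smul_comm, ← mul_assoc, h.xm, smul_mul_assoc, smul_smul, mul_assoc,
      neg_add, zpow_add₀ hq0, mul_comm]

lemma HasWt.npow (hq0 : q ≠ 0) {T Ti : ALG q M N ext 3} {w : ℕ → ℤ} (h : HasWt T Ti w) (n : ℕ) :
    ∃ S Si : ALG q M N ext 3, HasWt S Si (fun j => n * w j) := by
  induction n with
  | zero => exact ⟨1, 1, HasWt.one.congr (by simp)⟩
  | succ n ih =>
    obtain ⟨S, Si, hS⟩ := ih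
    exact ⟨_, _, (hS.mul hq0 h).congr fun j => by push_cast; ring⟩

lemma HasWt.zpow (hq0 : q ≠ 0) {T Ti : ALG q M N ext 3} {w : ℕ → ℤ} (h : HasWt T Ti w) (n : ℤ) :
    ∃ S Si : ALG q M N ext 3, HasWt S Si (fun j => n * w j) := by
  rcases Int.natAbs_eq n with h' | h'
  · obtain ⟨S, Si, hS⟩ := h.npow hq0 n.natAbs
    exact ⟨S, Si, hS.congr fun j => by rw [← h']⟩
  · obtain ⟨S, Si, hS⟩ := h.npow hq0 n.natAbs
    exact ⟨Si, S, (hS.inv hq0).congr fun j => by rw [← neg_mul, ← h']⟩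

lemma exists_wt (hq0 : q ≠ 0) (a : ℕ → ℤ) (ha : a 0 = 0) (n : ℕ) (hn : n ≤ M + N - 1) :
    ∃ S Si : ALG q M N ext 3, HasWt S Si (fun j => ∑ i ∈ Finset.range (n + 1), a i * cc M i j) := by
  induction n with
  | zero => exact ⟨1, 1, HasWt.one.congr fun j => by simp [ha]⟩
  | succ n ih =>
    obtain ⟨S, Si, hS⟩ := ih (by omega)
    obtain ⟨R, Ri, hR⟩ := (HasWt.K (q := q) (ext := ext) (⟨n + 1, by omega, hn⟩ : Idx M N)).zpow hq0 (a (n + 1))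
    exact ⟨_, _, (hS.mul hq0 hR).congr fun j => by rw [Finset.sum_range_succ _ (n + 1)]⟩

lemma lof_sq (M i : ℕ) : lof M i * lof M i = 1 := by
  unfold lof; split_ifs <;> simp

lemma wt_sum (y : ℕ → ℤ) (hM : 1 ≤ M) (hN : 1 ≤ N)
    (hy : ∑ k ∈ Finset.range (M + N), lof M (k + 1) * y (k + 1) = 0) (j : ℕ) (hj1 : 1 ≤ j)
    (hj2 : j ≤ M + N - 1) :
    ∑ i ∈ Finset.range (M + N - 1 + 1), (∑ k ∈ Finset.range i, lof M (k + 1) * y (k + 1)) * cc M i j =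
      y j - y (j + 1) := by
  set a : ℕ → ℤ := fun i => ∑ k ∈ Finset.range i, lof M (k + 1) * y (k + 1) with ha
  have has : ∀ i, a (i + 1) = a i + lof M (i + 1) * y (i + 1) := fun i => by
    simp only [ha, Finset.sum_range_succ]
  have h1 : ∑ i ∈ Finset.range (M + N - 1 + 1), a i * cc M i j =
      ∑ i ∈ Finset.range (M + N + 1), a i * cc M i j := by
    rw [Finset.sum_range_succ _ (M + N), show M + N - 1 + 1 = M + N by omega]
    have : a (M + N) = 0 := hy
    simp [this]
  rw [h1]
  obtain ⟨j, rfl⟩ : ∃ j', j = j' + 1 := ⟨j - 1, by omega⟩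
  simp only [cc, form4, innerE, mul_add, mul_sub, mul_ite, mul_zero, Finset.sum_add_distrib,
    Finset.sum_sub_distrib, Nat.add_right_cancel_iff, Finset.sum_ite_eq', Finset.mem_range]
  rw [if_pos (by omega), if_pos (by omega), if_pos (by omega), if_pos (by omega)]
  rw [has (j + 1), has j]
  linear_combination (y (j + 1)) * lof_sq M (j + 1) - y (j + 2) * lof_sq M (j + 2)

lemma sum_lof (M N : ℕ) : ∑ k ∈ Finset.range (M + N), lof M (k + 1) = (M : ℤ) - N := by
  rw [Finset.sum_range_add]
  have h1 : ∑ k ∈ Finset.range M, lof M (k + 1) = M := by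
    rw [Finset.sum_congr rfl (g := fun _ => (1 : ℤ))]
    · simp
    · intro k hk; have := Finset.mem_range.1 hk; simp [lof]; omega
  have h2 : ∑ k ∈ Finset.range N, lof M (M + k + 1) = -N := by
    rw [Finset.sum_congr rfl (g := fun _ => (-1 : ℤ))]
    · simp
    · intro k hk; simp [lof]
  rw [h1, h2]; ring

lemma exists_height (hq0 : q ≠ 0) (hM : 1 ≤ M) (hN : 1 ≤ N) :
    ∃ T Ti : ALG q M N ext 3, HasWt T Ti (fun _ => (M : ℤ) - N) := by
  let t : ℤ := ∑ k ∈ Finset.range (M + N), lof M (k + 1) * ((k + 1 : ℕ) : ℤ)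
  let y : ℕ → ℤ := fun k => -((M : ℤ) - N) * (k : ℤ) + t
  have hy : ∑ k ∈ Finset.range (M + N), lof M (k + 1) * y (k + 1) = 0 := by
    have : ∀ k : ℕ, lof M (k + 1) * y (k + 1) =
      -((M : ℤ) - N) * (lof M (k + 1) * ((k + 1 : ℕ) : ℤ)) + t * lof M (k + 1) := by
      intro k; simp only [y]; ring
    simp only [this, Finset.sum_add_distrib, ← Finset.mul_sum, sum_lof]
    simp only [t]; ring
  obtain ⟨S, Si, hS⟩ := exists_wt (q := q) (M := M) (N := N) (ext := ext) hq0
    (fun i => ∑ k ∈ Finset.range i, lof M (k + 1) * y (k + 1)) (by simp) (M + N - 1) le_rfl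
  refine ⟨S, Si, hS.congr fun j => ?_⟩
  rw [wt_sum y hM hN hy j.1 j.2.1 j.2.2]
  simp only [y]; push_cast; ring

lemma exists_k0wt (hq0 : q ≠ 0) (hM : 1 ≤ M) (hN : 1 ≤ N) :
    ∃ T Ti : ALG q M N ext 3, HasWt T Ti (fun j => if j = 1 then (M : ℤ) - N else 0) := by
  let y : ℕ → ℤ := fun k => if k = 1 then (M : ℤ) - N - 1 else -1
  have hy : ∑ k ∈ Finset.range (M + N), lof M (k + 1) * y (k + 1) = 0 := by
    have : ∀ k : ℕ, lof M (k + 1) * y (k + 1) =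
      (if k = 0 then ((M : ℤ) - N) else 0) - lof M (k + 1) := by
      intro k; simp only [y]
      rcases k with _ | k
      · simp [lof, hM]
      · simp
    simp only [this, Finset.sum_sub_distrib, sum_lof, Finset.sum_ite_eq', Finset.mem_range]
    rw [if_pos (by omega), sub_self]
  obtain ⟨S, Si, hS⟩ := exists_wt (q := q) (M := M) (N := N) (ext := ext) hq0
    (fun i => ∑ k ∈ Finset.range i, lof M (k + 1) * y (k + 1)) (by simp) (M + N - 1) le_rfl
  refine ⟨S, Si, hS.congr fun j => ?_⟩
  rw [wt_sum y hM hN hy j.1 j.2.1 j.2.2]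
  have := j.2.1
  simp only [y]
  split_ifs <;> first | omega | ring
end gens
end QAS
end

section
set_option linter.unusedSectionVars false
set_option linter.unusedSimpArgs false
namespace QAS

section stepB
variable {q : ℂ} {M N : ℕ} {ext : Bool}

/-- induction principle for the algebra. -/
lemma alg_induction {C : ALG q M N ext 3 → Prop} (hc : ∀ c : ℂ, C (algebraMap ℂ _ c))
    (hg : ∀ g, C (gx q M N ext g)) (hadd : ∀ a b, C a → C b → C (a + b))
    (hmul : ∀ a b, C a → C b → C (a * b)) (a : ALG q M N ext 3) : C a := by
  obtain ⟨b, rfl⟩ := RingQuot.mkAlgHom_surjective ℂ (rel q M N ext 3) a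
  change C (mkA q M N ext 3 b)
  induction b using FreeAlgebra.induction with
  | grade0 r => simpa using hc r
  | grade1 x => exact hg x
  | mul a b ha hb => rw [map_mul]; exact hmul _ _ ha hb
  | add a b ha hb => rw [map_add]; exact hadd _ _ ha hb

variable {V : Type} [AddCommGroup V] [Module ℂ V]

lemma alg_stable (ρ : ALG q M N ext 3 →ₐ[ℂ] Module.End ℂ V) (W : Submodule ℂ V)
    (h : ∀ g, ∀ w ∈ W, ρ (gx q M N ext g) w ∈ W) (a : ALG q M N ext 3) : ∀ w ∈ W, ρ a w ∈ W := by
  induction a using alg_induction with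
  | hc c => intro w hw; simpa [Algebra.algebraMap_eq_smul_one] using W.smul_mem c hw
  | hg g => exact h g
  | hadd a b ha hb => intro w hw; simpa using W.add_mem (ha w hw) (hb w hw)
  | hmul a b ha hb => intro w hw; simpa using ha _ (hb w hw)

lemma joint_eigen {ι : Type} [FiniteDimensional ℂ V] (f : ι → Module.End ℂ V)
    (hf : ∀ i j, Commute (f i) (f j)) (n : ℕ) : ∀ (W : Submodule ℂ V), W ≠ ⊥ →
    Module.finrank ℂ W ≤ n →
    (∀ i, ∀ w ∈ W, f i w ∈ W) → ∃ v ∈ W, v ≠ 0 ∧ ∀ i, ∃ c : ℂ, f i v = c • v := by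
  induction n with
  | zero =>
    intro W hW hn
    exact absurd (Submodule.finrank_eq_zero.1 (Nat.le_zero.1 hn)) hW
  | succ n ih =>
    intro W hW hn hs
    by_cases hsc : ∀ i, ∃ c : ℂ, ∀ w ∈ W, f i w = c • w
    · obtain ⟨v, hv, hv0⟩ := Submodule.exists_mem_ne_zero_of_ne_bot hW
      exact ⟨v, hv, hv0, fun i => (hsc i).imp fun c hc => hc v hv⟩
    · push Not at hsc
      obtain ⟨i, hi⟩ := hsc
      haveI : Nontrivial W := Submodule.nontrivial_iff_ne_bot.2 hW
      obtain ⟨c, hc⟩ := Module.End.exists_eigenvalue ((f i).restrict (hs i))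
      obtain ⟨u, hu⟩ := hc.exists_hasEigenvector
      have hu1 := hu.apply_eq_smul
      have hu2 : f i u.1 = c • u.1 := congrArg Subtype.val hu1
      have hu0 : u.1 ≠ 0 := fun h => hu.2 (Subtype.ext h)
      let E : Submodule ℂ V := W ⊓ Module.End.eigenspace (f i) c
      have hE : E ≠ ⊥ := by
        intro h
        have : u.1 ∈ E := ⟨u.2, Module.End.mem_eigenspace_iff.2 hu2⟩
        rw [h] at this; exact hu0 ((Submodule.mem_bot ℂ).1 this)
      have hlt : E < W := by
        refine lt_of_le_of_ne inf_le_left fun h => ?_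
        obtain ⟨w, hw, hw'⟩ := hi c
        rw [← h] at hw
        exact hw' (Module.End.mem_eigenspace_iff.1 hw.2)
      obtain ⟨v, hv, h⟩ := ih E hE (by have := Submodule.finrank_lt_finrank_of_lt hlt; omega) (by
        intro j w hw
        refine ⟨hs j w hw.1, Module.End.mem_eigenspace_iff.2 ?_⟩
        have h1 := Module.End.mem_eigenspace_iff.1 hw.2
        have h2 := LinearMap.congr_fun (hf i j).eq w
        simp only [Module.End.mul_apply] at h2
        rw [h2, h1, map_smul])
      exact ⟨v, hv.1, h⟩

/-- index of the Cartan generators. -/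
inductive CI (M N : ℕ) : Type
  | K : Idx M N → CI M N
  | Ki : Idx M N → CI M N
  | H : Idx M N → {s : ℤ // s ≠ 0} → CI M N

/-- Cartan generators as generators. -/
def CI.gen : CI M N → Gen M N ext
  | .K i => Gen.K i
  | .Ki i => Gen.Ki i
  | .H i s => Gen.H i s

lemma CI.comm (a b : CI M N) : Commute (gx q M N ext a.gen) (gx q M N ext b.gen) := by
  rcases a with i | i | ⟨i, s⟩ <;> rcases b with j | j | ⟨j, t⟩
  · exact gKK i j
  · exact gKKi2 i j
  · exact gKH i j t
  · exact (gKKi2 j i).symm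
  · exact gKiKi i j
  · exact gKiH i j t
  · exact (gKH j i s).symm
  · exact (gKiH j i s).symm
  · exact gHH i j s t

lemma HasWt.cart {T Ti : ALG q M N ext 3} {w : ℕ → ℤ} (h : HasWt T Ti w) (a : CI M N) :
    Commute T (gx q M N ext a.gen) := by
  rcases a with i | i | ⟨i, s⟩
  exacts [h.cK i, h.cKi i, h.cH i s]

lemma zpow_inj_of (hq0 : q ≠ 0) (hq1 : ∀ k : ℕ, k ≠ 0 → q ^ k ≠ 1) {d : ℤ} (hd : d ≠ 0) :
    Function.Injective fun n : ℕ => q ^ (d * (n : ℤ)) := by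
  intro a b hab
  have := pow_inj_of q hq0 hq1 hab
  have := mul_left_cancel₀ hd this
  exact_mod_cast this

lemma exists_hw [FiniteDimensional ℂ V] [Nontrivial V] (hq0 : q ≠ 0)
    (hq1 : ∀ k : ℕ, k ≠ 0 → q ^ k ≠ 1) (hM : 1 ≤ M) (hN : 1 ≤ N) (hMN : M ≠ N)
    (ρ : ALG q M N ext 3 →ₐ[ℂ] Module.End ℂ V) :
    ∃ v : V, v ≠ 0 ∧ (∀ i n, ρ (gx q M N ext (Gen.Xp i n)) v = 0) ∧
      ∀ a : CI M N, ∃ c : ℂ, ρ (gx q M N ext a.gen) v = c • v := by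
  obtain ⟨T, Ti, hT⟩ := exists_height (q := q) (M := M) (N := N) (ext := ext) hq0 hM hN
  set d : ℤ := (M : ℤ) - N with hd
  have hd0 : d ≠ 0 := by omega
  obtain ⟨μ₀, hμ₀⟩ := Module.End.exists_eigenvalue (ρ T)
  have hTT : ρ T * ρ Ti = 1 := by rw [← map_mul, hT.inv1, map_one]
  have hTT2 : ρ Ti * ρ T = 1 := by rw [← map_mul, hT.inv2, map_one]
  have hne : ∀ μ, (ρ T).HasEigenvalue μ → μ ≠ 0 := by
    rintro μ hμ rfl
    obtain ⟨u, hu⟩ := hμ.exists_hasEigenvector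
    have h1 := hu.apply_eq_smul
    apply hu.2
    have := LinearMap.congr_fun hTT2 u
    simpa [h1] using this.symm
  have : ∃ n : ℕ, (ρ T).HasEigenvalue (μ₀ * q ^ (d * (n : ℤ))) ∧
      ¬ (ρ T).HasEigenvalue (μ₀ * q ^ (d * ((n + 1 : ℕ) : ℤ))) := by
    by_contra hcon
    push Not at hcon
    have hall : ∀ n : ℕ, (ρ T).HasEigenvalue (μ₀ * q ^ (d * (n : ℤ))) := by
      intro n
      induction n with
      | zero => simpa using hμ₀
      | succ n ih => exact hcon n ih
    have hfin := Module.End.finite_hasEigenvalue (ρ T)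
    have hinj : Function.Injective fun n : ℕ => μ₀ * q ^ (d * (n : ℤ)) := by
      intro a b hab
      exact zpow_inj_of hq0 hq1 hd0 (mul_left_cancel₀ (hne _ hμ₀) hab)
    exact Set.infinite_of_injective_forall_mem hinj hall hfin
  obtain ⟨n, hn1, hn2⟩ := this
  set μ := μ₀ * q ^ (d * (n : ℤ)) with hμ
  have hμ' : μ₀ * q ^ (d * ((n + 1 : ℕ) : ℤ)) = q ^ d * μ := by
    rw [hμ]; push_cast; rw [mul_add, mul_one, zpow_add₀ hq0]; ring
  rw [hμ'] at hn2
  obtain ⟨v, hv, hv0, hvc⟩ := joint_eigen (fun a : CI M N => ρ (gx q M N ext a.gen))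
    (fun a b => (CI.comm a b).map ρ) _ (Module.End.eigenspace (ρ T) μ) hn1 le_rfl (by
      intro a w hw
      rw [Module.End.mem_eigenspace_iff] at hw ⊢
      have h2 := LinearMap.congr_fun ((hT.cart a).map ρ).eq w
      simp only [Module.End.mul_apply] at h2
      rw [h2, hw, map_smul])
  refine ⟨v, hv0, fun i n => ?_, hvc⟩
  rw [Module.End.mem_eigenspace_iff] at hv
  by_contra h
  apply hn2
  refine Module.End.hasEigenvalue_of_hasEigenvector (x := ρ (gx q M N ext (Gen.Xp i n)) v) ⟨Module.End.mem_eigenspace_iff.2 ?_, h⟩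
  have h2 := LinearMap.congr_fun (congrArg ρ (hT.xp i n)) v
  simp only [map_mul, map_smul, Module.End.mul_apply, LinearMap.smul_apply] at h2
  rw [h2, hv, map_smul, smul_smul]
end stepB
end QAS
end

section
set_option linter.unusedSectionVars false
set_option linter.unusedSimpArgs false
namespace QAS

section stepC
variable {q : ℂ} {M N : ℕ} {ext : Bool}

lemma map_expC {A B : Type} [Ring A] [Algebra ℂ A] [Ring B] [Algebra ℂ B] (f : A →ₐ[ℂ] B) (t : ℂ)
    (a : ℕ → A) (n : ℕ) : f (expC t a n) = expC t (fun s => f (a s)) n := by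
  induction n using Nat.strong_induction_on with
  | _ n ih =>
    rcases n with _ | n
    · simp [expC]
    · rw [expC, expC]
      simp only [map_smul, map_sum, map_mul]
      congr 2
      refine Finset.sum_congr rfl fun s _ => ?_
      rw [ih (n - s) (by omega)]

lemma XpA_eq (i : Idx M N) (n : ℤ) : XpA q M N ext 3 i.1 n = gx q M N ext (Gen.Xp i n) := by
  simp [XpA, XpF, gx, i.2]
lemma XmA_eq (i : Idx M N) (n : ℤ) : XmA q M N ext 3 i.1 n = gx q M N ext (Gen.Xm i n) := by
  simp [XmA, XmF, gx, i.2]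
lemma KA_eq (i : Idx M N) : KA q M N ext 3 i.1 = gx q M N ext (Gen.K i) := by
  simp [KA, KF, gx, i.2]
lemma KiA_eq (i : Idx M N) : KiA q M N ext 3 i.1 = gx q M N ext (Gen.Ki i) := by
  simp [KiA, KiF, gx, i.2]
lemma HA_eq (i : Idx M N) (s : {s : ℤ // s ≠ 0}) :
    HA q M N ext 3 i.1 s.1 = gx q M N ext (Gen.H i s) := by
  simp [HA, HF, gx, i.2, s.2]

lemma phiPA_nonneg (i : Idx M N) (n : ℕ) : phiPA q M N ext 3 i.1 n = gx q M N ext (Gen.K i) *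
    expC (qpar q M i.1 - (qpar q M i.1)⁻¹) (fun s => HA q M N ext 3 i.1 s) n := by
  simp only [phiPA, phiPF, Nat.cast_nonneg, if_true, map_mul, map_expC, Int.toNat_natCast]
  rw [← KA_eq]; rfl
lemma phiPA_neg (i : ℕ) (n : ℤ) (hn : n < 0) : phiPA q M N ext 3 i n = 0 := by
  simp [phiPA, phiPF, not_le.2 hn]
lemma phiMA_nonpos (i : Idx M N) (n : ℕ) : phiMA q M N ext 3 i.1 (-(n : ℤ)) =
    gx q M N ext (Gen.Ki i) *
    expC (-(qpar q M i.1 - (qpar q M i.1)⁻¹)) (fun s => HA q M N ext 3 i.1 (-(s : ℤ))) n := by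
  have : -(n : ℤ) ≤ 0 := by omega
  simp only [phiMA, phiMF, this, if_true, map_mul, map_expC, neg_neg, Int.toNat_natCast]
  rw [← KiA_eq]; rfl
lemma phiMA_pos (i : ℕ) (n : ℤ) (hn : 0 < n) : phiMA q M N ext 3 i n = 0 := by
  simp [phiMA, phiMF, not_le.2 hn]
lemma phiPA_zero (i : Idx M N) : phiPA q M N ext 3 i.1 0 = gx q M N ext (Gen.K i) := by
  have := phiPA_nonneg (q := q) (ext := ext) i 0
  simpa [expC] using this
lemma phiMA_zero (i : Idx M N) : phiMA q M N ext 3 i.1 0 = gx q M N ext (Gen.Ki i) := by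
  have := phiMA_nonpos (q := q) (ext := ext) i 0
  simpa [expC] using this

lemma gXpXm (i j : Idx M N) (m n : ℤ) :
    gx q M N ext (Gen.Xp i m) * gx q M N ext (Gen.Xm j n) -
      sgn M i.1 j.1 • (gx q M N ext (Gen.Xm j n) * gx q M N ext (Gen.Xp i m)) =
    if i = j then (qpar q M i.1 - (qpar q M i.1)⁻¹)⁻¹ •
      (phiPA q M N ext 3 i.1 (m + n) - phiMA q M N ext 3 i.1 (m + n)) else 0 := by
  have := mkA_rel (rel.XpXm (q := q) (ext := ext) (lvl := 3) i j m n)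
  rw [apply_ite (mkA q M N ext 3)] at this
  simpa [gx, phiPA, phiMA] using this

lemma gHXm (i j : Idx M N) (s : {s : ℤ // s ≠ 0}) (n : ℤ) :
    gx q M N ext (Gen.H i s) * gx q M N ext (Gen.Xm j n) -
      gx q M N ext (Gen.Xm j n) * gx q M N ext (Gen.H i s) =
    -((qint (qpar q M i.1) (s.1 * lof M i.1 * cc M i.1 j.1) / (s.1 : ℂ)) •
      gx q M N ext (Gen.Xm j (n + s.1))) := by
  simpa [gx] using mkA_rel (rel.HXm (q := q) (ext := ext) (lvl := 3) i j s n)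

lemma gXXm (i j : Idx M N) (m n : ℤ) (h : cc M i.1 j.1 ≠ 0) :
    gx q M N ext (Gen.Xm i (m + 1)) * gx q M N ext (Gen.Xm j n) -
      (q ^ (-cc M i.1 j.1)) • (gx q M N ext (Gen.Xm j n) * gx q M N ext (Gen.Xm i (m + 1))) =
    (q ^ (-cc M i.1 j.1)) • (gx q M N ext (Gen.Xm i m) * gx q M N ext (Gen.Xm j (n + 1))) -
      gx q M N ext (Gen.Xm j (n + 1)) * gx q M N ext (Gen.Xm i m) := by
  simpa [gx] using mkA_rel (rel.XXm (q := q) (ext := ext) (lvl := 3) i j m n (by norm_num) h)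

lemma cc_self (i : ℕ) (hi : i ≠ M) : cc M i i = 2 * lof M i := by
  simp only [cc, form4, innerE, lof]
  split_ifs <;> omega

lemma lof_cases (i : ℕ) : lof M i = 1 ∨ lof M i = -1 := by
  unfold lof; split_ifs <;> simp

lemma qpar_ne (hq0 : q ≠ 0) (i : ℕ) : qpar q M i ≠ 0 := zpow_ne_zero _ hq0

lemma qpar_not_root (hq1 : ∀ k : ℕ, k ≠ 0 → q ^ k ≠ 1) (i : ℕ) (k : ℕ) (hk : k ≠ 0) :
    qpar q M i ^ k ≠ 1 := by
  unfold qpar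
  rcases lof_cases (M := M) i with h | h <;> rw [h]
  · simpa using hq1 k hk
  · simpa using hq1 k hk

lemma qpar_M : qpar q M M = q := by simp [qpar, lof]

lemma qpar_sub_ne (hq0 : q ≠ 0) (hq1 : ∀ k : ℕ, k ≠ 0 → q ^ k ≠ 1) (i : ℕ) :
    qpar q M i - (qpar q M i)⁻¹ ≠ 0 := by
  have := qinv_sub_ne (qpar q M i) (qpar_ne hq0 i) (qpar_not_root hq1 i) 0
  intro h; apply this; simp only [zero_add, pow_one]; linear_combination -h

lemma q_cc_self (i : ℕ) (hi : i ≠ M) : q ^ (-cc M i i) = ((qpar q M i) ^ 2)⁻¹ := by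
  rw [cc_self i hi, qpar, zpow_neg, mul_comm, zpow_mul]; norm_cast

variable {V : Type} [AddCommGroup V] [Module ℂ V]

lemma expC_eigen (t : ℂ) (a : ℕ → Module.End ℂ V) (v : V)
    (h : ∀ s, ∃ c : ℂ, a (s + 1) v = c • v) (n : ℕ) : ∃ c : ℂ, expC t a n v = c • v := by
  induction n using Nat.strong_induction_on with
  | _ n ih =>
    rcases n with _ | n
    · exact ⟨1, by simp [expC]⟩
    · choose c hc using h
      have ih' : ∀ s, ∃ c : ℂ, expC t a (n - s) v = c • v := fun s => ih _ (by omega)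
      choose e he using ih'
      refine ⟨((n : ℂ) + 1)⁻¹ * (t * ∑ s ∈ Finset.range (n + 1), ((s : ℂ) + 1) * (e s * c s)), ?_⟩
      rw [expC]
      simp only [LinearMap.smul_apply, LinearMap.sum_apply, Module.End.mul_apply, he, map_smul, hc,
        smul_smul, ← Finset.sum_smul, mul_assoc]

lemma exists_hwdata [FiniteDimensional ℂ V] (hq0 : q ≠ 0)
    (hq1 : ∀ k : ℕ, k ≠ 0 → q ^ k ≠ 1) (hM : 1 ≤ M) (hN : 1 ≤ N)
    (ρ : ALG q M N ext 3 →ₐ[ℂ] Module.End ℂ V) (v : V) (hv : v ≠ 0)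
    (hx : ∀ i n, ρ (gx q M N ext (Gen.Xp i n)) v = 0)
    (hc : ∀ a : CI M N, ∃ c : ℂ, ρ (gx q M N ext a.gen) v = c • v) :
    ∃ (Λ : HW q M N) (ε : ℕ → ℂ), (∀ i, ε i = 1 ∨ ε i = -1) ∧ ε M = 1 ∧
      (∀ (i : Idx M N), i.1 ≠ M → ∀ n,
        ρ (phiPA q M N ext 3 i.1 n) v = (ε i.1 * gammaP q M i.1 (Λ.P i.1) n) • v ∧
        ρ (phiMA q M N ext 3 i.1 n) v = (ε i.1 * gammaM q M i.1 (Λ.P i.1) n) • v) ∧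
      ρ (KA q M N ext 3 M) v = Λ.c • v ∧
      (∀ n, ρ (phiPA q M N ext 3 M n) v - ρ (phiMA q M N ext 3 M n) v =
        ((q - q⁻¹) * Λ.f n) • v) := by
  have hH : ∀ (i : Idx M N) (s : ℤ), ∃ c : ℂ, ρ (HA q M N ext 3 i.1 s) v = c • v := by
    intro i s
    by_cases hs : s = 0
    · subst hs; exact ⟨0, by simp [HA, HF]⟩
    · obtain ⟨c, h⟩ := hc (CI.H i ⟨s, hs⟩)
      exact ⟨c, by rw [HA_eq i ⟨s, hs⟩]; exact h⟩
  have hP : ∀ (i : Idx M N) (n : ℤ), ∃ c : ℂ, ρ (phiPA q M N ext 3 i.1 n) v = c • v := by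
    intro i n
    rcases lt_or_ge n 0 with hn | hn
    · exact ⟨0, by simp [phiPA_neg _ n hn]⟩
    · obtain ⟨n, rfl⟩ := Int.eq_ofNat_of_zero_le hn
      obtain ⟨c, h⟩ := hc (CI.K i)
      obtain ⟨e, h'⟩ := expC_eigen (qpar q M i.1 - (qpar q M i.1)⁻¹)
        (fun s => ρ (HA q M N ext 3 i.1 s)) v (fun s => hH i _) n
      refine ⟨e * c, ?_⟩
      rw [phiPA_nonneg, map_mul, map_expC, Module.End.mul_apply, h', map_smul, mul_smul]
      exact congrArg _ h
  have hMi : ∀ (i : Idx M N) (n : ℤ), ∃ c : ℂ, ρ (phiMA q M N ext 3 i.1 n) v = c • v := by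
    intro i n
    rcases lt_or_ge 0 n with hn | hn
    · exact ⟨0, by simp [phiMA_pos _ n hn]⟩
    · obtain ⟨n, rfl⟩ : ∃ m : ℕ, n = -(m : ℤ) := ⟨(-n).toNat, by omega⟩
      obtain ⟨c, h⟩ := hc (CI.Ki i)
      obtain ⟨e, h'⟩ := expC_eigen (-(qpar q M i.1 - (qpar q M i.1)⁻¹))
        (fun s => ρ (HA q M N ext 3 i.1 (-(s : ℤ)))) v (fun s => hH i _) n
      refine ⟨e * c, ?_⟩
      rw [phiMA_nonpos, map_mul, map_expC, Module.End.mul_apply, h', map_smul, mul_smul]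
      exact congrArg _ h
  choose γp hγp using hP
  choose γm hγm using hMi
  have inj : ∀ a b : ℂ, a • v = b • v → a = b := fun a b hab => by
    have := sub_smul a b v
    rw [hab, sub_self] at this
    exact sub_eq_zero.1 ((smul_eq_zero.1 this).resolve_right hv)
  -- even nodes
  have heven : ∀ i : Idx M N, i.1 ≠ M → ∃ (P : Polynomial ℂ) (ε : ℂ), P.coeff 0 = 1 ∧
      (ε = 1 ∨ ε = -1) ∧ (∀ n, γp i n = ε * gammaP q M i.1 P n) ∧
      (∀ n, γm i n = ε * gammaM q M i.1 P n) := by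
    intro i hi
    have hcc : cc M i.1 i.1 ≠ 0 := by
      rw [cc_self _ hi]; rcases lof_cases (M := M) i.1 with h | h <;> rw [h] <;> norm_num
    refine sl2_main (qpar q M i.1) (qpar_ne hq0 _) (qpar_not_root hq1 _)
      (fun n => ρ (gx q M N ext (Gen.Xp i n))) (fun n => ρ (gx q M N ext (Gen.Xm i n)))
      (ρ (gx q M N ext (Gen.K i))) (ρ (gx q M N ext (Gen.Ki i)))
      (fun s => ρ (HA q M N ext 3 i.1 s))
      (fun n => ρ (phiPA q M N ext 3 i.1 n)) (fun n => ρ (phiMA q M N ext 3 i.1 n))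
      ?_ ?_ ?_ ?_ ?_ ?_ ?_ ?_ ?_ v hv (hx i) (γp i) (γm i) (hγp i) (hγm i)
    · intro n; rw [phiPA_nonneg, map_mul, map_expC]
    · intro n hn; simp [phiPA_neg _ n hn]
    · simp [phiMA_zero]
    · intro n hn; simp [phiMA_pos _ n hn]
    · rw [← map_mul, gKiK, map_one]
    · intro n
      rw [← q_cc_self _ hi, ← map_mul, gKXm, map_smul, map_mul]
    · intro s n
      have hs : ((s : ℤ) + 1) ≠ 0 := by omega
      have h1 := congrArg ρ (gHXm (q := q) (ext := ext) i i ⟨(s : ℤ) + 1, hs⟩ n)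
      rw [← HA_eq] at h1
      simp only [map_sub, map_mul, map_neg, map_smul] at h1
      push_cast
      rw [h1, smul_neg, smul_smul]
      congr 2
      have h2 : ((s : ℤ) + 1) * lof M i.1 * cc M i.1 i.1 = 2 * ((s + 1 : ℕ) : ℤ) := by
        rw [cc_self _ hi]; push_cast; linear_combination (2 * ((s : ℤ) + 1)) * lof_sq M i.1
      rw [h2, qint, zpow_neg, zpow_mul]
      have h3 : ((s : ℂ) + 1) ≠ 0 := by exact_mod_cast hs
      have h4 := qpar_sub_ne (M := M) hq0 hq1 i.1
      rw [zpow_natCast]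
      have h5 : qpar q M i.1 ^ (2 : ℤ) = qpar q M i.1 ^ 2 := by norm_cast
      rw [h5, inv_pow]
      push_cast
      generalize qpar q M i.1 - (qpar q M i.1)⁻¹ = A at h4 ⊢
      generalize ((qpar q M i.1 ^ 2) ^ (s + 1) - ((qpar q M i.1 ^ 2) ^ (s + 1))⁻¹) = B
      field_simp
    · intro m n
      have h1 := congrArg ρ (gXpXm (q := q) (ext := ext) i i m n)
      simpa [sgn, hi] using h1
    · intro m n
      have h1 := congrArg ρ (gXXm (q := q) (ext := ext) i i m n hcc)
      rw [q_cc_self _ hi] at h1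
      simpa using h1
  choose P₀ ε₀ hP₀ hε₀ hgP hgM using heven
  let iM : Idx M N := ⟨M, hM, by omega⟩
  let P : ℕ → Polynomial ℂ := fun i => if h : (1 ≤ i ∧ i ≤ M + N - 1) ∧ i ≠ M then P₀ ⟨i, h.1⟩ h.2 else 1
  let ε : ℕ → ℂ := fun i => if h : (1 ≤ i ∧ i ≤ M + N - 1) ∧ i ≠ M then ε₀ ⟨i, h.1⟩ h.2 else 1
  let f : ℤ → ℂ := fun n => (γp iM n - γm iM n) / (q - q⁻¹)
  have hqq : q - q⁻¹ ≠ 0 := by simpa [qpar_M] using qpar_sub_ne (M := M) hq0 hq1 M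
  have hγ1 : γm iM 0 * γp iM 0 = 1 := by
    apply inj
    have h1 := LinearMap.congr_fun (congrArg ρ (gKiK (q := q) (ext := ext) iM)) v
    rw [← phiMA_zero, ← phiPA_zero, map_mul, Module.End.mul_apply, hγp, map_smul, hγm, smul_smul,
      mul_comm] at h1
    simpa using h1
  have hc0 : γp iM 0 ≠ 0 := right_ne_zero_of_mul_eq_one hγ1
  have htor : ∃ Q : Polynomial ℂ, Q ≠ 0 ∧ annih Q f := by
    obtain ⟨Q, hQ, h⟩ := exists_rel fun s : ℕ => ρ (gx q M N ext (Gen.Xm iM (-(s : ℤ)))) v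
    refine ⟨Q, hQ, fun n => ?_⟩
    apply inj
    have h1 := congrArg (ρ (gx q M N ext (Gen.Xp iM n))) h
    rw [map_sum, map_zero] at h1
    rw [zero_smul, ← h1, Finset.sum_smul]
    refine Finset.sum_congr rfl fun s _ => ?_
    have h2 := LinearMap.congr_fun (congrArg ρ (gXpXm (q := q) (ext := ext) iM iM n (-(s : ℤ)))) v
    simp only [map_sub, map_mul, map_smul, LinearMap.sub_apply, LinearMap.smul_apply,
      Module.End.mul_apply, hx, map_zero, smul_zero, sub_zero, if_true, hγp, hγm, ← sub_smul] at h2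
    rw [map_smul, h2, mul_smul, smul_smul (_⁻¹)]
    congr 2
    simp only [f, iM, qpar_M, ← sub_eq_add_neg]
    rw [div_eq_inv_mul]
  refine ⟨⟨P, f, γp iM 0, ?_, hc0, htor, ?_⟩, ε, ?_, ?_, ?_, ?_, ?_⟩
  · intro i
    by_cases h : (1 ≤ i ∧ i ≤ M + N - 1) ∧ i ≠ M
    · simp only [P, dif_pos h, hP₀]
    · simp only [P, dif_neg h, Polynomial.coeff_one_zero]
  · simp only [f]
    rw [eq_inv_of_mul_eq_one_left hγ1]
  · intro i
    by_cases h : (1 ≤ i ∧ i ≤ M + N - 1) ∧ i ≠ M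
    · simp only [ε, dif_pos h, hε₀]
    · simp only [ε, dif_neg h, true_or]
  · simp [ε]
  · intro i hi n
    have h : (1 ≤ i.1 ∧ i.1 ≤ M + N - 1) ∧ i.1 ≠ M := ⟨i.2, hi⟩
    simp only [ε, P, dif_pos h]
    exact ⟨by rw [hγp, hgP i hi], by rw [hγm, hgM i hi]⟩
  · change ρ (KA q M N ext 3 iM.1) v = _
    rw [KA_eq, ← phiPA_zero, hγp]
  · intro n
    change ρ (phiPA q M N ext 3 iM.1 n) v - ρ (phiMA q M N ext 3 iM.1 n) v = _
    rw [hγp, hγm, ← sub_smul]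
    congr 1
    simp only [f]
    rw [mul_div_cancel₀ _ hqq]
end stepC
end QAS
end

section
set_option linter.unusedSectionVars false
set_option linter.unusedSimpArgs false
namespace QAS

section stepD
variable {q : ℂ} {M N : ℕ} {ext : Bool}
variable {V : Type} [AddCommGroup V] [Module ℂ V]

lemma CS_eigen (ρ : ALG q M N ext 3 →ₐ[ℂ] Module.End ℂ V) (v : V)
    (hc : ∀ i, ∃ c : ℂ, ρ (gx q M N ext (Gen.K i)) v = c • v)
    (hci : ∀ i, ∃ c : ℂ, ρ (gx q M N ext (Gen.Ki i)) v = c • v) (T : ALG q M N ext 3)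
    (hT : T ∈ CS q M N ext) : ∃ c : ℂ, ρ T v = c • v := by
  induction hT using Algebra.adjoin_induction with
  | mem x hx => obtain ⟨i, rfl | rfl⟩ := hx; exacts [hc i, hci i]
  | algebraMap r => exact ⟨r, by simp [Algebra.algebraMap_eq_smul_one]⟩
  | add x y _ _ hx hy =>
    obtain ⟨a, ha⟩ := hx; obtain ⟨b, hb⟩ := hy
    exact ⟨a + b, by simp [ha, hb, add_smul]⟩
  | mul x y _ _ hx hy =>
    obtain ⟨a, ha⟩ := hx; obtain ⟨b, hb⟩ := hy
    exact ⟨b * a, by simp [ha, hb, mul_smul]⟩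

lemma exists_calc [FiniteDimensional ℂ V] (T : Module.End ℂ V) (r : ℂ → ℂ) :
    ∃ S : Module.End ℂ V, ∀ μ, ∀ x ∈ Module.End.eigenspace T μ, S x = r μ • x := by
  have hfin := Module.End.finite_hasEigenvalue T
  let F : Finset ℂ := hfin.toFinset
  let p : Polynomial ℂ := Lagrange.interpolate F id r
  refine ⟨Polynomial.aeval T p, fun μ x hx => ?_⟩
  by_cases h0 : x = 0
  · simp [h0]
  have hev : T.HasEigenvector μ x := ⟨hx, h0⟩
  rw [Module.End.aeval_apply_of_hasEigenvector hev]
  congr 1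
  refine Lagrange.eval_interpolate_at_node r (v := id) (fun a _ b _ h => h) ?_
  exact hfin.mem_toFinset.2 (Module.End.hasEigenvalue_of_hasEigenvector hev)

lemma exists_K0 [FiniteDimensional ℂ V] (hq0 : q ≠ 0)
    (hq1 : ∀ k : ℕ, k ≠ 0 → q ^ k ≠ 1) (hM : 1 ≤ M) (hN : 1 ≤ N) (hMN : M ≠ N)
    (ρ : ALG q M N false 3 →ₐ[ℂ] Module.End ℂ V)
    (hsimple : ∀ W : Submodule ℂ V, (∀ g, ∀ w ∈ W, ρ (gx q M N false g) w ∈ W) → W ≠ ⊥ → W = ⊤)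
    (v : V) (hv : v ≠ 0)
    (hc : ∀ a : CI M N, ∃ c : ℂ, ρ (gx q M N false a.gen) v = c • v) :
    ∃ K0 K0i : Module.End ℂ V, K0 * K0i = 1 ∧ K0i * K0 = 1 ∧
      (∀ a : CI M N, K0 * ρ (gx q M N false a.gen) = ρ (gx q M N false a.gen) * K0) ∧
      (∀ j n, K0 * ρ (gx q M N false (Gen.Xp j n)) =
        (q ^ (if j.1 = 1 then (1 : ℤ) else 0)) • (ρ (gx q M N false (Gen.Xp j n)) * K0)) ∧
      (∀ j n, K0 * ρ (gx q M N false (Gen.Xm j n)) =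
        (q ^ (if j.1 = 1 then (-1 : ℤ) else 0)) • (ρ (gx q M N false (Gen.Xm j n)) * K0)) ∧
      K0 v = v := by
  obtain ⟨T, Ti, hT⟩ := exists_k0wt (q := q) (M := M) (N := N) (ext := false) hq0 hM hN
  set e : ℤ := (M : ℤ) - N with he
  have he0 : e ≠ 0 := by omega
  obtain ⟨τ, hτ⟩ := CS_eigen ρ v (fun i => hc (CI.K i)) (fun i => hc (CI.Ki i)) T hT.memT
  have hτ0 : τ ≠ 0 := by
    rintro rfl
    apply hv
    have := LinearMap.congr_fun (congrArg ρ hT.inv2) v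
    simpa [hτ] using this.symm
  let E : ℤ → Submodule ℂ V := fun n => Module.End.eigenspace (ρ T) (τ * q ^ (e * n))
  have hE : ∀ n x, x ∈ E n ↔ ρ T x = (τ * q ^ (e * n)) • x := fun n x =>
    Module.End.mem_eigenspace_iff
  have hcart : ∀ (a : CI M N) n x, x ∈ E n → ρ (gx q M N false a.gen) x ∈ E n := by
    intro a n x hx
    rw [hE] at hx ⊢
    have h2 := LinearMap.congr_fun ((hT.cart a).map ρ).eq x
    simp only [Module.End.mul_apply] at h2
    rw [h2, hx, map_smul]
  have hxp : ∀ (j : Idx M N) k n x, x ∈ E n →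
      ρ (gx q M N false (Gen.Xp j k)) x ∈ E (n + if j.1 = 1 then (1 : ℤ) else 0) := by
    intro j k n x hx
    rw [hE] at hx ⊢
    have h2 := LinearMap.congr_fun (congrArg ρ (hT.xp j k)) x
    simp only [map_mul, map_smul, Module.End.mul_apply, LinearMap.smul_apply] at h2
    rw [h2, hx, map_smul, smul_smul, mul_add, zpow_add₀ hq0]
    congr 1
    split_ifs <;> simp <;> ring
  have hxm : ∀ (j : Idx M N) k n x, x ∈ E n →
      ρ (gx q M N false (Gen.Xm j k)) x ∈ E (n + if j.1 = 1 then (-1 : ℤ) else 0) := by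
    intro j k n x hx
    rw [hE] at hx ⊢
    have h2 := LinearMap.congr_fun (congrArg ρ (hT.xm j k)) x
    simp only [map_mul, map_smul, Module.End.mul_apply, LinearMap.smul_apply] at h2
    rw [h2, hx, map_smul, smul_smul, mul_add, zpow_add₀ hq0]
    congr 1
    split_ifs <;> simp <;> ring
  have hv0 : v ∈ E 0 := by rw [hE]; simpa using hτ
  have htop : (⨆ n, E n) = ⊤ := by
    apply hsimple
    · intro g w hw
      induction hw using Submodule.iSup_induction' with
      | mem n x hx =>
        rcases g with ⟨j, k⟩ | ⟨j, k⟩ | i | i | ⟨i, s⟩ | h | h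
        · exact Submodule.mem_iSup_of_mem _ (hxp j k n x hx)
        · exact Submodule.mem_iSup_of_mem _ (hxm j k n x hx)
        · exact Submodule.mem_iSup_of_mem _ (hcart (CI.K i) n x hx)
        · exact Submodule.mem_iSup_of_mem _ (hcart (CI.Ki i) n x hx)
        · exact Submodule.mem_iSup_of_mem _ (hcart (CI.H i s) n x hx)
        · exact absurd h (by simp)
        · exact absurd h (by simp)
      | zero => rw [map_zero]; exact Submodule.zero_mem _
      | add x y _ _ hx hy => rw [map_add]; exact Submodule.add_mem _ hx hy
    · intro h
      have : v ∈ (⨆ n, E n) := Submodule.mem_iSup_of_mem 0 hv0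
      rw [h] at this
      exact hv ((Submodule.mem_bot ℂ).1 this)
  have hext : ∀ A B : Module.End ℂ V, (∀ n, ∀ x ∈ E n, A x = B x) → A = B := by
    intro A B h
    have h1 : (⨆ n, E n) ≤ LinearMap.eqLocus A B := iSup_le fun n x hx => h n x hx
    rw [htop] at h1
    exact LinearMap.ext fun x => h1 (Submodule.mem_top : x ∈ ⊤)
  have hinj : ∀ m n : ℤ, τ * q ^ (e * m) = τ * q ^ (e * n) → m = n := by
    intro m n h
    exact mul_left_cancel₀ he0 (pow_inj_of q hq0 hq1 (mul_left_cancel₀ hτ0 h))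
  have hK : ∀ σ : ℤ, ∃ S : Module.End ℂ V, ∀ n, ∀ x ∈ E n, S x = q ^ (σ * n) • x := by
    intro σ
    classical
    obtain ⟨S, hS⟩ := exists_calc (ρ T) (fun μ => if h : ∃ n : ℤ, μ = τ * q ^ (e * n) then
      q ^ (σ * h.choose) else 0)
    refine ⟨S, fun n x hx => ?_⟩
    rw [hS _ x hx]
    have h : ∃ m : ℤ, τ * q ^ (e * n) = τ * q ^ (e * m) := ⟨n, rfl⟩
    rw [dif_pos h, ← hinj _ _ h.choose_spec]
  obtain ⟨K0, hK0⟩ := hK 1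
  obtain ⟨K0i, hK0i⟩ := hK (-1)
  refine ⟨K0, K0i, hext _ _ fun n x hx => ?_, hext _ _ fun n x hx => ?_, fun a => hext _ _ fun n x hx => ?_,
    fun j k => hext _ _ fun n x hx => ?_, fun j k => hext _ _ fun n x hx => ?_, ?_⟩
  · rw [Module.End.mul_apply, hK0i n x hx, map_smul, hK0 n x hx, smul_smul, ← zpow_add₀ hq0]
    simp
  · rw [Module.End.mul_apply, hK0 n x hx, map_smul, hK0i n x hx, smul_smul, ← zpow_add₀ hq0]
    simp
  · rw [Module.End.mul_apply, hK0 n _ (hcart a n x hx), Module.End.mul_apply, hK0 n x hx, map_smul]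
  · rw [Module.End.mul_apply, hK0 _ _ (hxp j k n x hx), LinearMap.smul_apply, Module.End.mul_apply,
      hK0 n x hx, map_smul, smul_smul, ← zpow_add₀ hq0]
    congr 2; ring
  · rw [Module.End.mul_apply, hK0 _ _ (hxm j k n x hx), LinearMap.smul_apply, Module.End.mul_apply,
      hK0 n x hx, map_smul, smul_smul, ← zpow_add₀ hq0]
    congr 2; ring
  · rw [hK0 0 v hv0]; simp
end stepD
end QAS
end

section
set_option linter.unusedSectionVars false
set_option linter.unusedSimpArgs false
namespace QAS

section stepD2
variable {q : ℂ} {M N : ℕ}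
variable {V : Type} [AddCommGroup V] [Module ℂ V]

/-- the twisted images of the generators. -/
def genMap (ρ : ALG q M N false 3 →ₐ[ℂ] Module.End ℂ V) (ε : ℕ → ℂ) (K0 K0i : Module.End ℂ V) :
    Gen M N true → Module.End ℂ V
  | .Xp i n => ε i.1 • ρ (gx q M N false (Gen.Xp i n))
  | .Xm i n => ρ (gx q M N false (Gen.Xm i n))
  | .K i => ε i.1 • ρ (gx q M N false (Gen.K i))
  | .Ki i => ε i.1 • ρ (gx q M N false (Gen.Ki i))
  | .H i s => ρ (gx q M N false (Gen.H i s))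
  | .K0 _ => K0
  | .K0i _ => K0i

/-- the twisted map on the free algebra. -/
def rhoF (ρ : ALG q M N false 3 →ₐ[ℂ] Module.End ℂ V) (ε : ℕ → ℂ) (K0 K0i : Module.End ℂ V) :
    FA M N true →ₐ[ℂ] Module.End ℂ V := FreeAlgebra.lift ℂ (genMap ρ ε K0 K0i)

lemma brF_smul {A : Type} [Ring A] [Algebra ℂ A] (u a b : ℂ) (x y : A) :
    brF u (a • x) (b • y) = (a * b) • brF u x y := by
  simp only [brF, smul_mul_smul_comm, smul_sub, smul_smul]
  congr 2; ring

lemma oscOf_smul {A : Type} [Ring A] [Algebra ℂ A] (q : ℂ) (M : ℕ) (ε : ℕ → ℂ) (X : ℕ → ℤ → A)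
    (m n k u : ℤ) : oscOf q M (fun i n => ε i • X i n) m n k u =
      (ε (M - 1) * ε M * ε (M + 1) * ε M) • oscOf q M X m n k u := by
  simp only [oscOf, brF_smul, smul_mul_smul_comm, smul_add]
  congr 2; ring

lemma map_brF {A B : Type} [Ring A] [Algebra ℂ A] [Ring B] [Algebra ℂ B] (f : A →ₐ[ℂ] B) (u : ℂ)
    (x y : A) : f (brF u x y) = brF u (f x) (f y) := by simp [brF]

lemma map_oscOf {A B : Type} [Ring A] [Algebra ℂ A] [Ring B] [Algebra ℂ B] (f : A →ₐ[ℂ] B)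
    (q : ℂ) (M : ℕ) (X : ℕ → ℤ → A)
    (m n k u : ℤ) : f (oscOf q M X m n k u) = oscOf q M (fun i n => f (X i n)) m n k u := by
  simp [oscOf, map_brF]

variable (ρ : ALG q M N false 3 →ₐ[ℂ] Module.End ℂ V) (ε : ℕ → ℂ) (K0 K0i : Module.End ℂ V)

lemma rhoF_gi (g : Gen M N true) : rhoF ρ ε K0 K0i (gi g) = genMap ρ ε K0 K0i g := by
  simp [rhoF, gi]

lemma rhoF_Xp (i : ℕ) (n : ℤ) : rhoF ρ ε K0 K0i (XpF M N true i n) =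
    ε i • ρ (XpA q M N false 3 i n) := by
  unfold XpF XpA XpF
  split_ifs with h
  · rw [rhoF_gi]; rfl
  · simp
lemma rhoF_Xm (i : ℕ) (n : ℤ) : rhoF ρ ε K0 K0i (XmF M N true i n) =
    ρ (XmA q M N false 3 i n) := by
  unfold XmF XmA XmF
  split_ifs with h
  · rw [rhoF_gi]; rfl
  · simp
lemma rhoF_K (i : ℕ) : rhoF ρ ε K0 K0i (KF M N true i) = ε i • ρ (KA q M N false 3 i) := by
  unfold KF KA KF
  split_ifs with h
  · rw [rhoF_gi]; rfl
  · simp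
lemma rhoF_Ki (i : ℕ) : rhoF ρ ε K0 K0i (KiF M N true i) = ε i • ρ (KiA q M N false 3 i) := by
  unfold KiF KiA KiF
  split_ifs with h
  · rw [rhoF_gi]; rfl
  · simp
lemma rhoF_H (i : ℕ) (s : ℤ) : rhoF ρ ε K0 K0i (HF M N true i s) = ρ (HA q M N false 3 i s) := by
  unfold HF HA HF
  split_ifs with h
  · rw [rhoF_gi]; rfl
  · simp
lemma rhoF_phiP (i : ℕ) (n : ℤ) : rhoF ρ ε K0 K0i (phiPF q M N true i n) =
    ε i • ρ (phiPA q M N false 3 i n) := by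
  unfold phiPF phiPA phiPF
  split_ifs with h
  · simp only [map_mul, map_expC, rhoF_K, rhoF_H, smul_mul_assoc]; rfl
  · simp
lemma rhoF_phiM (i : ℕ) (n : ℤ) : rhoF ρ ε K0 K0i (phiMF q M N true i n) =
    ε i • ρ (phiMA q M N false 3 i n) := by
  unfold phiMF phiMA phiMF
  split_ifs with h
  · simp only [map_mul, map_expC, rhoF_Ki, rhoF_H, smul_mul_assoc]; rfl
  · simp

lemma rhoF_rel (hε : ∀ i, ε i * ε i = 1)
    (hK1 : K0 * K0i = 1) (hK2 : K0i * K0 = 1)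
    (hKc : ∀ a : CI M N, K0 * ρ (gx q M N false a.gen) = ρ (gx q M N false a.gen) * K0)
    (hKp : ∀ j n, K0 * ρ (gx q M N false (Gen.Xp j n)) =
        (q ^ (if j.1 = 1 then (1 : ℤ) else 0)) • (ρ (gx q M N false (Gen.Xp j n)) * K0))
    (hKm : ∀ j n, K0 * ρ (gx q M N false (Gen.Xm j n)) =
        (q ^ (if j.1 = 1 then (-1 : ℤ) else 0)) • (ρ (gx q M N false (Gen.Xm j n)) * K0))
    (a b : FA M N true) (h : rel q M N true 3 a b) :
    rhoF ρ ε K0 K0i a = rhoF ρ ε K0 K0i b := by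
  have hr : ∀ {a b : FA M N false}, rel q M N false 3 a b →
      ρ (mkA q M N false 3 a) = ρ (mkA q M N false 3 b) := fun h => congrArg ρ (mkA_rel h)
  induction h with
  | KKi i =>
    have := hr (rel.KKi i)
    simp only [map_mul, map_one] at this
    simp only [map_mul, map_one, rhoF_gi, genMap, smul_mul_smul_comm, hε, one_smul]
    exact this
  | KiK i =>
    have := hr (rel.KiK i)
    simp only [map_mul, map_one] at this
    simp only [map_mul, map_one, rhoF_gi, genMap, smul_mul_smul_comm, hε, one_smul]
    exact this
  | KK i j =>
    have := hr (rel.KK i j)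
    simp only [map_mul] at this
    simp only [map_mul, rhoF_gi, genMap, smul_mul_smul_comm, mul_comm (ε j.1)]
    exact congrArg _ this
  | KKi2 i j =>
    have := hr (rel.KKi2 i j)
    simp only [map_mul] at this
    simp only [map_mul, rhoF_gi, genMap, smul_mul_smul_comm, mul_comm (ε j.1)]
    exact congrArg _ this
  | KiKi i j =>
    have := hr (rel.KiKi i j)
    simp only [map_mul] at this
    simp only [map_mul, rhoF_gi, genMap, smul_mul_smul_comm, mul_comm (ε j.1)]
    exact congrArg _ this
  | KH i j s =>
    have := hr (rel.KH i j s)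
    simp only [map_mul] at this
    simp only [map_mul, rhoF_gi, genMap, smul_mul_assoc, mul_smul_comm]
    exact congrArg _ this
  | KiH i j s =>
    have := hr (rel.KiH i j s)
    simp only [map_mul] at this
    simp only [map_mul, rhoF_gi, genMap, smul_mul_assoc, mul_smul_comm]
    exact congrArg _ this
  | HH i j s t =>
    have := hr (rel.HH i j s t)
    simp only [map_mul] at this
    simp only [map_mul, rhoF_gi, genMap]
    exact this
  | KXp i j n =>
    have := hr (rel.KXp i j n)
    simp only [map_mul, map_smul] at this
    simp only [map_mul, map_smul, rhoF_gi, genMap, smul_mul_smul_comm, mul_comm (ε j.1)]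
    rw [smul_comm]
    exact congrArg _ this
  | KXm i j n =>
    have := hr (rel.KXm i j n)
    simp only [map_mul, map_smul] at this
    simp only [map_mul, map_smul, rhoF_gi, genMap, smul_mul_assoc, mul_smul_comm]
    rw [smul_comm]
    exact congrArg _ this
  | HXp i j s n =>
    have := hr (rel.HXp i j s n)
    simp only [map_mul, map_smul, map_sub] at this
    simp only [map_mul, map_smul, map_sub, rhoF_gi, genMap, smul_mul_assoc, mul_smul_comm,
      ← smul_sub]
    rw [smul_comm _ (ε _)]
    exact congrArg _ this
  | HXm i j s n =>
    have := hr (rel.HXm i j s n)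
    simp only [map_mul, map_smul, map_sub, map_neg] at this
    simp only [map_mul, map_smul, map_sub, map_neg, rhoF_gi, genMap]
    exact this
  | XpXm i j m n =>
    have := hr (rel.XpXm i j m n)
    have e1 : rhoF ρ ε K0 K0i (if i = j then
            (qpar q M i.1 - (qpar q M i.1)⁻¹)⁻¹ •
              (phiPF q M N true i.1 (m + n) - phiMF q M N true i.1 (m + n))
          else 0) = ε i.1 • ρ (mkA q M N false 3 (if i = j then
            (qpar q M i.1 - (qpar q M i.1)⁻¹)⁻¹ •
              (phiPF q M N false i.1 (m + n) - phiMF q M N false i.1 (m + n))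
          else 0)) := by
      split_ifs with h
      · simp only [map_smul, map_sub, rhoF_phiP, rhoF_phiM, ← smul_sub]
        rw [smul_comm]; rfl
      · simp
    rw [e1, ← this]
    simp only [map_mul, map_smul, map_sub, rhoF_gi, genMap, smul_mul_assoc, mul_smul_comm, smul_sub]
    rw [smul_comm]; rfl
  | XX0p i j m n h2 h =>
    have := hr (rel.XX0p i j m n h2 h)
    simp only [map_mul, map_smul, map_sub, map_zero] at this
    simp only [map_mul, map_smul, map_sub, map_zero, rhoF_gi, genMap, smul_mul_smul_comm,
      mul_comm (ε j.1)]
    rw [smul_comm (sgn _ _ _), ← smul_sub]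
    exact (congrArg _ this).trans (smul_zero _)
  | XX0m i j m n h2 h =>
    have := hr (rel.XX0m i j m n h2 h)
    simp only [map_mul, map_smul, map_sub, map_zero] at this
    simp only [map_mul, map_smul, map_sub, map_zero, rhoF_gi, genMap]
    exact this
  | XXp i j m n h2 h =>
    have := hr (rel.XXp i j m n h2 h)
    simp only [map_mul, map_smul, map_sub] at this
    simp only [map_mul, map_smul, map_sub, rhoF_gi, genMap, smul_mul_smul_comm, mul_comm (ε j.1)]
    rw [smul_comm (q ^ _), smul_comm (q ^ _), ← smul_sub, ← smul_sub]
    exact congrArg _ this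
  | XXm i j m n h2 h =>
    have := hr (rel.XXm i j m n h2 h)
    simp only [map_mul, map_smul, map_sub] at this
    simp only [map_mul, map_smul, map_sub, rhoF_gi, genMap]
    exact this
  | serreP i j m n k h3 h hi =>
    have := hr (rel.serreP i j m n k h3 h hi)
    simp only [map_add, map_brF, map_zero] at this
    simp only [map_add, map_brF, map_zero, rhoF_gi, genMap, brF_smul]
    rw [← smul_add]
    exact (congrArg _ this).trans (smul_zero _)
  | serreM i j m n k h3 h hi =>
    have := hr (rel.serreM i j m n k h3 h hi)
    simp only [map_add, map_brF, map_zero] at this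
    simp only [map_add, map_brF, map_zero, rhoF_gi, genMap]
    exact this
  | oscP m n k u h3 hM hN =>
    have := hr (rel.oscP m n k u h3 hM hN)
    simp only [map_add, map_oscOf, map_zero] at this
    simp only [map_add, map_oscOf, map_zero, rhoF_Xp, oscOf_smul]
    rw [← smul_add]
    exact (congrArg _ this).trans (smul_zero _)
  | oscM m n k u h3 hM hN =>
    have := hr (rel.oscM m n k u h3 hM hN)
    simp only [map_add, map_oscOf, map_zero] at this
    simp only [map_add, map_oscOf, map_zero, rhoF_Xm]
    exact this
  | K0K0i he => simpa [rhoF_gi, genMap] using hK1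
  | K0iK0 he => simpa [rhoF_gi, genMap] using hK2
  | K0K he i =>
    simp only [map_mul, rhoF_gi, genMap, smul_mul_assoc, mul_smul_comm]
    exact congrArg _ (hKc (CI.K i))
  | K0Ki he i =>
    simp only [map_mul, rhoF_gi, genMap, smul_mul_assoc, mul_smul_comm]
    exact congrArg _ (hKc (CI.Ki i))
  | K0H he i s =>
    simp only [map_mul, rhoF_gi, genMap, smul_mul_assoc, mul_smul_comm]
    exact hKc (CI.H i s)
  | K0Xp he i n =>
    simp only [map_mul, map_smul, rhoF_gi, genMap, smul_mul_assoc, mul_smul_comm, hKp]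
    rw [smul_comm]
  | K0Xm he i n =>
    simp only [map_mul, map_smul, rhoF_gi, genMap, smul_mul_assoc, mul_smul_comm, hKm]

/-- existence of the twisted extended action. -/
lemma exists_rho' (hε : ∀ i, ε i * ε i = 1)
    (hK1 : K0 * K0i = 1) (hK2 : K0i * K0 = 1)
    (hKc : ∀ a : CI M N, K0 * ρ (gx q M N false a.gen) = ρ (gx q M N false a.gen) * K0)
    (hKp : ∀ j n, K0 * ρ (gx q M N false (Gen.Xp j n)) =
        (q ^ (if j.1 = 1 then (1 : ℤ) else 0)) • (ρ (gx q M N false (Gen.Xp j n)) * K0))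
    (hKm : ∀ j n, K0 * ρ (gx q M N false (Gen.Xm j n)) =
        (q ^ (if j.1 = 1 then (-1 : ℤ) else 0)) • (ρ (gx q M N false (Gen.Xm j n)) * K0)) :
    ∃ ρ' : ALG q M N true 3 →ₐ[ℂ] Module.End ℂ V,
      ∀ a, ρ' (mkA q M N true 3 a) = rhoF ρ ε K0 K0i a :=
  ⟨RingQuot.liftAlgHom ℂ ⟨rhoF ρ ε K0 K0i,
    fun {a b} h => rhoF_rel ρ ε K0 K0i hε hK1 hK2 hKc hKp hKm a b h⟩, fun a => by
      simp [mkA]⟩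
end stepD2
end QAS
end

section
set_option linter.unusedSectionVars false
set_option linter.unusedSimpArgs false
namespace QAS

section stepE
variable {q : ℂ} {M N : ℕ}
variable {Y : Type} [AddCommGroup Y] [Module ℂ Y]

lemma expC_mem {A : Type} [Ring A] [Algebra ℂ A] (S : Subalgebra ℂ A) (t : ℂ) (a : ℕ → A)
    (h : ∀ s, a s ∈ S) (n : ℕ) : expC t a n ∈ S := by
  induction n using Nat.strong_induction_on with
  | _ n ih =>
    rcases n with _ | n
    · rw [expC]; exact one_mem _
    · rw [expC]
      exact S.smul_mem (S.smul_mem (S.sum_mem fun s _ => S.smul_mem (S.mul_mem (h _)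
        (ih _ (by omega))) _) _) _

lemma expC_inv (t : ℂ) (ht : t ≠ 0) (a : ℕ → Module.End ℂ Y) (v : Y)
    (h : ∀ n, expC t a n v ∈ Submodule.span ℂ {v}) (s : ℕ) : a (s + 1) v ∈ Submodule.span ℂ {v} := by
  induction s using Nat.strong_induction_on with
  | _ n ih =>
    set L := Submodule.span ℂ {v} with hL
    have h1 := h (n + 1)
    have hn : (n : ℂ) + 1 ≠ 0 := by exact_mod_cast Nat.succ_ne_zero n
    rw [expC] at h1
    simp only [LinearMap.smul_apply, LinearMap.sum_apply, Module.End.mul_apply] at h1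
    rw [Submodule.smul_mem_iff _ (inv_ne_zero hn), Submodule.smul_mem_iff _ ht,
      Finset.sum_range_succ] at h1
    have h2 : ∑ x ∈ Finset.range n, ((x : ℂ) + 1) • a (x + 1) (expC t a (n - x) v) ∈ L := by
      refine L.sum_mem fun x hx => L.smul_mem _ ?_
      obtain ⟨c, hc⟩ := Submodule.mem_span_singleton.1 (h (n - x))
      rw [← hc, map_smul]
      exact L.smul_mem _ (ih x (Finset.mem_range.1 hx))
    have h3 := (L.add_mem_iff_right h2).1 h1
    rw [Submodule.smul_mem_iff _ hn] at h3
    simpa [expC] using h3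

/-- the filtration layers of a highest weight module. -/
def WW (ρ : ALG q M N true 3 →ₐ[ℂ] Module.End ℂ Y) (u : Y) : ℕ → Submodule ℂ Y
  | 0 => Submodule.span ℂ {u}
  | n + 1 => ⨆ p : Idx M N × ℤ, (WW ρ u n).map (ρ (gx q M N true (Gen.Xm p.1 p.2)))

variable (ρ : ALG q M N true 3 →ₐ[ℂ] Module.End ℂ Y) (u : Y)

lemma WW_xm (n : ℕ) (j : Idx M N) (k : ℤ) (w : Y) (hw : w ∈ WW ρ u n) :
    ρ (gx q M N true (Gen.Xm j k)) w ∈ WW ρ u (n + 1) :=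
  Submodule.mem_iSup_of_mem (p := fun p : Idx M N × ℤ =>
    (WW ρ u n).map (ρ (gx q M N true (Gen.Xm p.1 p.2)))) (j, k) (Submodule.mem_map_of_mem hw)

lemma WW_le (n : ℕ) (S : Submodule ℂ Y)
    (h : ∀ j k, ∀ w ∈ WW ρ u n, ρ (gx q M N true (Gen.Xm j k)) w ∈ S) : WW ρ u (n + 1) ≤ S := by
  refine iSup_le fun p => ?_
  rintro _ ⟨w, hw, rfl⟩
  exact h p.1 p.2 w hw

/-- stabilizer of the layers. -/
def Stab : Subalgebra ℂ (ALG q M N true 3) where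
  carrier := {a | ∀ n, ∀ w ∈ WW ρ u n, ρ a w ∈ WW ρ u n}
  mul_mem' := fun {a b} ha hb n w hw => by simpa using ha n _ (hb n w hw)
  add_mem' := fun {a b} ha hb n w hw => by simpa using Submodule.add_mem _ (ha n w hw) (hb n w hw)
  algebraMap_mem' := fun c n w hw => by
    simpa [Algebra.algebraMap_eq_smul_one] using Submodule.smul_mem _ c hw

lemma Stab_of (a : ALG q M N true 3) (h0 : ρ a u ∈ Submodule.span ℂ {u})
    (h : ∀ j k, ∀ n, (∀ w ∈ WW ρ u n, ρ a w ∈ WW ρ u n) → ∀ w ∈ WW ρ u n,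
      ρ (a * gx q M N true (Gen.Xm j k)) w ∈ WW ρ u (n + 1)) : a ∈ Stab ρ u := by
  intro n
  induction n with
  | zero =>
    intro w hw
    obtain ⟨c, rfl⟩ := Submodule.mem_span_singleton.1 hw
    rw [map_smul]
    exact Submodule.smul_mem _ _ h0
  | succ n ih =>
    have : WW ρ u (n + 1) ≤ (WW ρ u (n + 1)).comap (ρ a) := by
      apply WW_le
      intro j k w hw
      have := h j k n ih w hw
      rw [map_mul] at this
      exact this
    exact this

lemma Stab_skew (a : ALG q M N true 3) (h0 : ρ a u ∈ Submodule.span ℂ {u}) (r : Idx M N → ℂ)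
    (h : ∀ j k, a * gx q M N true (Gen.Xm j k) = r j • (gx q M N true (Gen.Xm j k) * a)) :
    a ∈ Stab ρ u := by
  refine Stab_of ρ u a h0 fun j k n ih w hw => ?_
  rw [h, map_smul, map_mul, LinearMap.smul_apply, Module.End.mul_apply]
  exact Submodule.smul_mem _ _ (WW_xm ρ u n j k _ (ih w hw))

lemma gK0Xm (i : Idx M N) (n : ℤ) : gx q M N true (Gen.K0 rfl) * gx q M N true (Gen.Xm i n) =
    (q ^ (if i.1 = 1 then (-1 : ℤ) else 0)) •
      (gx q M N true (Gen.Xm i n) * gx q M N true (Gen.K0 rfl)) := by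
  have := mkA_rel (rel.K0Xm (q := q) (lvl := 3) rfl i n)
  simp only [map_mul, map_smul] at this
  exact this
lemma gK0K0i : gx q M N true (Gen.K0 rfl) * gx q M N true (Gen.K0i rfl) = 1 := by
  simpa [gx] using mkA_rel (rel.K0K0i (q := q) (M := M) (N := N) (lvl := 3) rfl)
lemma gK0iK0 : gx q M N true (Gen.K0i rfl) * gx q M N true (Gen.K0 rfl) = 1 := by
  simpa [gx] using mkA_rel (rel.K0iK0 (q := q) (M := M) (N := N) (lvl := 3) rfl)

lemma inv_span {A Ai : Module.End ℂ Y} (h : Ai * A = 1) (hA : A u ∈ Submodule.span ℂ {u}) :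
    Ai u ∈ Submodule.span ℂ {u} := by
  obtain ⟨c, hc⟩ := Submodule.mem_span_singleton.1 hA
  have h1 := LinearMap.congr_fun h u
  rw [Module.End.mul_apply, ← hc, map_smul, Module.End.one_apply] at h1
  by_cases h0 : c = 0
  · rw [h0, zero_smul] at h1
    rw [← h1]; simp
  · rw [← Submodule.smul_mem_iff _ h0, h1]; exact Submodule.mem_span_singleton_self u


lemma Stab_K (hq0 : q ≠ 0) (hx : ∀ i n, ρ (gx q M N true (Gen.Xp i n)) u = 0)
  (hK : ∀ i, ρ (gx q M N true (Gen.K i)) u ∈ Submodule.span ℂ {u})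
  (hH : ∀ i s, ρ (gx q M N true (Gen.H i s)) u ∈ Submodule.span ℂ {u})
  (hK0 : ρ (gx q M N true (Gen.K0 rfl)) u = u)
    (i : Idx M N) : gx q M N true (Gen.K i) ∈ Stab ρ u :=
  Stab_skew ρ u _ (hK i) (fun j => q ^ (-cc M i.1 j.1)) (gKXm i)
lemma Stab_Ki (hq0 : q ≠ 0) (hx : ∀ i n, ρ (gx q M N true (Gen.Xp i n)) u = 0)
  (hK : ∀ i, ρ (gx q M N true (Gen.K i)) u ∈ Submodule.span ℂ {u})
  (hH : ∀ i s, ρ (gx q M N true (Gen.H i s)) u ∈ Submodule.span ℂ {u})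
  (hK0 : ρ (gx q M N true (Gen.K0 rfl)) u = u)
    (i : Idx M N) : gx q M N true (Gen.Ki i) ∈ Stab ρ u :=
  Stab_skew ρ u _ (inv_span u (by rw [← map_mul, gKiK, map_one]) (hK i)) _
    fun j n => swap_inv (zpow_ne_zero _ hq0) (gKKi i) (gKiK i) (gKXm i j n)
lemma Stab_H (hq0 : q ≠ 0) (hx : ∀ i n, ρ (gx q M N true (Gen.Xp i n)) u = 0)
  (hK : ∀ i, ρ (gx q M N true (Gen.K i)) u ∈ Submodule.span ℂ {u})
  (hH : ∀ i s, ρ (gx q M N true (Gen.H i s)) u ∈ Submodule.span ℂ {u})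
  (hK0 : ρ (gx q M N true (Gen.K0 rfl)) u = u)
    (i : Idx M N) (s) : gx q M N true (Gen.H i s) ∈ Stab ρ u := by
  refine Stab_of ρ u _ (hH i s) fun j k n ih w hw => ?_
  rw [eq_add_of_sub_eq' (gHXm i j s k), map_add, map_neg, map_smul, map_mul, LinearMap.add_apply,
    LinearMap.neg_apply, LinearMap.smul_apply, Module.End.mul_apply]
  exact Submodule.add_mem _ (WW_xm ρ u n _ _ _ (ih w hw)) (Submodule.neg_mem _
    (Submodule.smul_mem _ _ (WW_xm ρ u n _ _ _ hw)))
lemma Stab_K0 (hq0 : q ≠ 0) (hx : ∀ i n, ρ (gx q M N true (Gen.Xp i n)) u = 0)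
  (hK : ∀ i, ρ (gx q M N true (Gen.K i)) u ∈ Submodule.span ℂ {u})
  (hH : ∀ i s, ρ (gx q M N true (Gen.H i s)) u ∈ Submodule.span ℂ {u})
  (hK0 : ρ (gx q M N true (Gen.K0 rfl)) u = u)
    : gx q M N true (Gen.K0 rfl) ∈ Stab ρ u :=
  Stab_skew ρ u _ (by rw [hK0]; exact Submodule.mem_span_singleton_self u) _ gK0Xm
lemma Stab_K0i (hq0 : q ≠ 0) (hx : ∀ i n, ρ (gx q M N true (Gen.Xp i n)) u = 0)
  (hK : ∀ i, ρ (gx q M N true (Gen.K i)) u ∈ Submodule.span ℂ {u})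
  (hH : ∀ i s, ρ (gx q M N true (Gen.H i s)) u ∈ Submodule.span ℂ {u})
  (hK0 : ρ (gx q M N true (Gen.K0 rfl)) u = u)
    : gx q M N true (Gen.K0i rfl) ∈ Stab ρ u :=
  Stab_skew ρ u _ (inv_span u (by rw [← map_mul, gK0iK0, map_one])
    (by rw [hK0]; exact Submodule.mem_span_singleton_self u)) _
    fun j n => swap_inv (zpow_ne_zero _ hq0) gK0K0i gK0iK0 (gK0Xm j n)
lemma Stab_HA (hq0 : q ≠ 0) (hx : ∀ i n, ρ (gx q M N true (Gen.Xp i n)) u = 0)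
  (hK : ∀ i, ρ (gx q M N true (Gen.K i)) u ∈ Submodule.span ℂ {u})
  (hH : ∀ i s, ρ (gx q M N true (Gen.H i s)) u ∈ Submodule.span ℂ {u})
  (hK0 : ρ (gx q M N true (Gen.K0 rfl)) u = u)
    (i : Idx M N) (s : ℤ) : HA q M N true 3 i.1 s ∈ Stab ρ u := by
  by_cases hs : s = 0
  · subst hs; simp [HA, HF]
  · rw [HA_eq i ⟨s, hs⟩]; exact Stab_H ρ u hq0 hx hK hH hK0 i _
lemma Stab_phiP (hq0 : q ≠ 0) (hx : ∀ i n, ρ (gx q M N true (Gen.Xp i n)) u = 0)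
  (hK : ∀ i, ρ (gx q M N true (Gen.K i)) u ∈ Submodule.span ℂ {u})
  (hH : ∀ i s, ρ (gx q M N true (Gen.H i s)) u ∈ Submodule.span ℂ {u})
  (hK0 : ρ (gx q M N true (Gen.K0 rfl)) u = u)
    (i : Idx M N) (n : ℤ) : phiPA q M N true 3 i.1 n ∈ Stab ρ u := by
  rcases lt_or_ge n 0 with hn | hn
  · rw [phiPA_neg _ n hn]; exact zero_mem _
  · obtain ⟨n, rfl⟩ := Int.eq_ofNat_of_zero_le hn
    rw [phiPA_nonneg]
    exact mul_mem (Stab_K ρ u hq0 hx hK hH hK0 i)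
      (expC_mem _ _ _ (fun s => Stab_HA ρ u hq0 hx hK hH hK0 i _) n)
lemma Stab_phiM (hq0 : q ≠ 0) (hx : ∀ i n, ρ (gx q M N true (Gen.Xp i n)) u = 0)
  (hK : ∀ i, ρ (gx q M N true (Gen.K i)) u ∈ Submodule.span ℂ {u})
  (hH : ∀ i s, ρ (gx q M N true (Gen.H i s)) u ∈ Submodule.span ℂ {u})
  (hK0 : ρ (gx q M N true (Gen.K0 rfl)) u = u)
    (i : Idx M N) (n : ℤ) : phiMA q M N true 3 i.1 n ∈ Stab ρ u := by
  rcases lt_or_ge 0 n with hn | hn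
  · rw [phiMA_pos _ n hn]; exact zero_mem _
  · obtain ⟨n, rfl⟩ : ∃ m : ℕ, n = -(m : ℤ) := ⟨(-n).toNat, by omega⟩
    rw [phiMA_nonpos]
    exact mul_mem (Stab_Ki ρ u hq0 hx hK hH hK0 i)
      (expC_mem _ _ _ (fun s => Stab_HA ρ u hq0 hx hK hH hK0 i _) n)

lemma WW_xp0 (hq0 : q ≠ 0) (hx : ∀ i n, ρ (gx q M N true (Gen.Xp i n)) u = 0)
  (hK : ∀ i, ρ (gx q M N true (Gen.K i)) u ∈ Submodule.span ℂ {u})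
  (hH : ∀ i s, ρ (gx q M N true (Gen.H i s)) u ∈ Submodule.span ℂ {u})
  (hK0 : ρ (gx q M N true (Gen.K0 rfl)) u = u)
    (i : Idx M N) (m : ℤ) (w : Y) (hw : w ∈ WW ρ u 0) :
    ρ (gx q M N true (Gen.Xp i m)) w = 0 := by
  obtain ⟨c, rfl⟩ := Submodule.mem_span_singleton.1 hw
  rw [map_smul, hx, smul_zero]

lemma WW_xp (hq0 : q ≠ 0) (hx : ∀ i n, ρ (gx q M N true (Gen.Xp i n)) u = 0)
  (hK : ∀ i, ρ (gx q M N true (Gen.K i)) u ∈ Submodule.span ℂ {u})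
  (hH : ∀ i s, ρ (gx q M N true (Gen.H i s)) u ∈ Submodule.span ℂ {u})
  (hK0 : ρ (gx q M N true (Gen.K0 rfl)) u = u)
    (i : Idx M N) (m : ℤ) (n : ℕ) : ∀ w ∈ WW ρ u (n + 1),
    ρ (gx q M N true (Gen.Xp i m)) w ∈ WW ρ u n := by
  have key : ∀ n, (∀ j k, ∀ w ∈ WW ρ u n, ρ (gx q M N true (Gen.Xm j k))
      (ρ (gx q M N true (Gen.Xp i m)) w) ∈ WW ρ u n) →
      WW ρ u (n + 1) ≤ (WW ρ u n).comap (ρ (gx q M N true (Gen.Xp i m))) := by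
    intro n hn
    apply WW_le
    intro j k w hw
    have h2 := LinearMap.congr_fun (congrArg ρ (eq_add_of_sub_eq' (gXpXm (q := q) i j m k))) w
    rw [map_mul, map_add, map_smul, map_mul, LinearMap.add_apply, LinearMap.smul_apply,
      Module.End.mul_apply, Module.End.mul_apply] at h2
    rw [Submodule.mem_comap, h2]
    refine Submodule.add_mem _ (Submodule.smul_mem _ _ (hn j k w hw)) ?_
    have : (if i = j then (qpar q M i.1 - (qpar q M i.1)⁻¹)⁻¹ •
      (phiPA q M N true 3 i.1 (m + k) - phiMA q M N true 3 i.1 (m + k)) else 0) ∈ Stab ρ u := by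
      split_ifs
      · exact Subalgebra.smul_mem _ (sub_mem (Stab_phiP ρ u hq0 hx hK hH hK0 i _)
          (Stab_phiM ρ u hq0 hx hK hH hK0 i _)) _
      · exact zero_mem _
    exact this n w hw
  induction n with
  | zero =>
    refine key 0 fun j k w hw => ?_
    rw [WW_xp0 ρ u hq0 hx hK hH hK0 i m w hw, map_zero]; exact Submodule.zero_mem _
  | succ n ih =>
    exact key (n + 1) fun j k w hw => WW_xm ρ u n j k _ (ih w hw)

lemma WW_top (hq0 : q ≠ 0) (hx : ∀ i n, ρ (gx q M N true (Gen.Xp i n)) u = 0)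
  (hK : ∀ i, ρ (gx q M N true (Gen.K i)) u ∈ Submodule.span ℂ {u})
  (hH : ∀ i s, ρ (gx q M N true (Gen.H i s)) u ∈ Submodule.span ℂ {u})
  (hK0 : ρ (gx q M N true (Gen.K0 rfl)) u = u)
    (hgen : ∀ y, ∃ a, ρ a u = y) : (⨆ n, WW ρ u n) = ⊤ := by
  rw [eq_top_iff]
  rintro y -
  obtain ⟨a, rfl⟩ := hgen y
  refine alg_stable ρ _ ?_ a u (Submodule.mem_iSup_of_mem 0 (Submodule.mem_span_singleton_self u))
  intro g w hw
  induction hw using Submodule.iSup_induction' with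
  | mem n x hx' =>
    rcases g with ⟨j, k⟩ | ⟨j, k⟩ | i | i | ⟨i, s⟩ | h | h
    · rcases n with _ | n
      · rw [WW_xp0 ρ u hq0 hx hK hH hK0 j k x hx']; exact Submodule.zero_mem _
      · exact Submodule.mem_iSup_of_mem _ (WW_xp ρ u hq0 hx hK hH hK0 j k n x hx')
    · exact Submodule.mem_iSup_of_mem _ (WW_xm ρ u n j k x hx')
    · exact Submodule.mem_iSup_of_mem _ (Stab_K ρ u hq0 hx hK hH hK0 i n x hx')
    · exact Submodule.mem_iSup_of_mem _ (Stab_Ki ρ u hq0 hx hK hH hK0 i n x hx')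
    · exact Submodule.mem_iSup_of_mem _ (Stab_H ρ u hq0 hx hK hH hK0 i s n x hx')
    · exact Submodule.mem_iSup_of_mem _ (Stab_K0 ρ u hq0 hx hK hH hK0 n x hx')
    · exact Submodule.mem_iSup_of_mem _ (Stab_K0i ρ u hq0 hx hK hH hK0 n x hx')
  | zero => rw [map_zero]; exact Submodule.zero_mem _
  | add x y _ _ hx hy => rw [map_add]; exact Submodule.add_mem _ hx hy

lemma exists_proj (hq0 : q ≠ 0) (hx : ∀ i n, ρ (gx q M N true (Gen.Xp i n)) u = 0)
  (hK : ∀ i, ρ (gx q M N true (Gen.K i)) u ∈ Submodule.span ℂ {u})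
  (hH : ∀ i s, ρ (gx q M N true (Gen.H i s)) u ∈ Submodule.span ℂ {u})
  (hK0 : ρ (gx q M N true (Gen.K0 rfl)) u = u)
    (hq1 : ∀ k : ℕ, k ≠ 0 → q ^ k ≠ 1) (hM : 1 ≤ M) (hN : 1 ≤ N) (hMN : M ≠ N)
    (hu : u ≠ 0) (hgen : ∀ y, ∃ a, ρ a u = y) :
    ∃ (B : ℕ → ALG q M N true 3) (C : ℕ → ℂ), (∀ L, C L ≠ 0) ∧ (∀ L, ρ (B L) u = C L • u) ∧
      ∀ y, ∃ L c, ρ (B L) y = (c * C L) • u := by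
  obtain ⟨T, Ti, hT⟩ := exists_height (q := q) (M := M) (N := N) (ext := true) hq0 hM hN
  set d : ℤ := (M : ℤ) - N with hd
  have hd0 : d ≠ 0 := by omega
  have hKi : ∀ i, ρ (gx q M N true (Gen.Ki i)) u ∈ Submodule.span ℂ {u} := fun i =>
    inv_span u (by rw [← map_mul, gKiK, map_one]) (hK i)
  obtain ⟨τ, hτ⟩ := CS_eigen ρ u
    (fun i => (Submodule.mem_span_singleton.1 (hK i)).imp fun _ h => h.symm)
    (fun i => (Submodule.mem_span_singleton.1 (hKi i)).imp fun _ h => h.symm) T hT.memT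
  have hτ0 : τ ≠ 0 := by
    rintro rfl
    apply hu
    have := LinearMap.congr_fun (congrArg ρ hT.inv2) u
    simpa [hτ] using this.symm
  let r : ℕ → ℂ := fun n => τ * q ^ (-d * (n : ℤ))
  have hW : ∀ n, WW ρ u n ≤ Module.End.eigenspace (ρ T) (r n) := by
    intro n
    induction n with
    | zero =>
      intro w hw
      obtain ⟨c, rfl⟩ := Submodule.mem_span_singleton.1 hw
      rw [Module.End.mem_eigenspace_iff, map_smul, hτ, smul_comm]; simp [r]
    | succ n ih =>
      apply WW_le
      intro j k w hw
      have h1 := Module.End.mem_eigenspace_iff.1 (ih hw)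
      have h2 := LinearMap.congr_fun (congrArg ρ (hT.xm j k)) w
      simp only [map_mul, map_smul, Module.End.mul_apply, LinearMap.smul_apply] at h2
      rw [Module.End.mem_eigenspace_iff, h2, h1, map_smul, smul_smul]
      congr 1
      simp only [r]; push_cast; rw [mul_add, mul_one, zpow_add₀ hq0]; ring
  have hinj : ∀ m n : ℕ, r m = r n → m = n := by
    intro m n h
    exact_mod_cast mul_left_cancel₀ (neg_ne_zero.2 hd0) (pow_inj_of q hq0 hq1 (mul_left_cancel₀ hτ0 h))
  let p : ℕ → Polynomial ℂ := fun L => ∏ n ∈ Finset.range L, (Polynomial.X - Polynomial.C (r (n + 1)))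
  have hp : ∀ L n, ∀ w ∈ WW ρ u n, ρ (Polynomial.aeval T (p L)) w = ((p L).eval (r n)) • w := by
    intro L n w hw
    by_cases h0 : w = 0
    · simp [h0]
    · rw [← Polynomial.aeval_algHom_apply]
      exact Module.End.aeval_apply_of_hasEigenvector ⟨hW n hw, h0⟩
  have hev : ∀ L x, (p L).eval x = ∏ n ∈ Finset.range L, (x - r (n + 1)) := by
    intro L x; simp [p, Polynomial.eval_prod]
  have hu0 : u ∈ WW ρ u 0 := Submodule.mem_span_singleton_self u
  refine ⟨fun L => Polynomial.aeval T (p L), fun L => (p L).eval (r 0), fun L => ?_,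
    fun L => hp L 0 u hu0, fun y => ?_⟩
  · change (p L).eval (r 0) ≠ 0
    rw [hev, Finset.prod_ne_zero_iff]
    intro n _ h
    have := hinj _ _ (sub_eq_zero.1 h)
    omega
  · have hy : y ∈ ⨆ n, WW ρ u n := by rw [WW_top ρ u hq0 hx hK hH hK0 hgen]; trivial
    have : ∃ L c, ∀ L', L ≤ L' → ρ (Polynomial.aeval T (p L')) y = (c * (p L').eval (r 0)) • u := by
      induction hy using Submodule.iSup_induction' with
      | mem n x hx' =>
        rcases n with _ | n
        · obtain ⟨c, rfl⟩ := Submodule.mem_span_singleton.1 hx'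
          exact ⟨0, c, fun L _ => by rw [map_smul, hp L 0 u hu0, smul_smul]⟩
        · refine ⟨n + 1, 0, fun L hL => ?_⟩
          rw [hp L _ x hx', hev, Finset.prod_eq_zero (Finset.mem_range.2 (show n < L by omega)) (sub_self _)]
          simp
      | zero => exact ⟨0, 0, by simp⟩
      | add x y _ _ hx hy =>
        obtain ⟨L1, c1, h1⟩ := hx
        obtain ⟨L2, c2, h2⟩ := hy
        exact ⟨max L1 L2, c1 + c2, fun L hL => by
          rw [map_add, h1 L (le_trans (le_max_left _ _) hL), h2 L (le_trans (le_max_right _ _) hL),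
            add_mul, add_smul]⟩
    obtain ⟨L, c, h⟩ := this
    exact ⟨L, c, h L le_rfl⟩
end stepE
end QAS
end

section
set_option linter.unusedSectionVars false
set_option linter.unusedSimpArgs false
namespace QAS

section stepE
variable {q : ℂ} {M N : ℕ}
variable {Y : Type} [AddCommGroup Y] [Module ℂ Y]

lemma mem_of_sub_smul (A : Module.End ℂ Y) (u : Y) (c : ℂ) (h : A u - c • u = 0) :
    A u ∈ Submodule.span ℂ {u} := by
  rw [sub_eq_zero.1 h]
  exact Submodule.smul_mem _ _ (Submodule.mem_span_singleton_self u)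

lemma map_span_self {A : Module.End ℂ Y} {u w : Y} (hA : A u ∈ Submodule.span ℂ {u})
    (hw : w ∈ Submodule.span ℂ {u}) : A w ∈ Submodule.span ℂ {u} := by
  obtain ⟨c, rfl⟩ := Submodule.mem_span_singleton.1 hw
  rw [map_smul]
  exact Submodule.smul_mem _ _ hA

lemma verma_conds (ρ : ALG q M N true 3 →ₐ[ℂ] Module.End ℂ Y) (u : Y) (hq0 : q ≠ 0)
    (hq1 : ∀ k : ℕ, k ≠ 0 → q ^ k ≠ 1) (Λ : HW q M N)
    (h : ∀ x ∈ vermaRels q M N true Λ, ρ x u = 0) :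
    (∀ i n, ρ (gx q M N true (Gen.Xp i n)) u = 0) ∧
    (∀ i, ρ (gx q M N true (Gen.K i)) u ∈ Submodule.span ℂ {u}) ∧
    (∀ i s, ρ (gx q M N true (Gen.H i s)) u ∈ Submodule.span ℂ {u}) ∧
    ρ (gx q M N true (Gen.K0 rfl)) u = u := by
  have hx : ∀ i n, ρ (gx q M N true (Gen.Xp i n)) u = 0 := fun i n => by
    rw [← XpA_eq]
    exact h _ (Or.inl (Or.inl (Or.inl (Or.inl ⟨_, _, rfl⟩))))
  have hP : ∀ (i : Idx M N), i.1 ≠ M → ∀ n,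
      ρ (phiPA q M N true 3 i.1 n) u ∈ Submodule.span ℂ {u} := fun i hi n => by
    have := h _ (Or.inl (Or.inl (Or.inl (Or.inr ⟨i.1, n, i.2.1, i.2.2, hi, Or.inl rfl⟩))))
    refine mem_of_sub_smul _ _ (gammaP q M i (Λ.P i) n) ?_
    simpa [Module.algebraMap_end_apply] using this
  have hMm : ∀ (i : Idx M N), i.1 ≠ M → ∀ n,
      ρ (phiMA q M N true 3 i.1 n) u ∈ Submodule.span ℂ {u} := fun i hi n => by
    have := h _ (Or.inl (Or.inl (Or.inl (Or.inr ⟨i.1, n, i.2.1, i.2.2, hi, Or.inr rfl⟩))))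
    refine mem_of_sub_smul _ _ (gammaM q M i (Λ.P i) n) ?_
    simpa [Module.algebraMap_end_apply] using this
  have hKM : ρ (KA q M N true 3 M) u ∈ Submodule.span ℂ {u} := by
    have := h _ (Or.inl (Or.inl (Or.inr rfl)))
    refine mem_of_sub_smul _ _ Λ.c ?_
    simpa [Module.algebraMap_end_apply] using this
  have hf : ∀ n, ρ (phiPA q M N true 3 M n) u - ρ (phiMA q M N true 3 M n) u
      ∈ Submodule.span ℂ {u} := fun n => by
    have := h _ (Or.inl (Or.inr ⟨n, rfl⟩))
    have h2 := mem_of_sub_smul (ρ (phiPA q M N true 3 M n - phiMA q M N true 3 M n)) u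
      ((q - q⁻¹) * Λ.f n) (by
        rw [map_sub, LinearMap.sub_apply, AlgHom.commutes, Module.algebraMap_end_apply] at this
        exact this)
    rwa [map_sub, LinearMap.sub_apply] at h2
  have hK : ∀ i, ρ (gx q M N true (Gen.K i)) u ∈ Submodule.span ℂ {u} := fun i => by
    by_cases hi : i.1 = M
    · rw [← KA_eq, hi]; exact hKM
    · rw [← phiPA_zero]; exact hP i hi 0
  have hKi : ∀ i, ρ (gx q M N true (Gen.Ki i)) u ∈ Submodule.span ℂ {u} := fun i =>
    inv_span u (by rw [← map_mul, gKiK, map_one]) (hK i)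
  have hP' : ∀ (i : Idx M N) (n : ℕ),
      ρ (phiPA q M N true 3 i.1 n) u ∈ Submodule.span ℂ {u} := fun i n => by
    by_cases hi : i.1 = M
    · rcases n with _ | n
      · rw [Nat.cast_zero, phiPA_zero]; exact hK i
      · have := hf ((n + 1 : ℕ) : ℤ)
        rw [phiMA_pos M _ (by positivity), map_zero, LinearMap.zero_apply, sub_zero] at this
        rw [hi]; exact this
    · exact hP i hi n
  have hM' : ∀ (i : Idx M N) (n : ℕ),
      ρ (phiMA q M N true 3 i.1 (-(n : ℤ))) u ∈ Submodule.span ℂ {u} := fun i n => by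
    by_cases hi : i.1 = M
    · rcases n with _ | n
      · rw [Nat.cast_zero, neg_zero, phiMA_zero]; exact hKi i
      · have := hf (-((n + 1 : ℕ) : ℤ))
        rw [phiPA_neg M _ (by push_cast; omega), map_zero, LinearMap.zero_apply, zero_sub] at this
        rw [hi]; exact (Submodule.neg_mem_iff _).1 this
    · exact hMm i hi _
  have hep : ∀ (i : Idx M N) (n : ℕ), expC (qpar q M i.1 - (qpar q M i.1)⁻¹)
      (fun s : ℕ => ρ (HA q M N true 3 i.1 s)) n u ∈ Submodule.span ℂ {u} := fun i n => by
    have := map_span_self (hKi i) (hP' i n)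
    rw [phiPA_nonneg, ← Module.End.mul_apply, ← map_mul, ← mul_assoc, gKiK, one_mul,
      map_expC] at this
    exact this
  have hem : ∀ (i : Idx M N) (n : ℕ), expC (-(qpar q M i.1 - (qpar q M i.1)⁻¹))
      (fun s : ℕ => ρ (HA q M N true 3 i.1 (-(s : ℤ)))) n u ∈ Submodule.span ℂ {u} := fun i n => by
    have := map_span_self (hK i) (hM' i n)
    rw [phiMA_nonpos, ← Module.End.mul_apply, ← map_mul, ← mul_assoc, gKKi, one_mul,
      map_expC] at this
    exact this
  refine ⟨hx, hK, fun i s => ?_, ?_⟩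
  · have hne := qpar_sub_ne (M := M) hq0 hq1 i.1
    rw [← HA_eq]
    obtain ⟨s, hs⟩ := s
    rcases lt_or_gt_of_ne hs with h0 | h0
    · obtain ⟨n, rfl⟩ : ∃ n : ℕ, s = -((n + 1 : ℕ) : ℤ) := ⟨(-s - 1).toNat, by omega⟩
      exact expC_inv _ (neg_ne_zero.2 hne) _ u (hem i) n
    · obtain ⟨n, rfl⟩ : ∃ n : ℕ, s = ((n + 1 : ℕ) : ℤ) := ⟨(s - 1).toNat, by omega⟩
      exact expC_inv _ hne _ u (hep i) n
  · have := h _ (Or.inr ⟨rfl, rfl⟩)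
    rw [map_sub, map_one, LinearMap.sub_apply, Module.End.one_apply, sub_eq_zero] at this
    have h3 : K0A q M N true 3 = gx q M N true (Gen.K0 rfl) := by simp [K0A, K0F, gx]
    rwa [h3] at this

lemma vgen_gen (Λ : HW q M N) (y : VermaMod q M N true Λ) :
    ∃ a : ALG q M N true 3, a • vgen q M N Λ = y := by
  obtain ⟨a, rfl⟩ := Submodule.Quotient.mk_surjective _ y
  refine ⟨a, ?_⟩
  change Submodule.Quotient.mk (a • 1) = _
  rw [smul_eq_mul, mul_one]

lemma vgen_kill (Λ : HW q M N) (x : ALG q M N true 3) (hx : x ∈ vermaRels q M N true Λ) :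
    x • vgen q M N Λ = 0 := by
  change Submodule.Quotient.mk (x • (1 : ALG q M N true 3)) = _
  rw [smul_eq_mul, mul_one]
  exact (Submodule.Quotient.mk_eq_zero _).2 (Ideal.subset_span hx)

lemma simple_iso (hq0 : q ≠ 0)
    (hq1 : ∀ k : ℕ, k ≠ 0 → q ^ k ≠ 1) (hM : 1 ≤ M) (hN : 1 ≤ N) (hMN : M ≠ N) (Λ : HW q M N)
    {V : Type} [AddCommGroup V] [Module (ALG q M N true 3) V] [Module ℂ V]
    [IsScalarTower ℂ (ALG q M N true 3) V] (v : V) (hv : v ≠ 0)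
    (hkill : ∀ x ∈ vermaRels q M N true Λ, x • v = 0)
    (hs : ∀ x : V, x ≠ 0 → ∀ y, ∃ a : ALG q M N true 3, a • x = y) :
    ∃ _ : V ≃ₗ[ALG q M N true 3] SimpMod q M N Λ, True := by
  let F : VermaMod q M N true Λ →ₗ[ALG q M N true 3] V :=
    Submodule.liftQ (vermaIdeal q M N true Λ)
      (LinearMap.toSpanSingleton (ALG q M N true 3) V v) (by
        refine Submodule.span_le.2 fun x hx => ?_
        change LinearMap.toSpanSingleton (ALG q M N true 3) V v x = 0
        rw [LinearMap.toSpanSingleton_apply]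
        exact hkill x hx)
  have hF : F (vgen q M N Λ) = v := by
    change LinearMap.toSpanSingleton (ALG q M N true 3) V v 1 = v
    rw [LinearMap.toSpanSingleton_apply, one_smul]
  have hu : vgen q M N Λ ≠ 0 := fun h => hv (by rw [← hF, h, map_zero])
  have hsurj : Function.Surjective F := fun y => by
    obtain ⟨a, ha⟩ := hs v hv y
    exact ⟨a • vgen q M N Λ, by rw [map_smul, hF, ha]⟩
  let ρ : ALG q M N true 3 →ₐ[ℂ] Module.End ℂ (VermaMod q M N true Λ) :=
    Algebra.lsmul ℂ ℂ (VermaMod q M N true Λ)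
  have hρ : ∀ a y, ρ a y = a • y := fun a y => rfl
  obtain ⟨hx, hK, hH, hK0⟩ := verma_conds ρ (vgen q M N Λ) hq0 hq1 Λ
    (fun x hx => vgen_kill Λ x hx)
  obtain ⟨B, C, hC, hBu, hBy⟩ := exists_proj ρ (vgen q M N Λ) hq0 hx hK hH hK0 hq1 hM hN hMN hu
    (vgen_gen Λ)
  have hFc : ∀ (c : ℂ) y, F (c • y) = c • F y := fun c y => by
    rw [← algebraMap_smul (ALG q M N true 3) c y, map_smul, algebraMap_smul]
  have hcp : ∀ (p : Submodule (ALG q M N true 3) (VermaMod q M N true Λ)) (c : ℂ) y, y ∈ p →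
      c • y ∈ p := fun p c y hy => by
    rw [← algebraMap_smul (ALG q M N true 3) c y]
    exact p.smul_mem _ hy
  have hker : LinearMap.ker F = radV q M N Λ := by
    refine le_antisymm (le_sSup ?_) (sSup_le fun p hp x hxp => ?_)
    · intro h
      exact hv (hF ▸ h)
    · by_contra hFx
      obtain ⟨a, ha⟩ := hs (F x) hFx v
      have hy : a • x ∈ p := p.smul_mem _ hxp
      have hFy : F (a • x) = v := by rw [map_smul, ha]
      obtain ⟨L, c, hL⟩ := hBy (a • x)
      have h1 : F (ρ (B L) (a • x)) = C L • v := by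
        rw [hρ, map_smul, hFy, ← hF, ← map_smul, ← hρ, hBu, hFc]
      rw [hL, hFc, hF] at h1
      have h2 : c * C L = C L := smul_left_injective ℂ hv h1
      rw [h2] at hL
      have h3 : C L • vgen q M N Λ ∈ p := by
        rw [← hL, hρ]; exact p.smul_mem _ hy
      have h4 := hcp p (C L)⁻¹ _ h3
      rw [smul_smul, inv_mul_cancel₀ (hC L), one_smul] at h4
      exact hp h4
  exact ⟨(LinearMap.quotKerEquivOfSurjective F hsurj).symm.trans
    (Submodule.quotEquivOfEq _ _ hker), trivial⟩

end stepE
end QAS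
end

open QAS in
/-- Proposition 4.18 (a): when `MN > 0` and `M ≠ N`, every
finite-dimensional simple `U_q(Lsl(M,N))`-module is isomorphic to `π*ι* S'(P̲,f,c)` for
some `(P̲,f,c) ∈ R_{M,N}` and some `π ∈ D`: there is a ℂ-linear equivalence with
`S'(P̲,f,c)` intertwining the action of each `U`-generator with its `π`-twist. -/
theorem fd_simple_classification (q : ℂ) (hq0 : q ≠ 0)
    (hq1 : ∀ k : ℕ, k ≠ 0 → q ^ k ≠ 1) (M N : ℕ) (hM : 1 ≤ M) (hN : 1 ≤ N)
    (hMN : M ≠ N)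
    (V : Type) [AddCommGroup V] [Module (ALG q M N false 3) V] [Module ℂ V]
    [IsScalarTower ℂ (ALG q M N false 3) V] [FiniteDimensional ℂ V]
    [IsSimpleModule (ALG q M N false 3) V] :
    ∃ (Λ : HW q M N) (ε : ℕ → ℂ),
      (∀ i : ℕ, 1 ≤ i → i ≤ M + N - 1 → ε i = 1 ∨ ε i = -1) ∧ ε M = 1 ∧
      ∃ g : V ≃ₗ[ℂ] SimpMod q M N Λ,
        (∀ (i : ℕ) (n : ℤ) (v : V),
          g (XpA q M N false 3 i n • v) = ε i • (XpA q M N true 3 i n • g v)) ∧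
        (∀ (i : ℕ) (n : ℤ) (v : V),
          g (XmA q M N false 3 i n • v) = XmA q M N true 3 i n • g v) ∧
        (∀ (i : ℕ) (v : V),
          g (KA q M N false 3 i • v) = ε i • (KA q M N true 3 i • g v)) ∧
        (∀ (i : ℕ) (v : V),
          g (KiA q M N false 3 i • v) = ε i • (KiA q M N true 3 i • g v)) ∧
        (∀ (i : ℕ) (s : ℤ) (v : V),
          g (HA q M N false 3 i s • v) = HA q M N true 3 i s • g v) := by
  let ρ : ALG q M N false 3 →ₐ[ℂ] Module.End ℂ V := Algebra.lsmul ℂ ℂ V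
  have hρ : ∀ a y, ρ a y = a • y := fun a y => rfl
  have : Nontrivial V := IsSimpleModule.nontrivial (ALG q M N false 3) V
  have hsimple : ∀ W : Submodule ℂ V,
      (∀ g, ∀ w ∈ W, ρ (gx q M N false g) w ∈ W) → W ≠ ⊥ → W = ⊤ := by
    intro W hW hb
    let W' : Submodule (ALG q M N false 3) V :=
      { carrier := W
        add_mem' := fun ha hb => W.add_mem ha hb
        zero_mem' := W.zero_mem
        smul_mem' := fun a w hw => alg_stable ρ W hW a w hw }
    have hmem : ∀ x, x ∈ W' ↔ x ∈ W := fun x => Iff.rfl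
    rcases eq_bot_or_eq_top W' with h | h
    · refine absurd ?_ hb
      rw [eq_bot_iff]
      intro x hx
      have : x ∈ W' := hx
      rw [h] at this
      exact this
    · rw [eq_top_iff]
      intro x _
      have : x ∈ W' := by rw [h]; trivial
      exact this
  obtain ⟨v, hv, hx, hc⟩ := exists_hw hq0 hq1 hM hN hMN ρ
  obtain ⟨Λ, ε, hε, hεM, hphi, hKM, hf⟩ := exists_hwdata hq0 hq1 hM hN ρ v hv hx hc
  obtain ⟨K0, K0i, hK1, hK2, hKc, hKp, hKm, hKv⟩ := exists_K0 hq0 hq1 hM hN hMN ρ hsimple v hv hc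
  have hε2 : ∀ i, ε i * ε i = 1 := fun i => by rcases hε i with h | h <;> rw [h] <;> norm_num
  obtain ⟨ρ', hρ'⟩ := exists_rho' ρ ε K0 K0i hε2 hK1 hK2 hKc hKp hKm
  let _ : Module (ALG q M N true 3) V := Module.compHom V (ρ' : ALG q M N true 3 →+* Module.End ℂ V)
  have hsm : ∀ (a : ALG q M N true 3) (y : V), a • y = ρ' a y := fun a y => rfl
  have : IsScalarTower ℂ (ALG q M N true 3) V := ⟨fun c a y => by
    rw [hsm, hsm, map_smul, LinearMap.smul_apply]⟩
  have tXp : ∀ i n, ρ' (XpA q M N true 3 i n) = ε i • ρ (XpA q M N false 3 i n) := fun i n => by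
    rw [XpA, hρ', rhoF_Xp]
  have tXm : ∀ i n, ρ' (XmA q M N true 3 i n) = ρ (XmA q M N false 3 i n) := fun i n => by
    rw [XmA, hρ', rhoF_Xm]
  have tK : ∀ i, ρ' (KA q M N true 3 i) = ε i • ρ (KA q M N false 3 i) := fun i => by
    rw [KA, hρ', rhoF_K]
  have tKi : ∀ i, ρ' (KiA q M N true 3 i) = ε i • ρ (KiA q M N false 3 i) := fun i => by
    rw [KiA, hρ', rhoF_Ki]
  have tH : ∀ i s, ρ' (HA q M N true 3 i s) = ρ (HA q M N false 3 i s) := fun i s => by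
    rw [HA, hρ', rhoF_H]
  have tP : ∀ i n, ρ' (phiPA q M N true 3 i n) = ε i • ρ (phiPA q M N false 3 i n) := fun i n => by
    rw [phiPA, hρ', rhoF_phiP]
  have tM : ∀ i n, ρ' (phiMA q M N true 3 i n) = ε i • ρ (phiMA q M N false 3 i n) := fun i n => by
    rw [phiMA, hρ', rhoF_phiM]
  have tK0 : ρ' (K0A q M N true 3) = K0 := by
    have h3 : K0A q M N true 3 = mkA q M N true 3 (gi (Gen.K0 rfl)) := by simp [K0A, K0F]
    rw [h3, hρ', rhoF_gi]; rfl
  have hkill : ∀ x ∈ vermaRels q M N true Λ, x • v = 0 := by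
    rintro x ((((⟨i, n, rfl⟩ | ⟨i, n, h1, h2, h3, rfl | rfl⟩) | rfl) | ⟨n, rfl⟩) | ⟨-, rfl⟩)
    · rw [hsm, tXp, LinearMap.smul_apply]
      by_cases h : 1 ≤ i ∧ i ≤ M + N - 1
      · rw [XpA_eq (⟨i, h⟩ : Idx M N), hx, smul_zero]
      · simp [XpA, XpF, h]
    · rw [hsm, map_sub, tP, LinearMap.sub_apply, AlgHom.commutes, Module.algebraMap_end_apply,
        LinearMap.smul_apply, (hphi ⟨i, h1, h2⟩ h3 n).1, smul_smul, ← mul_assoc, hε2, one_mul,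
        sub_self]
    · rw [hsm, map_sub, tM, LinearMap.sub_apply, AlgHom.commutes, Module.algebraMap_end_apply,
        LinearMap.smul_apply, (hphi ⟨i, h1, h2⟩ h3 n).2, smul_smul, ← mul_assoc, hε2, one_mul,
        sub_self]
    · rw [hsm, map_sub, tK, LinearMap.sub_apply, AlgHom.commutes, Module.algebraMap_end_apply,
        hεM, one_smul, hKM, sub_self]
    · rw [hsm, map_sub, map_sub, tP, tM, LinearMap.sub_apply, LinearMap.sub_apply,
        AlgHom.commutes, Module.algebraMap_end_apply, hεM, one_smul, one_smul, hf, sub_self]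
    · rw [hsm, map_sub, tK0, map_one, LinearMap.sub_apply, Module.End.one_apply, hKv, sub_self]
  have hs : ∀ x : V, x ≠ 0 → ∀ y, ∃ a : ALG q M N true 3, a • x = y := by
    intro x hx0
    let W : Submodule ℂ V := LinearMap.range ((LinearMap.applyₗ x).comp ρ'.toLinearMap)
    have hmem : ∀ y, y ∈ W ↔ ∃ a, ρ' a x = y := fun y => Iff.rfl
    have hst : ∀ (a : ALG q M N true 3), ∀ w ∈ W, ρ' a w ∈ W := by
      rintro a w ⟨b, rfl⟩
      exact ⟨a * b, by simp⟩
    have hε' : ∀ i (w : V), ε i • ε i • w = w := fun i w => by rw [smul_smul, hε2, one_smul]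
    have hW : W = ⊤ := by
      refine hsimple W ?_ ?_
      · rintro g w hw
        cases g with
        | Xp i n =>
          have := W.smul_mem (ε i.1) (hst (XpA q M N true 3 i.1 n) w hw)
          rwa [tXp, LinearMap.smul_apply, hε', XpA_eq] at this
        | Xm i n =>
          have := hst (XmA q M N true 3 i.1 n) w hw
          rwa [tXm, XmA_eq] at this
        | K i =>
          have := W.smul_mem (ε i.1) (hst (KA q M N true 3 i.1) w hw)
          rwa [tK, LinearMap.smul_apply, hε', KA_eq] at this
        | Ki i =>
          have := W.smul_mem (ε i.1) (hst (KiA q M N true 3 i.1) w hw)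
          rwa [tKi, LinearMap.smul_apply, hε', KiA_eq] at this
        | H i s =>
          have := hst (HA q M N true 3 i.1 s.1) w hw
          rwa [tH, HA_eq] at this
        | K0 h => exact absurd h (by decide)
        | K0i h => exact absurd h (by decide)
      · intro h
        have : x ∈ W := ⟨1, by simp⟩
        rw [h] at this
        exact hx0 this
    intro y
    have : y ∈ W := by rw [hW]; trivial
    exact this
  obtain ⟨g, -⟩ := simple_iso hq0 hq1 hM hN hMN Λ v hv hkill hs
  have hgc : ∀ (c : ℂ) y, g (c • y) = c • g y := fun c y => by
    rw [← algebraMap_smul (ALG q M N true 3) c y, map_smul, algebraMap_smul]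
  let g' : V ≃ₗ[ℂ] SimpMod q M N Λ :=
    { g with
      map_smul' := hgc }
  have hg' : ∀ y, g' y = g y := fun y => rfl
  have key : ∀ i (a : ALG q M N false 3) (b : ALG q M N true 3), ρ' b = ε i • ρ a →
      ∀ w, g' (a • w) = ε i • (b • g' w) := by
    intro i a b h w
    rw [hg', hg', ← map_smul, ← hgc, hsm, h, LinearMap.smul_apply, smul_smul, hε2, one_smul, hρ]
  have key1 : ∀ (a : ALG q M N false 3) (b : ALG q M N true 3), ρ' b = ρ a →
      ∀ w, g' (a • w) = b • g' w := by
    intro a b h w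
    rw [hg', hg', ← map_smul, hsm, h, hρ]
  exact ⟨Λ, ε, fun i _ _ => hε i, hεM, g', fun i n => key i _ _ (tXp i n),
    fun i n => key1 _ _ (tXm i n), fun i => key i _ _ (tK i), fun i => key i _ _ (tKi i),
    fun i s => key1 _ _ (tH i s)⟩
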